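/- Let m ≥ 3 be an integer, q = 2^{2m}, γ = 1/(2^m − 2), and let α', α be real numbers with 2γ ≤ α' ≤ α ≤ 1/2 + γ. Then for every ε > 0 and every N there exist n ≥ N and 𝔽_q-linear codes C' ⊇ C ⊆ 𝔽_qⁿ such that: (i) C^⊥ ⊆ C, where C^⊥ = {x : Σᵢ xᵢ yᵢ = 0 for all y ∈ C}; (ii) dim_{𝔽_q} C' ≥ (1 − α' + γ − ε)·n and every nonzero codeword of C' has Hamming weight ≥ (α' − 2γ − ε)·n; and (iii) dim_{𝔽_q} C ≥ (1 − α + γ − ε)·n and every nonzero codeword of C has Hamming weight ≥ (α − 2γ − ε)·n. -/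

import Mathlib

section

open Polynomial

set_option linter.unusedSectionVars false

universe u

namespace RatFunc

variable {F : Type u} [Field F]

/-- Rational functions of degree at most `d` (together with `0`). -/
def degLE (F : Type u) [Field F] (d : ℤ) : Submodule F (RatFunc F) where
  carrier := {φ | φ = 0 ∨ φ.intDegree ≤ d}
  zero_mem' := Or.inl rfl
  add_mem' := by
    intro a b ha hb
    by_cases hab : a + b = 0
    · exact Or.inl hab
    by_cases hb0 : b = 0
    · simpa [hb0] using ha
    by_cases ha0 : a = 0
    · simpa [ha0] using hb
    right
    have := intDegree_add_le hb0 hab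
    rcases ha with ha | ha
    · exact absurd ha ha0
    rcases hb with hb | hb
    · exact absurd hb hb0
    exact this.trans (max_le ha hb)
  smul_mem' := by
    intro c a ha
    by_cases hc : c = 0
    · simp [hc]
    rcases ha with ha | ha
    · simp [ha]
    by_cases ha0 : a = 0
    · simp [ha0]
    right
    rw [smul_eq_C_mul, intDegree_mul (by simpa using hc) ha0, intDegree_C]
    simpa using ha

theorem degLE_mono {d e : ℤ} (h : d ≤ e) : degLE F d ≤ degLE F e := by
  intro φ hφ
  exact hφ.imp id fun h' => h'.trans h

theorem mul_mem_degLE {d e : ℤ} {φ ψ : RatFunc F} (hφ : φ ∈ degLE F d) (hψ : ψ ∈ degLE F e) :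
    φ * ψ ∈ degLE F (d + e) := by
  by_cases h1 : φ = 0
  · simp [h1]
  by_cases h2 : ψ = 0
  · simp [h2]
  right
  rw [intDegree_mul h1 h2]
  exact add_le_add (hφ.resolve_left h1) (hψ.resolve_left h2)

theorem intDegree_X_zpow (n : ℤ) : (X ^ n : RatFunc F).intDegree = n := by
  have key : ∀ n : ℕ, (X ^ n : RatFunc F).intDegree = n := by
    intro n
    induction n with
    | zero => simp
    | succ n ih => rw [pow_succ, intDegree_mul (pow_ne_zero _ X_ne_zero) X_ne_zero, ih]; simp
  obtain ⟨n, rfl | rfl⟩ := n.eq_nat_or_neg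
  · simpa using key n
  · rw [zpow_neg, intDegree_inv]; simpa using key n

theorem X_zpow_mem_degLE (n : ℤ) : (X ^ n : RatFunc F) ∈ degLE F n :=
  Or.inr (intDegree_X_zpow n).le

theorem eq_zero_of_mem_degLE_neg {p : F[X]} {d : ℤ} (hd : d < 0)
    (h : algebraMap F[X] (RatFunc F) p ∈ degLE F d) : p = 0 := by
  rcases h with h | h
  · simpa using h
  · rw [intDegree_polynomial] at h
    omega

/-- Subtracting a monomial lowers the degree. -/
theorem exists_sub_smul_X_zpow_mem {φ : RatFunc F} {d : ℤ} (h : φ ∈ degLE F d) :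
    ∃ c : F, φ - c • (X ^ d : RatFunc F) ∈ degLE F (d - 1) := by
  by_cases h0 : φ = 0
  · exact ⟨0, by simp [h0]⟩
  have hd := h.resolve_left h0
  rcases hd.lt_or_eq with hlt | heq
  · exact ⟨0, Or.inr (by simpa using by omega)⟩
  have hn : φ.num ≠ 0 := num_ne_zero h0
  have hq : φ.denom ≠ 0 := denom_ne_zero φ
  have hq' : algebraMap F[X] (RatFunc F) φ.denom ≠ 0 := by simpa using hq
  have hmon : φ.denom.Monic := monic_denom φ
  have hdeg : (φ.num.natDegree : ℤ) - φ.denom.natDegree = d := heq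
  refine ⟨φ.num.leadingCoeff, ?_⟩
  set c := φ.num.leadingCoeff with hc
  have hc0 : c ≠ 0 := by simpa [hc] using hn
  obtain ⟨a, b, rfl⟩ : ∃ a b : ℕ, d = a - b := ⟨φ.num.natDegree, φ.denom.natDegree, hdeg.symm⟩
  have hX : (RatFunc.X : RatFunc F) ≠ 0 := X_ne_zero
  have hφ : φ = algebraMap F[X] (RatFunc F) φ.num / algebraMap F[X] (RatFunc F) φ.denom :=
    (num_div_denom φ).symm
  -- the numerator of the difference
  set P : F[X] := φ.num * Polynomial.X ^ b - Polynomial.C c * Polynomial.X ^ a * φ.denom with hP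
  have hdiff : φ - c • (RatFunc.X ^ ((a : ℤ) - b) : RatFunc F) =
      algebraMap F[X] (RatFunc F) P /
        algebraMap F[X] (RatFunc F) (φ.denom * Polynomial.X ^ b) := by
    rw [zpow_sub₀ hX, zpow_natCast, zpow_natCast, smul_eq_C_mul, hP]
    conv_lhs => rw [hφ]
    have hX' : algebraMap F[X] (RatFunc F) Polynomial.X = RatFunc.X := algebraMap_X
    have hC' : algebraMap F[X] (RatFunc F) (Polynomial.C c) = RatFunc.C c := algebraMap_C c
    simp only [map_sub, map_mul, map_pow, hX', hC']
    field_simp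
  rw [hdiff]
  by_cases hP0 : P = 0
  · simp [hP0]
  right
  have hden : φ.denom * Polynomial.X ^ b ≠ 0 := mul_ne_zero hq (pow_ne_zero _ Polynomial.X_ne_zero)
  rw [intDegree_div (by simpa using hP0) ((map_ne_zero_iff _ (algebraMap_injective F)).2 hden),
    intDegree_polynomial,
    intDegree_polynomial, natDegree_mul hq (pow_ne_zero _ Polynomial.X_ne_zero), natDegree_X_pow]
  have hlt : P.degree < (φ.num * Polynomial.X ^ b).degree := by
    apply degree_sub_lt_left
    · rw [degree_mul, degree_mul, degree_mul, degree_X_pow, degree_X_pow, degree_C hc0,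
        degree_eq_natDegree hn, degree_eq_natDegree hq]
      norm_cast
      omega
    · exact mul_ne_zero hn (pow_ne_zero _ Polynomial.X_ne_zero)
    · simp [hmon.leadingCoeff, hc]
  have := natDegree_lt_natDegree hP0 hlt
  rw [natDegree_mul hn (pow_ne_zero _ Polynomial.X_ne_zero), natDegree_X_pow] at this
  push_cast
  omega

/-- A rational function is the sum of a polynomial and a function vanishing at infinity. -/
theorem exists_poly_add_mem_degLE (φ : RatFunc F) :
    ∃ p : F[X], ∃ ψ ∈ degLE F (-1), φ = algebraMap F[X] (RatFunc F) p + ψ := by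
  have hmon : φ.denom.Monic := monic_denom φ
  have hd' : algebraMap F[X] (RatFunc F) φ.denom ≠ 0 := by simpa using denom_ne_zero φ
  have hm := modByMonic_add_div φ.num φ.denom
  have h3 : algebraMap F[X] (RatFunc F) φ.num = algebraMap F[X] (RatFunc F) (φ.num %ₘ φ.denom) +
      algebraMap F[X] (RatFunc F) φ.denom * algebraMap F[X] (RatFunc F) (φ.num /ₘ φ.denom) := by
    rw [← map_mul, ← map_add, hm]
  refine ⟨φ.num /ₘ φ.denom,
    algebraMap F[X] (RatFunc F) (φ.num %ₘ φ.denom) / algebraMap F[X] (RatFunc F) φ.denom, ?_, ?_⟩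
  · by_cases hs0 : φ.num %ₘ φ.denom = 0
    · simp [hs0]
    right
    rw [intDegree_div (by simpa using hs0) hd', intDegree_polynomial, intDegree_polynomial]
    have := natDegree_lt_natDegree hs0 (degree_modByMonic_lt φ.num hmon)
    omega
  · conv_lhs => rw [← num_div_denom φ, h3]
    field_simp
    ring

/-- A residue functional at infinity: it kills polynomials and functions of degree at most `-2`,
and is normalised at `X⁻¹`. -/
structure IsResidue (ρ : RatFunc F →ₗ[F] F) : Prop where
  poly : ∀ p : F[X], ρ (algebraMap F[X] (RatFunc F) p) = 0
  deg : ∀ φ ∈ degLE F (-2), ρ φ = 0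
  inv_X : ρ (X⁻¹) = 1

theorem exists_isResidue (F : Type u) [Field F] : ∃ ρ : RatFunc F →ₗ[F] F, IsResidue ρ := by
  set W : Submodule F (RatFunc F) :=
    LinearMap.range (Algebra.linearMap F[X] (RatFunc F) |>.restrictScalars F) ⊔ degLE F (-2) with hW
  have hX : (X⁻¹ : RatFunc F) ∉ W := by
    intro h
    rw [hW, Submodule.mem_sup] at h
    obtain ⟨_, ⟨p, rfl⟩, φ, hφ, h⟩ := h
    have h1 : (X⁻¹ : RatFunc F) ∈ degLE F (-1) := by simpa using X_zpow_mem_degLE (F := F) (-1)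
    have hp : algebraMap F[X] (RatFunc F) p ∈ degLE F (-1) := by
      have : algebraMap F[X] (RatFunc F) p = X⁻¹ - φ := by rw [← h]; simp
      rw [this]
      exact Submodule.sub_mem _ h1 (degLE_mono (by norm_num) hφ)
    have hp0 := eq_zero_of_mem_degLE_neg (by norm_num) hp
    subst hp0
    have : (X⁻¹ : RatFunc F) ∈ degLE F (-2) := by
      rw [← h]; simpa using hφ
    rcases this with h | h
    · exact inv_ne_zero X_ne_zero h
    · rw [intDegree_inv, intDegree_X] at h
      norm_num at h
  obtain ⟨f, hf, hW'⟩ := Submodule.exists_le_ker_of_notMem hX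
  refine ⟨(f X⁻¹)⁻¹ • f, ⟨fun p => ?_, fun φ hφ => ?_, ?_⟩⟩
  · have : algebraMap F[X] (RatFunc F) p ∈ W := Submodule.mem_sup_left ⟨p, rfl⟩
    have := hW' this
    simp_all
  · have : φ ∈ W := Submodule.mem_sup_right hφ
    have := hW' this
    simp_all
  · simp [hf]

namespace IsResidue

variable {ρ : RatFunc F →ₗ[F] F} (hρ : IsResidue ρ)
include hρ

theorem X_zpow (n : ℤ) : ρ (X ^ n) = if n = -1 then 1 else 0 := by
  split_ifs with h
  · subst h; simpa using hρ.inv_X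
  rcases lt_or_ge n 0 with hn | hn
  · exact hρ.deg _ (degLE_mono (by omega) (X_zpow_mem_degLE n))
  · lift n to ℕ using hn
    have := hρ.poly (Polynomial.X ^ n)
    simpa using this

theorem mem_degLE_of_forall {φ : RatFunc F} (h : ∀ t : ℕ, ρ (X ^ (-(t : ℤ)) * φ) = 0) :
    φ ∈ degLE F (-2) := by
  by_contra hφ
  have h0 : φ ≠ 0 := fun h0 => hφ (Or.inl h0)
  have hd : -2 < φ.intDegree := lt_of_not_ge fun h => hφ (Or.inr h)
  have hmem : φ ∈ degLE F φ.intDegree := Or.inr le_rfl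
  obtain ⟨c, hc⟩ := exists_sub_smul_X_zpow_mem hmem
  have hc0 : c ≠ 0 := by
    rintro rfl
    rcases hc with hc | hc
    · simp [h0] at hc
    · simp at hc
  obtain ⟨t, ht⟩ : ∃ t : ℕ, (t : ℤ) = φ.intDegree + 1 := ⟨(φ.intDegree + 1).toNat, by omega⟩
  have h1 := mul_mem_degLE (X_zpow_mem_degLE (F := F) (-(t : ℤ))) hc
  have h2 := hρ.deg _ (degLE_mono (by omega) h1)
  rw [mul_sub, map_sub, h, mul_smul_comm, map_smul, ← zpow_add₀ X_ne_zero, hρ.X_zpow,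
    if_pos (by omega)] at h2
  simp [hc0] at h2

theorem exists_poly_of_forall {φ : RatFunc F}
    (h : ∀ p : F[X], ρ (algebraMap F[X] (RatFunc F) p * φ) = 0) :
    ∃ p : F[X], φ = algebraMap F[X] (RatFunc F) p := by
  obtain ⟨q, ψ, hψ, hsum⟩ := exists_poly_add_mem_degLE φ
  refine ⟨q, ?_⟩
  suffices hψ0 : ψ = 0 by rw [hsum, hψ0, add_zero]
  by_contra hψ0
  have hdeg : ψ.intDegree ≤ -1 := hψ.resolve_left hψ0
  have hψρ : ∀ p : F[X], ρ (algebraMap F[X] (RatFunc F) p * ψ) = 0 := by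
    intro p
    have h1 := h p
    rw [hsum, mul_add, map_add, ← map_mul, hρ.poly, zero_add] at h1
    exact h1
  obtain ⟨t, ht⟩ : ∃ t : ℕ, ψ.intDegree = -1 - t := ⟨(-1 - ψ.intDegree).toNat, by omega⟩
  have hmem : ψ ∈ degLE F ψ.intDegree := Or.inr le_rfl
  obtain ⟨c, hc⟩ := exists_sub_smul_X_zpow_mem hmem
  have hc0 : c ≠ 0 := by
    rintro rfl
    rcases hc with hc | hc
    · simp [hψ0] at hc
    · simp at hc
  have h1 := mul_mem_degLE (X_zpow_mem_degLE (F := F) (t : ℤ)) hc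
  have h2 := hρ.deg _ (degLE_mono (by omega) h1)
  have h3 := hψρ (Polynomial.X ^ t)
  rw [map_pow, algebraMap_X] at h3
  rw [mul_sub, map_sub, zpow_natCast, h3, mul_smul_comm, map_smul, ← zpow_natCast,
    ← zpow_add₀ X_ne_zero, hρ.X_zpow,
    if_pos (by omega)] at h2
  simp [hc0] at h2

/-- Functionals killing polynomials and a neighbourhood of infinity are represented through the
residue. -/
theorem exists_eq_mul (θ : RatFunc F →ₗ[F] F)
    (h1 : ∀ p : F[X], θ (algebraMap F[X] (RatFunc F) p) = 0)
    (N : ℕ) (h2 : ∀ φ ∈ degLE F (-(N : ℤ) - 1), θ φ = 0) :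
    ∃ w : RatFunc F, ∀ φ, θ φ = ρ (φ * w) := by
  induction N generalizing θ with
  | zero =>
    refine ⟨0, fun φ => ?_⟩
    obtain ⟨q, ψ, hψ, hsum⟩ := exists_poly_add_mem_degLE φ
    rw [hsum, map_add, h1, h2 ψ (by simpa using hψ), mul_zero, map_zero, add_zero]
  | succ N ih =>
    set c := θ (X ^ (-(N : ℤ) - 1)) with hc
    let θ' : RatFunc F →ₗ[F] F := θ - ρ.comp (LinearMap.mulRight F (c • (X : RatFunc F) ^ N))
    have hθ' : ∀ φ, θ' φ = θ φ - ρ (φ * c • (X : RatFunc F) ^ N) := fun φ => by simp [θ']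
    obtain ⟨w, hw⟩ := ih θ' (fun p => by
        have : algebraMap F[X] (RatFunc F) p * c • (X : RatFunc F) ^ N =
            algebraMap F[X] (RatFunc F) (p * (c • Polynomial.X ^ N)) := by
          rw [map_mul, smul_eq_C_mul, Polynomial.smul_eq_C_mul, map_mul, map_pow, algebraMap_X,
            algebraMap_C]
        rw [hθ', h1, this, hρ.poly, sub_zero]) (fun φ hφ => by
      obtain ⟨e, he⟩ := exists_sub_smul_X_zpow_mem hφ
      have h3 := h2 _ (degLE_mono (by push_cast; omega) he)
      have h4 := hρ.deg _ (degLE_mono (e := -2) (by omega)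
        (mul_mem_degLE he (X_zpow_mem_degLE (F := F) (N : ℤ))))
      rw [map_sub, map_smul, ← hc, sub_eq_zero] at h3
      rw [sub_mul, map_sub, smul_mul_assoc, map_smul, ← zpow_add₀ X_ne_zero, hρ.X_zpow,
        if_pos (by ring), sub_eq_zero, zpow_natCast] at h4
      rw [hθ', mul_smul_comm, map_smul, h3, h4]
      simp [mul_comm])
    refine ⟨w + c • (X : RatFunc F) ^ N, fun φ => ?_⟩
    rw [mul_add, map_add, ← hw, hθ']
    ring

end IsResidue

end RatFunc

section AddValuation

variable {L : Type*} [Field L] {v : AddValuation L (WithTop ℤ)}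

namespace AddValuation

theorem exists_int_of_ne_zero (v : AddValuation L (WithTop ℤ)) {f : L} (hf : f ≠ 0) :
    ∃ n : ℤ, v f = (n : WithTop ℤ) := by
  have : v f ≠ ⊤ := by rwa [Ne, v.top_iff]
  obtain ⟨n, hn⟩ := WithTop.ne_top_iff_exists.1 this
  exact ⟨n, hn.symm⟩

theorem int_le_mul {f g : L} {a b c : ℤ} (hf : (a : WithTop ℤ) ≤ v f) (hg : (b : WithTop ℤ) ≤ v g)
    (hc : c ≤ a + b) : (c : WithTop ℤ) ≤ v (f * g) := by
  rw [v.map_mul]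
  calc (c : WithTop ℤ) ≤ ((a + b : ℤ) : WithTop ℤ) := by exact_mod_cast hc
    _ = (a : WithTop ℤ) + b := by push_cast; rfl
    _ ≤ _ := add_le_add hf hg

theorem int_le_pow {f : L} {a c : ℤ} (n : ℕ) (hf : (a : WithTop ℤ) ≤ v f) (hc : c ≤ n * a) :
    (c : WithTop ℤ) ≤ v (f ^ n) := by
  induction n generalizing c with
  | zero => rw [pow_zero, v.map_one]; exact_mod_cast (by simpa using hc : c ≤ 0)
  | succ n ih =>
    rw [pow_succ]
    exact int_le_mul (ih le_rfl) hf (by push_cast at hc; linarith)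

theorem int_mul_eq {f g : L} {a b : ℤ} (hf : v f = (a : WithTop ℤ)) (hg : v g = (b : WithTop ℤ)) :
    v (f * g) = ((a + b : ℤ) : WithTop ℤ) := by
  rw [v.map_mul, hf, hg]; push_cast; rfl

theorem ne_zero_of_int_eq {f : L} {a : ℤ} (hf : v f = (a : WithTop ℤ)) : f ≠ 0 := by
  rintro rfl
  rw [v.map_zero] at hf
  exact WithTop.coe_ne_top hf.symm

theorem int_inv_eq {f : L} {a : ℤ} (hf : v f = (a : WithTop ℤ)) :
    v f⁻¹ = ((-a : ℤ) : WithTop ℤ) := by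
  have hf0 := ne_zero_of_int_eq hf
  obtain ⟨b, hb⟩ := v.exists_int_of_ne_zero (inv_ne_zero hf0)
  have h := int_mul_eq hf hb
  rw [mul_inv_cancel₀ hf0, v.map_one] at h
  have h : (0 : ℤ) = a + b := by exact_mod_cast h
  rw [hb, show b = -a by omega]

theorem int_pow_eq {f : L} {a : ℤ} (hf : v f = (a : WithTop ℤ)) (n : ℕ) :
    v (f ^ n) = ((n * a : ℤ) : WithTop ℤ) := by
  induction n with
  | zero => simp
  | succ n ih => rw [pow_succ, int_mul_eq ih hf]; congr 1; push_cast; ring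

theorem int_zpow_eq {f : L} {a : ℤ} (hf : v f = (a : WithTop ℤ)) (n : ℤ) :
    v (f ^ n) = ((n * a : ℤ) : WithTop ℤ) := by
  obtain ⟨n, rfl | rfl⟩ := n.eq_nat_or_neg
  · simpa using int_pow_eq hf n
  · rw [zpow_neg, zpow_natCast, int_inv_eq (int_pow_eq hf n)]
    congr 1; ring

end AddValuation

end AddValuation

section Dual

/-- Elements of the trace dual of the integral closure of `A` in `L`. -/
def IsDual (A K : Type*) {L : Type*} [CommRing A] [Field K] [Field L] [Algebra A K] [Algebra A L]
    [Algebra K L] (f : L) : Prop :=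
  ∀ g : L, IsIntegral A g → ∃ a : A, algebraMap A K a = Algebra.trace K L (f * g)

end Dual

/-- A function field `L` over `F(X)` with a single place of degree one over infinity, together with
the facts about it and its trace form that are needed for one-point codes. -/
structure IsOnePoint {F L : Type u} [Field F] [Field L] [Algebra F L] [Algebra F[X] L]
    [Algebra (RatFunc F) L] (v : AddValuation L (WithTop ℤ)) (r : ℕ) (h : F[X]) : Prop where
  finite : FiniteDimensional (RatFunc F) L
  separable : Algebra.IsSeparable (RatFunc F) L
  r_pos : 0 < r
  v_base : ∀ φ : RatFunc F, φ ≠ 0 →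
    v (algebraMap (RatFunc F) L φ) = ((-(r : ℤ) * φ.intDegree : ℤ) : WithTop ℤ)
  residue : ∀ f : L, ((0 : ℤ) : WithTop ℤ) ≤ v f →
    ∃ c : F, ((1 : ℤ) : WithTop ℤ) ≤ v (f - algebraMap F L c)
  exists_neg_one : ∃ t : L, v t = ((-1 : ℤ) : WithTop ℤ)
  le_trace : ∀ f : L, v f ≤ v (algebraMap (RatFunc F) L (Algebra.trace (RatFunc F) L f))
  dual : ∀ (m : ℤ) (f : L), (∀ g : L, ((-m : ℤ) : WithTop ℤ) ≤ v g →
    Algebra.trace (RatFunc F) L (f * g) ∈ RatFunc.degLE F (-2)) →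
    ((m + 2 : ℤ) : WithTop ℤ) ≤ v f
  h_ne_zero : h ≠ 0
  dual_integral : ∀ f : L, IsDual F[X] (RatFunc F) f →
    IsIntegral F[X] (algebraMap F[X] L (h ^ 2) * f)

namespace IsOnePoint

variable {F L : Type u} [Field F] [Field L] [Algebra F L] [Algebra F[X] L]
    [Algebra (RatFunc F) L] {v : AddValuation L (WithTop ℤ)} {r : ℕ} {h : F[X]}
    [IsScalarTower F[X] (RatFunc F) L] [IsScalarTower F (RatFunc F) L] [IsScalarTower F F[X] L]
    (H : IsOnePoint v r h)
include H

theorem v_const {c : F} (hc : c ≠ 0) : v (algebraMap F L c) = ((0 : ℤ) : WithTop ℤ) := by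
  have := H.v_base (RatFunc.C c) (by simpa using hc)
  rw [RatFunc.intDegree_C, mul_zero] at this
  rw [← this, IsScalarTower.algebraMap_apply F (RatFunc F) L, RatFunc.algebraMap_eq_C]

theorem v_const_nonneg (c : F) : ((0 : ℤ) : WithTop ℤ) ≤ v (algebraMap F L c) := by
  by_cases hc : c = 0
  · simp [hc]
  · exact (H.v_const hc).ge

theorem v_poly {p : F[X]} (hp : p ≠ 0) :
    v (algebraMap F[X] L p) = ((-(r : ℤ) * p.natDegree : ℤ) : WithTop ℤ) := by
  rw [IsScalarTower.algebraMap_apply F[X] (RatFunc F) L, H.v_base _ (by simpa using hp),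
    RatFunc.intDegree_polynomial]

/-- Functions with a pole of order at most `m` at infinity. -/
def poles (m : ℤ) : Submodule F L where
  carrier := {f | ((-m : ℤ) : WithTop ℤ) ≤ v f}
  zero_mem' := by simp
  add_mem' := fun {a b} ha hb => (le_min ha hb).trans (v.map_add a b)
  smul_mem' := fun c f hf => by
    rw [Algebra.smul_def]
    exact AddValuation.int_le_mul (H.v_const_nonneg c) hf (by omega)

theorem mem_poles {m : ℤ} {f : L} : f ∈ H.poles m ↔ ((-m : ℤ) : WithTop ℤ) ≤ v f := Iff.rfl

theorem poles_mono {m m' : ℤ} (hm : m ≤ m') : H.poles m ≤ H.poles m' := by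
  intro f hf
  refine le_trans ?_ (show ((-m : ℤ) : WithTop ℤ) ≤ v f from hf)
  exact_mod_cast neg_le_neg hm

theorem mul_mem_poles {m m' : ℤ} {f g : L} (hf : f ∈ H.poles m) (hg : g ∈ H.poles m') :
    f * g ∈ H.poles (m + m') :=
  AddValuation.int_le_mul hf hg (by omega)

omit H in
variable (F L) in
/-- The integral functions, as an `F`-subspace. -/
noncomputable def integral : Submodule F L :=
  (Subalgebra.toSubmodule (integralClosure F[X] L)).restrictScalars F

omit H in
omit [Algebra (RatFunc F) L] [IsScalarTower F[X] (RatFunc F) L] [IsScalarTower F (RatFunc F) L] in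
theorem mem_integral {f : L} : f ∈ integral F L ↔ IsIntegral F[X] f := Iff.rfl

/-- The Riemann-Roch space of `m` times the place at infinity. -/
noncomputable def rr (m : ℤ) : Submodule F L := integral F L ⊓ H.poles m

theorem rr_mono {m m' : ℤ} (hm : m ≤ m') : H.rr m ≤ H.rr m' :=
  inf_le_inf_left _ (H.poles_mono hm)

theorem mul_mem_rr {m m' : ℤ} {f g : L} (hf : f ∈ H.rr m) (hg : g ∈ H.rr m') :
    f * g ∈ H.rr (m + m') :=
  ⟨hf.1.mul hg.1, H.mul_mem_poles hf.2 hg.2⟩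

theorem trace_integral {f : L} (hf : IsIntegral F[X] f) :
    ∃ p : F[X], algebraMap F[X] (RatFunc F) p = Algebra.trace (RatFunc F) L f := by
  have := H.finite
  exact IsIntegrallyClosed.isIntegral_iff.1 (Algebra.isIntegral_trace hf)

theorem exists_mem_poles (f : L) : ∃ m : ℕ, f ∈ H.poles m := by
  by_cases hf : f = 0
  · exact ⟨0, hf ▸ Submodule.zero_mem _⟩
  obtain ⟨n, hn⟩ := v.exists_int_of_ne_zero hf
  refine ⟨n.natAbs, ?_⟩
  rw [mem_poles, hn]
  have : -(n.natAbs : ℤ) ≤ n := by omega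
  exact_mod_cast this

theorem mem_degLE_of_mem_poles {φ : RatFunc F} {m : ℤ}
    (hφ : algebraMap (RatFunc F) L φ ∈ H.poles (r * m)) :
    φ ∈ RatFunc.degLE F m := by
  by_cases h0 : φ = 0
  · exact Or.inl h0
  right
  rw [mem_poles, H.v_base φ h0] at hφ
  have hφ : -((r : ℤ) * m) ≤ -r * φ.intDegree := by exact_mod_cast hφ
  have hr : (0 : ℤ) < r := by exact_mod_cast H.r_pos
  nlinarith

theorem mem_poles_of_mem_degLE {φ : RatFunc F} {m : ℤ} (hφ : φ ∈ RatFunc.degLE F m) :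
    algebraMap (RatFunc F) L φ ∈ H.poles (r * m) := by
  by_cases h0 : φ = 0
  · rw [h0, map_zero]; exact Submodule.zero_mem _
  have h1 := hφ.resolve_left h0
  rw [mem_poles, H.v_base φ h0]
  have hr : (0 : ℤ) < r := by exact_mod_cast H.r_pos
  have : -((r : ℤ) * m) ≤ -r * φ.intDegree := by nlinarith
  exact_mod_cast this

theorem rr_eq_bot {m : ℤ} (hm : m < 0) : H.rr m = ⊥ := by
  have := H.finite
  have := H.separable
  rw [eq_bot_iff]
  intro f hf
  obtain ⟨s, b, hb⟩ := FiniteDimensional.exists_is_basis_integral F[X] (RatFunc F) L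
  choose k hk using fun i => H.exists_mem_poles (b i)
  obtain ⟨n, hn⟩ : ∃ n : ℕ, ∀ i, k i < n := by
    refine ⟨Finset.univ.sup k + 1, fun i => Nat.lt_succ_of_le ?_⟩
    exact Finset.le_sup (f := k) (Finset.mem_univ i)
  have hv : ((1 : ℤ) : WithTop ℤ) ≤ v f := le_trans (by exact_mod_cast (by omega)) hf.2
  have key : ∀ i, Algebra.trace (RatFunc F) L (f ^ n * b i) = 0 := by
    intro i
    obtain ⟨p, hp⟩ := H.trace_integral ((hf.1.pow n).mul (hb i))
    have h1 : f ^ n * b i ∈ H.poles (-1) := by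
      refine AddValuation.int_le_mul (AddValuation.int_le_pow n hv le_rfl) (hk i) ?_
      have := hn i
      omega
    have h2 := le_trans h1 (H.le_trace _)
    rw [← hp] at h2 ⊢
    by_contra hne
    have hp0 : p ≠ 0 := by rintro rfl; simp at hne
    rw [← IsScalarTower.algebraMap_apply, H.v_poly hp0] at h2
    have h2 : (- -1 : ℤ) ≤ -r * p.natDegree := by exact_mod_cast h2
    have : (0 : ℤ) ≤ r * p.natDegree := by positivity
    linarith
  have h0 : f ^ n = 0 := by
    have hnd := traceForm_nondegenerate (RatFunc F) L
    refine (hnd.1 (f ^ n) ?_)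
    intro y
    rw [← b.sum_repr y]
    simp only [map_sum, map_smul]
    simp [Algebra.traceForm_apply, key]
  have : f = 0 := by
    by_contra hf0
    exact pow_ne_zero n hf0 h0
  simp [this]

theorem rr_le_sup (m : ℤ) : ∃ f0 : L, H.rr (m + 1) ≤ H.rr m ⊔ Submodule.span F {f0} := by
  by_cases hle : H.rr (m + 1) ≤ H.rr m
  · exact ⟨0, hle.trans le_sup_left⟩
  obtain ⟨f0, hf0, hf0'⟩ := Set.not_subset.1 hle
  have hne : f0 ≠ 0 := by rintro rfl; exact hf0' (Submodule.zero_mem _)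
  obtain ⟨n, hn⟩ := v.exists_int_of_ne_zero hne
  have hn1 : n = -(m + 1) := by
    have h1 : f0 ∈ H.poles (m + 1) := hf0.2
    rw [mem_poles, hn] at h1
    have h1 : -(m + 1) ≤ n := by exact_mod_cast h1
    have h2 : ¬ (-m ≤ n) := by
      intro h2
      apply hf0'
      refine ⟨hf0.1, ?_⟩
      show f0 ∈ H.poles m
      rw [mem_poles, hn]
      exact_mod_cast h2
    omega
  refine ⟨f0, fun f hf => ?_⟩
  have hq : ((0 : ℤ) : WithTop ℤ) ≤ v (f * f0⁻¹) :=
    AddValuation.int_le_mul hf.2 (AddValuation.int_inv_eq hn).ge (by omega)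
  obtain ⟨c, hc⟩ := H.residue _ hq
  have hsub : f - c • f0 ∈ H.rr m := by
    refine ⟨Submodule.sub_mem _ hf.1 (Submodule.smul_mem _ _ hf0.1), ?_⟩
    have : f - c • f0 = f0 * (f * f0⁻¹ - algebraMap F L c) := by
      rw [Algebra.smul_def]; field_simp
    rw [this]
    exact AddValuation.int_le_mul hn.ge hc (by omega)
  rw [Submodule.mem_sup]
  exact ⟨_, hsub, c • f0, Submodule.smul_mem _ _ (Submodule.mem_span_singleton_self _), by simp⟩

theorem finite_rr (m : ℤ) : FiniteDimensional F (H.rr m) := by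
  have key : ∀ n : ℕ, FiniteDimensional F (H.rr ((n : ℤ) - 1)) := by
    intro n
    induction n with
    | zero => rw [H.rr_eq_bot (by norm_num)]; infer_instance
    | succ n ih =>
      obtain ⟨f0, hf0⟩ := H.rr_le_sup ((n : ℤ) - 1)
      have h2 : ((n + 1 : ℕ) : ℤ) - 1 = (n : ℤ) - 1 + 1 := by push_cast; ring
      rw [h2]
      exact Submodule.finiteDimensional_of_le hf0
  have := key (m + 1).toNat
  exact Submodule.finiteDimensional_of_le (H.rr_mono (by omega : m ≤ ((m + 1).toNat : ℤ) - 1))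

theorem finrank_rr_add_le (m : ℤ) (d : ℕ) :
    Module.finrank F (H.rr (m + d)) ≤ Module.finrank F (H.rr m) + d := by
  induction d with
  | zero => rw [show m + ((0 : ℕ) : ℤ) = m by simp]; simp
  | succ d ih =>
    obtain ⟨f0, hf0⟩ := H.rr_le_sup (m + d)
    have := H.finite_rr (m + d)
    have h1 := Submodule.finrank_mono hf0
    have h2 := Submodule.finrank_add_le_finrank_add_finrank (H.rr (m + d)) (Submodule.span F {f0})
    have h3 : Module.finrank F (Submodule.span F {f0}) ≤ 1 := by
      simpa using finrank_span_le_card (R := F) ({f0} : Set L)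
    have h4 : m + ((d + 1 : ℕ) : ℤ) = m + d + 1 := by push_cast; ring
    rw [h4]
    omega

end IsOnePoint

/-- Two functionals agreeing on an intersection, one of them zero, are jointly induced by a global
functional. -/
theorem Submodule.exists_linearMap_of_inf {k V : Type*} [Field k] [AddCommGroup V] [Module k V]
    (P Q : Submodule k V) (l : V →ₗ[k] k) (h : ∀ x ∈ P, x ∈ Q → l x = 0) :
    ∃ θ : V →ₗ[k] k, (∀ x ∈ P, θ x = 0) ∧ ∀ x ∈ Q, θ x = l x := by
  let f : V →ₗ.[k] k := ⟨P, 0⟩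
  let g : V →ₗ.[k] k := ⟨Q, l.comp Q.subtype⟩
  have hfg : ∀ (x : f.domain) (y : g.domain), (x : V) = y → f x = g y := by
    intro x y hxy
    have hx : (x : V) ∈ Q := by rw [hxy]; exact y.2
    have h1 : f x = 0 := rfl
    have h2 : g y = l y := rfl
    rw [h1, h2, ← hxy, h x x.2 hx]
  obtain ⟨θ, hθ⟩ := LinearMap.exists_extend (f.sup g hfg).toFun
  have key : ∀ z : (f.sup g hfg).domain, θ z = (f.sup g hfg) z := fun z =>
    congrArg (fun t => t z) hθ
  refine ⟨θ, fun x hx => ?_, fun x hx => ?_⟩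
  · have hz : x ∈ f.domain ⊔ g.domain := Submodule.mem_sup_left hx
    have h1 := LinearPMap.sup_apply hfg (⟨x, hx⟩ : f.domain) 0 ⟨x, hz⟩ (by simp)
    have h2 := (key ⟨x, hz⟩).trans h1
    simpa [f] using h2
  · have hz : x ∈ f.domain ⊔ g.domain := Submodule.mem_sup_right hx
    have h1 := LinearPMap.sup_apply hfg 0 (⟨x, hx⟩ : g.domain) ⟨x, hz⟩ (by simp)
    have h2 := (key ⟨x, hz⟩).trans h1
    simpa [g] using h2

namespace IsOnePoint

variable {F L : Type u} [Field F] [Field L] [Algebra F L] [Algebra F[X] L]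
    [Algebra (RatFunc F) L] {v : AddValuation L (WithTop ℤ)} {r : ℕ} {h : F[X]}
    [IsScalarTower F[X] (RatFunc F) L] [IsScalarTower F (RatFunc F) L] [IsScalarTower F F[X] L]
    (H : IsOnePoint v r h) {ρ : RatFunc F →ₗ[F] F} (hρ : RatFunc.IsResidue ρ)
include H hρ

/-- Additive duality between a Riemann-Roch space and the pole filtration. -/
theorem exists_add_of_residue_eq_zero (m : ℤ) (g : L)
    (hg : ∀ f ∈ H.rr m, ρ (Algebra.trace (RatFunc F) L (f * g)) = 0) :
    ∃ g1 g2 : L, g = g1 + g2 ∧ IsDual F[X] (RatFunc F) g1 ∧ ((m + 2 : ℤ) : WithTop ℤ) ≤ v g2 := by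
  classical
  have := H.finite
  have := H.separable
  obtain ⟨s, b, hb⟩ := FiniteDimensional.exists_is_basis_integral F[X] (RatFunc F) L
  let lam : L →ₗ[F] F := ρ.comp (((Algebra.trace (RatFunc F) L).comp
    (LinearMap.mulRight (RatFunc F) g)).restrictScalars F)
  have hlam : ∀ f, lam f = ρ (Algebra.trace (RatFunc F) L (f * g)) := fun f => rfl
  obtain ⟨θ, hθ1, hθ2⟩ := Submodule.exists_linearMap_of_inf (integral F L) (H.poles m) lam
    (fun x h1 h2 => by rw [hlam]; exact hg x ⟨h1, h2⟩)
  -- represent θ in terms of the residue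
  have hw : ∀ i, ∃ w : RatFunc F, ∀ φ : RatFunc F, θ (φ • b i) = ρ (φ * w) := by
    intro i
    let θi : RatFunc F →ₗ[F] F :=
      θ.comp ((LinearMap.toSpanSingleton (RatFunc F) L (b i)).restrictScalars F)
    have hθi : ∀ φ, θi φ = θ (φ • b i) := fun φ => rfl
    obtain ⟨k, hk⟩ := H.exists_mem_poles (b i)
    obtain ⟨k', hk'⟩ := H.exists_mem_poles
      (algebraMap (RatFunc F) L (Algebra.trace (RatFunc F) L (b i * g)))
    have hr : (1 : ℤ) ≤ r := by exact_mod_cast H.r_pos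
    have hdeg : Algebra.trace (RatFunc F) L (b i * g) ∈ RatFunc.degLE F k' := by
      apply H.mem_degLE_of_mem_poles
      refine H.poles_mono ?_ hk'
      nlinarith
    refine hρ.exists_eq_mul θi (fun p => ?_) (k + k' + m.natAbs + 2) (fun φ hφ => ?_)
    · rw [hθi]
      apply hθ1
      rw [mem_integral, algebraMap_smul, Algebra.smul_def]
      exact isIntegral_algebraMap.mul (hb i)
    · rw [hθi, hθ2, hlam, smul_mul_assoc, map_smul, smul_eq_mul]
      · apply hρ.deg
        exact RatFunc.degLE_mono (by have := abs_nonneg m; push_cast; omega)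
          (RatFunc.mul_mem_degLE hφ hdeg)
      · rw [Algebra.smul_def]
        refine H.poles_mono ?_ (H.mul_mem_poles (H.mem_poles_of_mem_degLE hφ) hk)
        push_cast
        have : (r : ℤ) * (-(k + k' + |m| + 2) - 1) ≤ (-(k + k' + |m| + 2) - 1) := by
          have : 0 ≤ |m| := abs_nonneg m
          nlinarith
        have := neg_abs_le m
        have : (0 : ℤ) ≤ k' := by positivity
        linarith
  choose w hw using hw
  set g1 := ∑ i, w i • b.traceDual i with hg1
  have htr : ∀ i, Algebra.trace (RatFunc F) L (b i * g1) = w i := by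
    intro i
    rw [hg1, Finset.mul_sum, map_sum, Finset.sum_eq_single i]
    · rw [mul_smul_comm, map_smul, Module.Basis.trace_mul_traceDual, if_pos rfl]; simp
    · intro j _ hj
      rw [mul_smul_comm, map_smul, Module.Basis.trace_mul_traceDual, if_neg (Ne.symm hj), smul_zero]
    · simp
  have hrep : ∀ f : L, ρ (Algebra.trace (RatFunc F) L (f * g1)) = θ f := by
    intro f
    conv_lhs => rw [← b.sum_repr f]
    conv_rhs => rw [← b.sum_repr f]
    rw [Finset.sum_mul, map_sum, map_sum, map_sum]
    refine Finset.sum_congr rfl fun i _ => ?_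
    rw [smul_mul_assoc, map_smul, htr, hw, smul_eq_mul]
  refine ⟨g1, g - g1, by ring, fun f hf => ?_, ?_⟩
  · obtain ⟨p, hp⟩ := hρ.exists_poly_of_forall (φ := Algebra.trace (RatFunc F) L (g1 * f)) (by
      intro p
      have : algebraMap F[X] (RatFunc F) p * Algebra.trace (RatFunc F) L (g1 * f) =
          Algebra.trace (RatFunc F) L ((algebraMap F[X] L p * f) * g1) := by
        rw [← smul_eq_mul, ← map_smul, Algebra.smul_def, ← IsScalarTower.algebraMap_apply]
        congr 1; ring
      rw [this, hrep]
      exact hθ1 _ (isIntegral_algebraMap.mul hf))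
    exact ⟨p, hp.symm⟩
  · apply H.dual
    intro f hf
    apply hρ.mem_degLE_of_forall
    intro t
    have h1 : RatFunc.X ^ (-(t : ℤ)) * Algebra.trace (RatFunc F) L ((g - g1) * f) =
        Algebra.trace (RatFunc F) L ((algebraMap (RatFunc F) L (RatFunc.X ^ (-(t : ℤ))) * f) * g) -
        Algebra.trace (RatFunc F) L
          ((algebraMap (RatFunc F) L (RatFunc.X ^ (-(t : ℤ))) * f) * g1) := by
      rw [← smul_eq_mul, ← map_smul, Algebra.smul_def, ← map_sub]
      congr 1; ring
    rw [h1, map_sub, hrep, hθ2, hlam, sub_self]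
    refine H.poles_mono ?_
      (H.mul_mem_poles (H.mem_poles_of_mem_degLE (RatFunc.X_zpow_mem_degLE (-(t : ℤ)))) hf)
    have : (0 : ℤ) ≤ r * t := by positivity
    linarith

/-- The Riemann inequality, with explicit genus bound `r * natDegree h`. -/
theorem le_finrank_rr (m : ℤ) (hm : (r * h.natDegree : ℤ) - 1 ≤ m) :
    m + 1 - r * h.natDegree ≤ Module.finrank F (H.rr m) := by
  classical
  have := H.finite
  set e : ℤ := r * h.natDegree with he
  set N : ℤ := m - 2 * e with hN
  have hvh : v (algebraMap F[X] L (h ^ 2)) = ((-(2 * e) : ℤ) : WithTop ℤ) := by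
    rw [H.v_poly (pow_ne_zero 2 H.h_ne_zero), natDegree_pow]
    congr 1; push_cast; ring
  have hh0 : algebraMap F[X] L (h ^ 2) ≠ 0 := AddValuation.ne_zero_of_int_eq hvh
  have := H.finite_rr m
  have := H.finite_rr (N + 2 * e)
  obtain ⟨d, hd⟩ : ∃ d : ℕ, (d : ℤ) = N + m + 2 := ⟨(N + m + 2).toNat, by omega⟩
  obtain ⟨t, ht⟩ := H.exists_neg_one
  have ht0 := AddValuation.ne_zero_of_int_eq ht
  -- independent functions modulo high vanishing order
  let e' : Fin d → L := fun i => t ^ ((i : ℤ) - m - 1)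
  let S : (Fin d → F) →ₗ[F] L := Fintype.linearCombination F e'
  have hS : ∀ c, S c ∈ H.poles N := by
    intro c
    rw [Fintype.linearCombination_apply]
    refine Submodule.sum_mem _ fun i _ => Submodule.smul_mem _ _ ?_
    rw [mem_poles, AddValuation.int_zpow_eq ht]
    have := i.2
    have : -N ≤ ((i : ℤ) - m - 1) * -1 := by omega
    exact_mod_cast this
  have hSinj : ∀ c, S c ∈ H.poles (-m - 2) → c = 0 := by
    intro c hc
    by_contra hne
    obtain ⟨i0, hi0, hmax⟩ : ∃ i0, c i0 ≠ 0 ∧ ∀ i, i0 < i → c i = 0 := by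
      have hne' : (Finset.univ.filter fun i => c i ≠ 0).Nonempty := by
        obtain ⟨i, hi⟩ := Function.ne_iff.1 hne
        exact ⟨i, by simpa using hi⟩
      refine ⟨_, (Finset.mem_filter.1 (Finset.max'_mem _ hne')).2, fun i hi => ?_⟩
      by_contra hci
      exact absurd (Finset.le_max' _ i (by simpa using hci)) (not_le.2 hi)
    rw [Fintype.linearCombination_apply,
      ← Finset.add_sum_erase _ _ (Finset.mem_univ i0)] at hc
    have h1 : v (c i0 • e' i0) = (((i0 : ℤ) - m - 1) * -1 : ℤ) := by
      rw [Algebra.smul_def, AddValuation.int_mul_eq (H.v_const hi0) (AddValuation.int_zpow_eq ht _),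
        zero_add]
    have h2 : c i0 • e' i0 ∈ H.poles ((i0 : ℤ) - m - 2) := by
      have h3 : ∑ i ∈ Finset.univ.erase i0, c i • e' i ∈ H.poles ((i0 : ℤ) - m - 2) := by
        refine Submodule.sum_mem _ fun i hi => ?_
        rcases lt_or_ge i0 i with hlt | hle
        · rw [hmax i hlt, zero_smul]; exact Submodule.zero_mem _
        · refine Submodule.smul_mem _ _ ?_
          have hlt : i < i0 := lt_of_le_of_ne hle (Finset.ne_of_mem_erase hi)
          rw [mem_poles, AddValuation.int_zpow_eq ht]
          have hlt' : (i : ℤ) < i0 := by exact_mod_cast hlt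
          have : -((i0 : ℤ) - m - 2) ≤ ((i : ℤ) - m - 1) * -1 := by omega
          exact_mod_cast this
      have h4 := H.poles_mono (m' := (i0 : ℤ) - m - 2) (by omega) hc
      simpa using Submodule.sub_mem _ h4 h3
    rw [mem_poles, h1] at h2
    have h2 : -((i0 : ℤ) - m - 2) ≤ ((i0 : ℤ) - m - 1) * -1 := by exact_mod_cast h2
    omega
  -- pairing with the Riemann-Roch space
  let B : (Fin d → F) →ₗ[F] Module.Dual F (H.rr m) :=
    LinearMap.mk₂ F (fun c (f : H.rr m) => ρ (Algebra.trace (RatFunc F) L (f * S c)))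
      (by intro a b f; simp [mul_add])
      (by intro a b f
          rw [map_smul, mul_smul_comm, ← algebraMap_smul (RatFunc F) a, map_smul, algebraMap_smul,
            map_smul])
      (by intro a b f; simp [add_mul])
      (by intro a b f
          rw [Submodule.coe_smul, smul_mul_assoc, ← algebraMap_smul (RatFunc F) a, map_smul,
            algebraMap_smul, map_smul])
  have hB : ∀ c f, B c f = ρ (Algebra.trace (RatFunc F) L (f * S c)) := fun c f => rfl
  have hker : ∀ c ∈ B.ker, ∃ f ∈ H.rr (N + 2 * e),
      algebraMap F[X] L (h ^ 2) * S c - f ∈ H.poles (2 * e - m - 2) := by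
    intro c hc
    obtain ⟨g1, g2, hg, hg1, hg2⟩ := H.exists_add_of_residue_eq_zero hρ m (S c) (fun f hf => by
      rw [← hB c ⟨f, hf⟩, LinearMap.mem_ker.1 hc, LinearMap.zero_apply])
    have hg2' : g2 ∈ H.poles (-m - 2) := le_trans (by exact_mod_cast (by omega)) hg2
    refine ⟨algebraMap F[X] L (h ^ 2) * g1, ⟨H.dual_integral g1 hg1, ?_⟩, ?_⟩
    · have : g1 ∈ H.poles N := by
        have : g1 = S c - g2 := by rw [hg]; ring
        rw [this]
        exact Submodule.sub_mem _ (hS c) (H.poles_mono (by omega) hg2')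
      exact AddValuation.int_le_mul hvh.ge this (by omega)
    · rw [hg]
      have : algebraMap F[X] L (h ^ 2) * (g1 + g2) - algebraMap F[X] L (h ^ 2) * g1 =
        algebraMap F[X] L (h ^ 2) * g2 := by ring
      rw [this]
      exact AddValuation.int_le_mul hvh.ge hg2' (by omega)
  have hkerle : Module.finrank F B.ker ≤ Module.finrank F (H.rr (N + 2 * e)) := by
    -- the kernel embeds into the image of the space modulo high vanishing order
    let Q := H.poles (2 * e - m - 2)
    let φ : B.ker →ₗ[F] L ⧸ Q := Q.mkQ.comp
      ((LinearMap.mulLeft F (algebraMap F[X] L (h ^ 2))).comp (S.comp B.ker.subtype))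
    let ψ : H.rr (N + 2 * e) →ₗ[F] L ⧸ Q := Q.mkQ.comp (H.rr (N + 2 * e)).subtype
    have hφ : Function.Injective φ := by
      rw [← LinearMap.ker_eq_bot, eq_bot_iff]
      intro c hc
      have hc' : algebraMap F[X] L (h ^ 2) * S c ∈ Q := by
        simpa [φ] using hc
      have : S c ∈ H.poles (-m - 2) := by
        have h1 := AddValuation.int_le_mul (AddValuation.int_inv_eq hvh).ge hc'
          (c := m + 2) (by omega)
        rw [← mul_assoc, inv_mul_cancel₀ hh0, one_mul] at h1
        exact le_trans (by exact_mod_cast (by omega)) h1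
      have := hSinj _ this
      simpa using this
    have hle : φ.range ≤ ψ.range := by
      rintro _ ⟨c, rfl⟩
      obtain ⟨f, hf, hfc⟩ := hker c c.2
      refine ⟨⟨f, hf⟩, ?_⟩
      symm
      exact (Submodule.Quotient.eq _).2 hfc
    calc Module.finrank F B.ker = Module.finrank F φ.range :=
          (LinearMap.finrank_range_of_inj hφ).symm
      _ ≤ Module.finrank F ψ.range := Submodule.finrank_mono hle
      _ ≤ _ := LinearMap.finrank_range_le ψ
  have h1 := LinearMap.finrank_range_add_finrank_ker B
  have h2 : Module.finrank F B.range ≤ Module.finrank F (Module.Dual F (H.rr m)) :=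
    Submodule.finrank_le _
  rw [Subspace.dual_finrank_eq] at h2
  rw [Module.finrank_fin_fun] at h1
  have h3 : N + 2 * e = m := by omega
  rw [h3] at hkerle
  omega

end IsOnePoint

/-- A family of distinct rational points, at which `h` does not vanish but `p` does, satisfying a
residue formula for sums over the points. -/
structure IsEvalSystem {F L ι : Type u} [Field F] [Field L] [Fintype ι] [Algebra F L]
    [Algebra F[X] L] [Algebra (RatFunc F) L] [IsScalarTower F F[X] L] (ρ : RatFunc F →ₗ[F] F)
    (r : ℕ) (h p : F[X]) (ev : ι → integralClosure F[X] L →ₐ[F] F) : Prop where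
  injective : Function.Injective ev
  h_ne_zero : ∀ P, ev P (algebraMap F[X] _ h) ≠ 0
  p_eq_zero : ∀ P, ev P (algebraMap F[X] _ p) = 0
  p_ne_zero : p ≠ 0
  card_eq : Fintype.card ι = r * p.natDegree
  sum_eq : ∀ f : integralClosure F[X] L, ∑ P, ev P (algebraMap F[X] _ h) * ev P f =
    ρ (Algebra.trace (RatFunc F) L (f * (algebraMap F[X] L p)⁻¹))

namespace IsOnePoint

variable {F L ι : Type u} [Field F] [Field L] [Fintype ι] [Algebra F L] [Algebra F[X] L]
    [Algebra (RatFunc F) L] {v : AddValuation L (WithTop ℤ)} {r : ℕ} {h p : F[X]}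
    [IsScalarTower F[X] (RatFunc F) L] [IsScalarTower F (RatFunc F) L] [IsScalarTower F F[X] L]
    (H : IsOnePoint v r h) {ρ : RatFunc F →ₗ[F] F} (hρ : RatFunc.IsResidue ρ)
    {ev : ι → integralClosure F[X] L →ₐ[F] F} (hev : IsEvalSystem ρ r h p ev) (b : ι → F)

/-- Weighted evaluation of functions at the points. -/
noncomputable def evalMap (ev : ι → integralClosure F[X] L →ₐ[F] F) (b : ι → F) (m : ℤ) :
    H.rr m →ₗ[F] (ι → F) where
  toFun f P := b P * ev P ⟨f, f.2.1⟩
  map_add' f g := by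
    ext P
    have : (⟨((f + g : H.rr m) : L), (f + g).2.1⟩ : integralClosure F[X] L) =
      ⟨f, f.2.1⟩ + ⟨g, g.2.1⟩ := rfl
    rw [this, map_add, mul_add]
    rfl
  map_smul' c f := by
    ext P
    have : (⟨((c • f : H.rr m) : L), (c • f).2.1⟩ : integralClosure F[X] L) =
      c • ⟨f, f.2.1⟩ := rfl
    rw [this, map_smul]
    simp only [smul_eq_mul, RingHom.id_apply, Pi.smul_apply]
    ring

theorem evalMap_apply (m : ℤ) (f : H.rr m) (P : ι) :
    H.evalMap ev b m f P = b P * ev P ⟨f, f.2.1⟩ := rfl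

/-- The one-point code. -/
noncomputable def code (ev : ι → integralClosure F[X] L →ₐ[F] F) (b : ι → F) (m : ℤ) :
    Submodule F (ι → F) :=
  (H.evalMap ev b m).range

include hev

theorem exists_eval_eq : ∃ M : ℕ, ∀ y : ι → F, ∃ f : H.rr M, ∀ P, ev P ⟨f, f.2.1⟩ = y P := by
  classical
  let Φ : integralClosure F[X] L →ₗ[F] (ι → F) := LinearMap.pi fun P => (ev P).toLinearMap
  have hΦ : Function.Surjective Φ := by
    rw [← LinearMap.range_eq_top]
    by_contra hne
    obtain ⟨f, hf0, hf⟩ := Submodule.exists_le_ker_of_lt_top _ (lt_top_iff_ne_top.2 hne)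
    have hli : LinearIndependent F (fun P => (ev P : integralClosure F[X] L → F)) := by
      have h1 := linearIndependent_monoidHom (integralClosure F[X] L) F
      have h2 : Function.Injective
          (fun P => ((ev P : integralClosure F[X] L →+* F) : integralClosure F[X] L →* F)) := by
        intro P Q hPQ
        apply hev.injective
        ext x
        exact congrArg (fun t : integralClosure F[X] L →* F => t x) hPQ
      exact h1.comp _ h2
    rw [Fintype.linearIndependent_iff] at hli
    have h3 := hli (fun P => f (Pi.single P 1)) (by
      ext x
      have h4 : f (Φ x) = 0 := hf ⟨x, rfl⟩
      rw [pi_eq_sum_univ (Φ x), map_sum] at h4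
      rw [Finset.sum_apply, Pi.zero_apply, ← h4]
      refine Finset.sum_congr rfl fun P _ => ?_
      rw [map_smul, Pi.smul_apply, smul_eq_mul, smul_eq_mul, mul_comm]
      congr 2
      ext Q
      simp [Pi.single_apply, eq_comm])
    apply hf0
    refine LinearMap.pi_ext' fun P => LinearMap.ext_ring ?_
    simpa using h3 P
  choose g hg using fun P : ι => hΦ (Pi.single P 1)
  choose k hk using fun P : ι => H.exists_mem_poles (g P : L)
  refine ⟨Finset.univ.sup k, fun y => ?_⟩
  have hmem : ((∑ P, y P • g P : integralClosure F[X] L) : L) ∈ H.rr (Finset.univ.sup k : ℕ) := by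
    refine ⟨(∑ P, y P • g P : integralClosure F[X] L).2, ?_⟩
    have h1 : ((∑ P, y P • g P : integralClosure F[X] L) : L) = ∑ P, y P • (g P : L) := by
      push_cast
      rfl
    rw [h1]
    refine Submodule.sum_mem _ fun P _ => Submodule.smul_mem _ _ (H.poles_mono ?_ (hk P))
    exact_mod_cast Finset.le_sup (f := k) (Finset.mem_univ P)
  refine ⟨⟨_, hmem⟩, fun Q => ?_⟩
  have h2 : Φ (∑ P, y P • g P) = y := by
    rw [map_sum]
    simp_rw [map_smul, hg]
    ext Q
    simp [Finset.sum_apply, Pi.single_apply]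
  exact congrFun h2 Q

/-- A nonzero function has at most as many zeros as poles. -/
theorem card_zeros_le (d : ℕ) {g : L} (hg : g ∈ H.rr d) (hg0 : g ≠ 0) (Z : Finset ι)
    (hZ : ∀ P ∈ Z, ev P ⟨g, hg.1⟩ = 0) : Z.card ≤ d := by
  classical
  obtain ⟨M, hM⟩ := H.exists_eval_eq hev
  have := H.finite_rr M
  have := H.finite_rr (M + d)
  let φ : H.rr (M + d) →ₗ[F] (Z → F) :=
    (LinearMap.funLeft F F (fun P : Z => (P : ι))).comp (H.evalMap ev 1 (M + d))
  have hφa : ∀ f P, φ f P = ev P ⟨f, f.2.1⟩ := by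
    intro f P
    simp [φ, LinearMap.funLeft_apply, evalMap_apply]
  have hφ : Function.Surjective φ := by
    intro y
    obtain ⟨f, hf⟩ := hM (fun P => if hP : P ∈ Z then y ⟨P, hP⟩ else 0)
    refine ⟨⟨f, H.rr_mono (by omega) f.2⟩, ?_⟩
    ext P
    rw [hφa]
    simpa using hf P
  let ψ : H.rr M →ₗ[F] φ.ker := LinearMap.codRestrict _
    ((LinearMap.mulRight F g).restrict (fun f hf => H.mul_mem_rr hf hg)) (by
      intro f
      rw [LinearMap.mem_ker]
      ext P
      rw [hφa]
      have h1 : (⟨_, (((LinearMap.mulRight F g).restrict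
        (fun f hf => H.mul_mem_rr hf hg)) f).2.1⟩ : integralClosure F[X] L) =
          ⟨f, f.2.1⟩ * ⟨g, hg.1⟩ := rfl
      rw [h1, map_mul, hZ P P.2, mul_zero]
      rfl)
  have hψ : Function.Injective ψ := by
    intro a c hac
    have h1 : (a : L) * g = c * g := congrArg (fun t : φ.ker => ((t : H.rr (M + d)) : L)) hac
    exact Subtype.ext (mul_right_cancel₀ hg0 h1)
  have h1 := LinearMap.finrank_range_add_finrank_ker φ
  rw [LinearMap.range_eq_top.2 hφ, finrank_top, Module.finrank_fintype_fun_eq_card,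
    Fintype.card_coe] at h1
  have h2 := LinearMap.finrank_le_finrank_of_injective hψ
  have h3 := H.finrank_rr_add_le M d
  omega

theorem card_weight {m : ℤ} (hb : ∀ P, b P ≠ 0) {x : ι → F} (hx : x ∈ H.code ev b m) (hx0 : x ≠ 0) :
    (Fintype.card ι : ℤ) - m ≤ ({i | x i ≠ 0}.ncard : ℕ) := by
  classical
  obtain ⟨f, rfl⟩ := hx
  have hf0 : (f : L) ≠ 0 := by
    intro h0
    apply hx0
    have : f = 0 := Subtype.ext h0
    rw [this, map_zero]
  have hm : 0 ≤ m := by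
    by_contra hm
    exact hf0 ((H.rr_eq_bot (not_le.1 hm)).le f.2)
  lift m to ℕ using hm
  have hZ := H.card_zeros_le hev m f.2 hf0
    (Finset.univ.filter fun P => H.evalMap ev b m f P = 0) (by
      intro P hP
      have := (Finset.mem_filter.1 hP).2
      rw [evalMap_apply] at this
      exact (mul_eq_zero.1 this).resolve_left (hb P))
  have h1 := Finset.card_filter_add_card_filter_not (s := (Finset.univ : Finset ι))
    (fun P => H.evalMap ev b m f P = 0)
  have h2 : {i | H.evalMap ev b m f i ≠ 0}.ncard =
      (Finset.univ.filter fun P => ¬ H.evalMap ev b m f P = 0).card := by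
    rw [← Set.ncard_coe_finset]
    congr 1
    ext; simp
  rw [h2]
  rw [Finset.card_univ] at h1
  omega

omit hev in
theorem code_mono {m m' : ℤ} (hm : m ≤ m') : H.code ev b m ≤ H.code ev b m' := by
  rintro _ ⟨f, rfl⟩
  exact ⟨⟨f, H.rr_mono hm f.2⟩, rfl⟩

include hρ

theorem le_finrank_code {m : ℤ} (hb : ∀ P, b P ≠ 0) (hm : (r * h.natDegree : ℤ) - 1 ≤ m)
    (hmn : m < Fintype.card ι) :
    m + 1 - r * h.natDegree ≤ Module.finrank F (H.code ev b m) := by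
  have hinj : Function.Injective (H.evalMap ev b m) := by
    rw [← LinearMap.ker_eq_bot, eq_bot_iff]
    intro f hf
    by_contra hf0
    have hf0' : (f : L) ≠ 0 := fun h0 => hf0 (Subtype.ext h0)
    have hm0 : 0 ≤ m := by
      by_contra hm
      exact hf0' ((H.rr_eq_bot (not_le.1 hm)).le f.2)
    lift m to ℕ using hm0
    have hZ := H.card_zeros_le hev m f.2 hf0' Finset.univ (by
      intro P _
      have := congrFun (LinearMap.mem_ker.1 hf) P
      rw [evalMap_apply] at this
      exact (mul_eq_zero.1 this).resolve_left (hb P))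
    rw [Finset.card_univ] at hZ
    omega
  rw [code, LinearMap.finrank_range_of_inj hinj]
  exact H.le_finrank_rr hρ m hm

theorem mem_code_of_orthogonal {m : ℤ} (hb : ∀ P, b P ^ 2 * ev P (algebraMap F[X] _ h) = 1)
    (hm : (Fintype.card ι : ℤ) + 2 * (r * h.natDegree) - 2 ≤ 2 * m) {y : ι → F}
    (hy : ∀ x ∈ H.code ev b m, ∑ P, y P * x P = 0) : y ∈ H.code ev b m := by
  have hb0 : ∀ P, b P ≠ 0 := by
    intro P h0
    have := hb P
    rw [h0] at this
    simp at this
  obtain ⟨M, hM⟩ := H.exists_eval_eq hev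
  obtain ⟨G, hG⟩ := hM (fun P => y P / b P / ev P (algebraMap F[X] _ h) ^ 2)
  have hp0 : algebraMap F[X] L p ≠ 0 := by
    rw [IsScalarTower.algebraMap_apply F[X] (RatFunc F) L]
    simpa using hev.p_ne_zero
  obtain ⟨g1, g2, hg, hg1, hg2⟩ := H.exists_add_of_residue_eq_zero hρ m
    ((algebraMap F[X] L p)⁻¹ * G) (by
      intro f hf
      have h1 := hev.sum_eq (⟨f, hf.1⟩ * ⟨G, G.2.1⟩)
      have h2 : f * ((algebraMap F[X] L p)⁻¹ * (G : L)) =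
        ((⟨f, hf.1⟩ * ⟨G, G.2.1⟩ : integralClosure F[X] L) : L) * (algebraMap F[X] L p)⁻¹ := by
        push_cast
        ring
      rw [h2, ← h1, ← hy (H.evalMap ev b m ⟨f, hf⟩) ⟨⟨f, hf⟩, rfl⟩]
      refine Finset.sum_congr rfl fun P _ => ?_
      rw [map_mul, hG, evalMap_apply]
      have h3 := hev.h_ne_zero P
      have h4 := hb P
      have h5 := hb0 P
      field_simp
      linear_combination (-(ev P ⟨f, hf.1⟩ * y P)) * h4)
  have hi := H.dual_integral g1 hg1
  -- the corrected function
  let G' : integralClosure F[X] L := algebraMap F[X] _ (h ^ 2) * ⟨G, G.2.1⟩ -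
    algebraMap F[X] _ p * ⟨_, hi⟩
  have hG'L : (G' : L) = algebraMap F[X] L (h ^ 2) * G -
    algebraMap F[X] L p * (algebraMap F[X] L (h ^ 2) * g1) := rfl
  have hG'2 : (G' : L) = algebraMap F[X] L (h ^ 2) * algebraMap F[X] L p * g2 := by
    have : (G : L) = algebraMap F[X] L p * (g1 + g2) := by
      rw [← hg, ← mul_assoc, mul_inv_cancel₀ hp0, one_mul]
    rw [hG'L, this]
    ring
  have hmem : (G' : L) ∈ H.rr m := by
    refine ⟨G'.2, ?_⟩
    have h1 : ((-(m) : ℤ) : WithTop ℤ) ≤ v (G' : L) := by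
      rw [hG'2, ← map_mul]
      refine AddValuation.int_le_mul (H.v_poly (mul_ne_zero (pow_ne_zero 2 H.h_ne_zero)
        hev.p_ne_zero)).ge hg2 ?_
      rw [natDegree_mul (pow_ne_zero 2 H.h_ne_zero) hev.p_ne_zero, natDegree_pow]
      have h2 : (Fintype.card ι : ℤ) = r * p.natDegree := by exact_mod_cast hev.card_eq
      push_cast
      linarith
    exact h1
  refine ⟨⟨G', hmem⟩, ?_⟩
  ext P
  rw [evalMap_apply]
  show b P * ev P G' = y P
  have h1 : ev P G' = y P / b P := by
    have h3 := hev.h_ne_zero P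
    simp only [G', map_sub, map_mul, hG, hev.p_eq_zero, zero_mul, sub_zero, map_pow]
    field_simp
  rw [h1]
  have := hb0 P
  field_simp

end IsOnePoint

namespace IsOnePoint

/-- Transporting codes along a bijection of the index sets. -/
theorem exists_codes_fin {F ι : Type u} [Field F] [Fintype ι] {n : ℕ} (hn : Fintype.card ι = n)
    {a a' d d' : ℝ} {C C' : Submodule F (ι → F)} (hCC' : C ≤ C')
    (hdual : ∀ x, (∀ y ∈ C, ∑ i, x i * y i = 0) → x ∈ C)
    (hC : a ≤ Module.finrank F C) (hwC : ∀ x ∈ C, x ≠ 0 → d ≤ ({i | x i ≠ 0}.ncard : ℝ))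
    (hC' : a' ≤ Module.finrank F C') (hwC' : ∀ x ∈ C', x ≠ 0 → d' ≤ ({i | x i ≠ 0}.ncard : ℝ)) :
    ∃ C C' : Submodule F (Fin n → F), C ≤ C' ∧
      (∀ x, (∀ y ∈ C, ∑ i, x i * y i = 0) → x ∈ C) ∧
      (a' ≤ Module.finrank F C' ∧ ∀ x ∈ C', x ≠ 0 → d' ≤ ({i | x i ≠ 0}.ncard : ℝ)) ∧
      (a ≤ Module.finrank F C ∧ ∀ x ∈ C, x ≠ 0 → d ≤ ({i | x i ≠ 0}.ncard : ℝ)) := by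
  let e : ι ≃ Fin n := Fintype.equivFinOfCardEq hn
  let φ : (Fin n → F) ≃ₗ[F] (ι → F) := LinearEquiv.funCongrLeft F F e
  have hφ : ∀ x i, φ x i = x (e i) := fun x i => rfl
  have hwt : ∀ x : Fin n → F, {i | φ x i ≠ 0}.ncard = {i | x i ≠ 0}.ncard := by
    intro x
    have : {i | x i ≠ 0} = e '' {i | φ x i ≠ 0} := by
      ext i
      constructor
      · intro hi
        exact ⟨e.symm i, by simpa [hφ] using hi, by simp⟩
      · rintro ⟨j, hj, rfl⟩
        exact hj
    rw [this, Set.ncard_image_of_injective _ e.injective]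
  have hfr : ∀ D : Submodule F (ι → F), Module.finrank F (D.comap φ.toLinearMap) =
      Module.finrank F D := by
    intro D
    have : D.comap φ.toLinearMap = D.map φ.symm.toLinearMap := by
      ext x
      simp
    rw [this]
    exact LinearEquiv.finrank_map_eq φ.symm D
  refine ⟨C.comap φ.toLinearMap, C'.comap φ.toLinearMap, Submodule.comap_mono hCC', ?_, ⟨?_, ?_⟩,
    ⟨?_, ?_⟩⟩
  · intro x hx
    refine hdual (φ x) fun y hy => ?_
    have h1 := hx (φ.symm y) (by simpa using hy)
    rw [← h1, ← e.sum_comp]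
    refine Finset.sum_congr rfl fun i _ => ?_
    rw [← hφ (φ.symm y), LinearEquiv.apply_symm_apply, hφ]
  · rwa [hfr]
  · intro x hx hx0
    rw [← hwt]
    exact hwC' _ hx (by simpa using hx0)
  · rwa [hfr]
  · intro x hx hx0
    rw [← hwt]
    exact hwC _ hx (by simpa using hx0)

variable {F L ι : Type u} [Field F] [Field L] [Fintype ι] [Algebra F L] [Algebra F[X] L]
    [Algebra (RatFunc F) L] {v : AddValuation L (WithTop ℤ)} {r : ℕ} {h p : F[X]}
    [IsScalarTower F[X] (RatFunc F) L] [IsScalarTower F (RatFunc F) L] [IsScalarTower F F[X] L]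

theorem exists_codes (H : IsOnePoint v r h) {ρ : RatFunc F →ₗ[F] F} (hρ : RatFunc.IsResidue ρ)
    {ev : ι → integralClosure F[X] L →ₐ[F] F} (hev : IsEvalSystem ρ r h p ev)
    [Finite F] [CharP F 2] {a a' d d' : ℝ} (ha : 1 / 2 ≤ a) (haa' : a ≤ a') {n : ℕ}
    (hn : n = Fintype.card ι) (ha' : a' * n + r * h.natDegree ≤ n)
    (hd : d ≤ (1 - a) * n - r * h.natDegree) (hd' : d' ≤ (1 - a') * n - r * h.natDegree) :
    ∃ C C' : Submodule F (Fin n → F), C ≤ C' ∧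
      (∀ x, (∀ y ∈ C, ∑ i, x i * y i = 0) → x ∈ C) ∧
      (a' * n ≤ Module.finrank F C' ∧ ∀ x ∈ C', x ≠ 0 → d' ≤ ({i | x i ≠ 0}.ncard : ℝ)) ∧
      (a * n ≤ Module.finrank F C ∧ ∀ x ∈ C, x ≠ 0 → d ≤ ({i | x i ≠ 0}.ncard : ℝ)) := by
  have hb : ∀ P, ∃ b : F, b ^ 2 * ev P (algebraMap F[X] _ h) = 1 := by
    intro P
    obtain ⟨s, hs⟩ := FiniteField.isSquare_of_char_two (ringChar.eq F 2)
      (ev P (algebraMap F[X] _ h))⁻¹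
    refine ⟨s, ?_⟩
    rw [pow_two, ← hs, inv_mul_cancel₀ (hev.h_ne_zero P)]
  choose b hb using hb
  have hb0 : ∀ P, b P ≠ 0 := by
    intro P h0
    have := hb P
    rw [h0] at this
    simp at this
  have hcode : ∀ c s : ℝ, 1 / 2 ≤ c → c * n + r * h.natDegree ≤ n →
      s ≤ (1 - c) * n - r * h.natDegree →
      (c * n ≤ Module.finrank F (H.code ev b (⌈c * n⌉ - 1 + r * h.natDegree)) ∧
      ∀ x ∈ H.code ev b (⌈c * n⌉ - 1 + r * h.natDegree), x ≠ 0 →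
        s ≤ ({i | x i ≠ 0}.ncard : ℝ)) := by
    intro c s hc hcn hs
    have h1 := Int.le_ceil (c * n)
    have h2 := Int.ceil_lt_add_one (c * n)
    constructor
    · have h3 := H.le_finrank_code hρ hev b (m := ⌈c * n⌉ - 1 + r * h.natDegree) hb0 (by
        have : 0 ≤ ⌈c * n⌉ := Int.ceil_nonneg (by positivity)
        linarith) (by
        rw [← hn]
        have : ((⌈c * n⌉ - 1 + r * h.natDegree : ℤ) : ℝ) < (n : ℤ) := by
          push_cast
          linarith
        exact_mod_cast this)
      have h4 : ⌈c * n⌉ ≤ (Module.finrank F (H.code ev b (⌈c * n⌉ - 1 + r * h.natDegree)) : ℤ) := by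
        linarith
      refine h1.trans ?_
      exact_mod_cast h4
    · intro x hx hx0
      have h3 := H.card_weight hev b hb0 hx hx0
      rw [← hn] at h3
      have h4 : ((n - (⌈c * n⌉ - 1 + r * h.natDegree) : ℤ) : ℝ) ≤
          (({i | x i ≠ 0}.ncard : ℤ) : ℝ) := by
        exact_mod_cast h3
      push_cast at h4
      linarith
  have hacn : a * n ≤ a' * n := by gcongr
  obtain ⟨hC, hwC⟩ := hcode a d ha (by linarith) hd
  obtain ⟨hC', hwC'⟩ := hcode a' d' (ha.trans haa') ha' hd'
  refine exists_codes_fin hn.symm (H.code_mono b ?_) ?_ hC hwC hC' hwC'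
  · have := Int.ceil_mono hacn
    omega
  · intro y hy
    refine H.mem_code_of_orthogonal hρ hev b hb ?_ hy
    have h1 := Int.le_ceil (a * n)
    have h2 : ((n : ℤ) : ℝ) ≤ ((2 * ⌈a * n⌉ : ℤ) : ℝ) := by
      push_cast
      have : (0 : ℝ) ≤ n := by positivity
      nlinarith
    have h2 : (n : ℤ) ≤ 2 * ⌈a * n⌉ := by exact_mod_cast h2
    rw [← hn]
    linarith

end IsOnePoint

/-- The tower of function fields attaining the bound used below. -/
def HasCurve (F : Type u) [Field F] (l k : ℕ) : Prop :=
  ∃ (L ι : Type u) (_ : Field L) (_ : Fintype ι) (_ : Algebra F L) (_ : Algebra F[X] L)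
    (_ : Algebra (RatFunc F) L) (_ : IsScalarTower F[X] (RatFunc F) L)
    (_ : IsScalarTower F (RatFunc F) L) (_ : IsScalarTower F F[X] L)
    (v : AddValuation L (WithTop ℤ)) (h p : F[X]) (ρ : RatFunc F →ₗ[F] F)
    (ev : ι → integralClosure F[X] L →ₐ[F] F), RatFunc.IsResidue ρ ∧ IsOnePoint v (l ^ k) h ∧
      IsEvalSystem ρ (l ^ k) h p ev ∧ h.natDegree = l ∧ p.natDegree = l ^ 2 - l

theorem charP_two_of_card_eq {K : Type*} [Field K] [Fintype K] {n : ℕ}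
    (hcard : Fintype.card K = 2 ^ n) : CharP K 2 := by
  obtain ⟨p, hp⟩ := CharP.exists K
  obtain ⟨k, hp', hk⟩ := FiniteField.card K p
  rw [hcard] at hk
  have h : p ∣ 2 ^ n := hk ▸ dvd_pow_self p k.ne_zero
  rwa [(Nat.prime_dvd_prime_iff_eq hp' Nat.prime_two).1 (hp'.dvd_of_dvd_pow h)] at hp

theorem ag_code_triples_of_hasCurve (m : ℕ) (hm : 3 ≤ m)
    (K : Type u) [Field K] [Fintype K] (hcard : Fintype.card K = 2 ^ (2 * m))
    (hcurve : ∀ k, HasCurve K (2 ^ m) k)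
    (γ : ℝ) (hγ : γ = 1 / (2 ^ m - 2))
    (α' α : ℝ) (h1 : 2 * γ ≤ α') (h2 : α' ≤ α) (h3 : α ≤ 1 / 2 + γ) :
    ∀ ε : ℝ, 0 < ε → ∀ N : ℕ, ∃ n : ℕ, N ≤ n ∧
      ∃ C C' : Submodule K (Fin n → K), C ≤ C' ∧
        (∀ x : Fin n → K, (∀ y ∈ C, ∑ i, x i * y i = 0) → x ∈ C) ∧
        ((1 - α' + γ - ε) * n ≤ (Module.finrank K C' : ℝ) ∧
          ∀ x ∈ C', x ≠ (0 : Fin n → K) →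
            (α' - 2 * γ - ε) * n ≤ ({i | x i ≠ 0}.ncard : ℝ)) ∧
        ((1 - α + γ - ε) * n ≤ (Module.finrank K C : ℝ) ∧
          ∀ x ∈ C, x ≠ (0 : Fin n → K) →
            (α - 2 * γ - ε) * n ≤ ({i | x i ≠ 0}.ncard : ℝ)) := by
  intro ε hε N
  have := charP_two_of_card_eq hcard
  obtain ⟨L, ι, _, _, _, _, _, _, _, _, v, h, p, ρ, ev, hρ, H, hev, hh, hp⟩ := hcurve N
  have hl8 : 8 ≤ 2 ^ m := by
    calc 8 = 2 ^ 3 := by norm_num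
      _ ≤ _ := Nat.pow_le_pow_right (by norm_num) hm
  set l : ℕ := 2 ^ m with hl
  have hl' : (2 ^ m : ℝ) = l := by rw [hl]; push_cast; rfl
  rw [hl'] at hγ
  have hlr : (8 : ℝ) ≤ l := by exact_mod_cast hl8
  have hcardι := hev.card_eq
  rw [hp] at hcardι
  have hn : ((Fintype.card ι : ℕ) : ℝ) = l ^ N * (l ^ 2 - l) := by
    rw [hcardι, Nat.cast_mul, Nat.cast_sub (by nlinarith)]
    push_cast; ring
  set n := Fintype.card ι with hnn
  have hNn : N ≤ n := by
    rw [hcardι]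
    have h5 : N < l ^ N := Nat.lt_pow_self (by omega)
    have h6 : 1 ≤ l ^ 2 - l := Nat.le_sub_of_add_le (by nlinarith)
    nlinarith
  have hn0 : (0 : ℝ) ≤ n := by positivity
  have hl2 : (0 : ℝ) < l - 2 := by linarith
  have hγn : ((l ^ N : ℕ) : ℝ) * h.natDegree ≤ γ * n := by
    rw [hh, hn, hγ]
    push_cast
    rw [one_div, ← div_eq_inv_mul, le_div_iff₀ hl2]
    have : (0 : ℝ) ≤ l ^ N := by positivity
    have h7 : (l : ℝ) * (l - 2) ≤ l ^ 2 - l := by nlinarith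
    calc (l : ℝ) ^ N * l * (l - 2) = l ^ N * (l * (l - 2)) := by ring
      _ ≤ _ := mul_le_mul_of_nonneg_left h7 this
  refine ⟨n, hNn, ?_⟩
  obtain ⟨C, C', h5, h6, ⟨h7, h8⟩, h9, h10⟩ := H.exists_codes hρ hev (a := 1 - α + γ)
    (a' := 1 - α' + γ) (n := n) (d := (α - 2 * γ) * n) (d' := (α' - 2 * γ) * n) (by linarith)
    (by linarith) hnn (by nlinarith) (by nlinarith) (by nlinarith)
  have hεn : 0 ≤ ε * n := by positivity
  refine ⟨C, C', h5, h6, ⟨by linarith, fun x hx hx0 => le_trans (by linarith) (h8 x hx hx0)⟩,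
    by linarith, fun x hx hx0 => le_trans (by linarith) (h10 x hx hx0)⟩

section LaurentSeries

open HahnSeries hiding C

theorem exists_powerSeries_pow_add_eq {F : Type*} [Field F] {l : ℕ} (hl : 2 ≤ l)
    (s : PowerSeries F) : ∃ w : PowerSeries F,
      w ^ l + w = PowerSeries.X * s ∧ w ∈ Ideal.span {(PowerSeries.X : PowerSeries F)} := by
  let f : Polynomial (PowerSeries F) := X ^ l + X - Polynomial.C (PowerSeries.X * s)
  have hf : f = X ^ l + (X - Polynomial.C (PowerSeries.X * s)) := by simp only [f]; ring
  have hmon : f.Monic := by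
    rw [hf]
    refine monic_X_pow_add ?_
    refine (degree_X_sub_C_le _).trans_lt ?_
    exact_mod_cast hl
  have h0 : f.eval 0 = - (PowerSeries.X * s) := by
    simp [f, zero_pow (by omega : l ≠ 0)]
  have h1 : f.derivative.eval 0 = 1 := by
    simp [f, derivative_X_pow, zero_pow (by omega : l - 1 ≠ 0)]
  obtain ⟨w, hw, hw0⟩ := HenselianRing.is_henselian
    (I := Ideal.span {(PowerSeries.X : PowerSeries F)})
    f hmon 0 (by
      rw [h0]
      exact neg_mem (Ideal.mul_mem_right _ _ (Ideal.mem_span_singleton_self _))) (by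
      rw [h1, map_one]
      exact isUnit_one)
  refine ⟨w, ?_, by simpa using hw0⟩
  have : w ^ l + w - PowerSeries.X * s = 0 := by simpa [f, IsRoot] using hw
  exact sub_eq_zero.1 this

theorem AddValuation.one_add_eq {L : Type*} [Field L] {v : AddValuation L (WithTop ℤ)} {f : L}
    (hf : ((1 : ℤ) : WithTop ℤ) ≤ v f) : v (1 + f) = ((0 : ℤ) : WithTop ℤ) := by
  have h1 : v 1 < v f := by
    rw [v.map_one]
    exact lt_of_lt_of_le (by exact_mod_cast (zero_lt_one : (0:ℤ) < 1)) hf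
  rw [v.map_add_eq_of_lt_left h1, v.map_one]
  rfl

theorem LaurentSeries.le_addVal_ofPowerSeries {F : Type*} [Field F] (n : ℕ) (w : PowerSeries F) :
    ((n : ℤ) : WithTop ℤ) ≤ addVal ℤ F (ofPowerSeries ℤ F (PowerSeries.X ^ n * w)) := by
  rw [addVal_apply, le_orderTop_iff_forall]
  intro i hi
  have hi : i < n := by exact_mod_cast hi
  rw [PowerSeries.coeff_coe]
  split_ifs with h
  · rfl
  · rw [PowerSeries.coeff_X_pow_mul', if_neg (by omega)]

theorem LaurentSeries.exists_ofPowerSeries {F : Type*} [Field F] (n : ℕ) {f : LaurentSeries F}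
    (hf : ((n : ℤ) : WithTop ℤ) ≤ addVal ℤ F f) :
    ∃ w : PowerSeries F, f = ofPowerSeries ℤ F (PowerSeries.X ^ n * w) := by
  by_cases h0 : f = 0
  · exact ⟨0, by simp [h0]⟩
  rw [addVal_apply_of_ne h0] at hf
  have hf : (n : ℤ) ≤ f.order := by exact_mod_cast hf
  refine ⟨PowerSeries.X ^ (f.order.toNat - n) * f.powerSeriesPart, ?_⟩
  rw [← mul_assoc, ← _root_.pow_add, LaurentSeries.X_order_mul_powerSeriesPart]
  omega

theorem LaurentSeries.exists_pow_add_eq {F : Type*} [Field F] {l : ℕ} (hl : 2 ≤ l)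
    {s : LaurentSeries F} {a : ℤ} (ha : 0 < a) (hs : addVal ℤ F s = (a : WithTop ℤ)) :
    ∃ w : LaurentSeries F, w ^ l + w = s ∧ addVal ℤ F w = (a : WithTop ℤ) := by
  obtain ⟨s', hs'⟩ := exists_ofPowerSeries 1 (f := s) (by
    rw [hs]
    have : ((1 : ℕ) : ℤ) ≤ a := by push_cast; omega
    exact_mod_cast this)
  rw [pow_one] at hs'
  obtain ⟨w, hw, hw0⟩ := exists_powerSeries_pow_add_eq hl s'
  obtain ⟨w', rfl⟩ := Ideal.mem_span_singleton.1 hw0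
  set W := ofPowerSeries ℤ F (PowerSeries.X * w') with hW
  have h1 : W ^ l + W = s := by
    rw [hs', ← hw, map_add, map_pow]
  refine ⟨W, h1, ?_⟩
  have h2 : ((1 : ℤ) : WithTop ℤ) ≤ addVal ℤ F W := by
    have := le_addVal_ofPowerSeries 1 w'
    rwa [pow_one] at this
  have h3 : addVal ℤ F (1 + W ^ (l - 1)) = ((0 : ℤ) : WithTop ℤ) :=
    AddValuation.one_add_eq (AddValuation.int_le_pow _ h2 (by omega))
  have h4 : W * (1 + W ^ (l - 1)) = s := by
    rw [← h1, mul_add, mul_one, ← pow_succ', Nat.sub_add_cancel (by omega)]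
    ring
  rw [← hs, ← h4, AddValuation.map_mul, h3]
  simp

theorem LaurentSeries.exists_next {F : Type*} [Field F] {l : ℕ} (hl : 2 ≤ l)
    {w : LaurentSeries F} {a : ℤ} (ha : 0 < a) (hw : addVal ℤ F w = (a : WithTop ℤ)) :
    ∃ w' : LaurentSeries F, (w⁻¹ ^ l + w⁻¹) * (w' ^ l + w') = 1 ∧
      addVal ℤ F w' = ((l * a : ℤ) : WithTop ℤ) := by
  have h1 : ((1 : ℤ) : WithTop ℤ) ≤ addVal ℤ F (w ^ (l - 1)) :=
    AddValuation.int_le_pow (a := a) _ hw.ge (by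
      have : (1 : ℤ) ≤ (l - 1 : ℕ) := by exact_mod_cast (by omega : 1 ≤ l - 1)
      nlinarith)
  have h2 := AddValuation.one_add_eq h1
  have hw0 := AddValuation.ne_zero_of_int_eq hw
  have h20 := AddValuation.ne_zero_of_int_eq h2
  have h3 := AddValuation.int_mul_eq (AddValuation.int_pow_eq hw l) (AddValuation.int_inv_eq h2)
  rw [neg_zero, add_zero] at h3
  obtain ⟨w', hw', hv⟩ := exists_pow_add_eq hl (by positivity) h3
  refine ⟨w', ?_, hv⟩
  rw [hw']
  have h5 : w ^ l * (w⁻¹ ^ l + w⁻¹) = 1 + w ^ (l - 1) := by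
    obtain ⟨j, rfl⟩ : ∃ j, l = j + 1 := ⟨l - 1, by omega⟩
    rw [Nat.add_sub_cancel, mul_add, ← mul_pow, mul_inv_cancel₀ hw0, one_pow, pow_succ,
      mul_assoc, mul_inv_cancel₀ hw0, mul_one]
  rw [mul_comm (w ^ l), mul_comm, mul_assoc, h5, inv_mul_cancel₀ h20]

end LaurentSeries

/-- A field with a discrete valuation and elements satisfying the equations of the tower, the
first one being transcendental over the constants. -/
structure IsTower {F E : Type u} [Field F] [Field E] [Algebra F E] [Algebra (RatFunc F) E]
    (v : AddValuation E (WithTop ℤ)) (l k : ℕ) (ξ : ℕ → E) : Prop where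
  v_const : ∀ a : F, a ≠ 0 → v (algebraMap F E a) = ((0 : ℤ) : WithTop ℤ)
  residue : ∀ f : E, ((0 : ℤ) : WithTop ℤ) ≤ v f →
    ∃ c : F, ((1 : ℤ) : WithTop ℤ) ≤ v (f - algebraMap F E c)
  v_ξ : ∀ i ≤ k, v (ξ i) = ((-(l : ℤ) ^ (k - i) : ℤ) : WithTop ℤ)
  rel : ∀ i < k, (ξ (i + 1) ^ l + ξ (i + 1)) * ((ξ i)⁻¹ ^ l + (ξ i)⁻¹) = 1
  algebraMap_X : algebraMap (RatFunc F) E RatFunc.X = ξ 0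

theorem exists_laurent_tower (F : Type u) [Field F] {l : ℕ} (hl : 2 ≤ l) (k : ℕ) :
    ∃ (E : Type u) (_ : Field E) (c : F →+* E) (v : AddValuation E (WithTop ℤ)) (ξ : ℕ → E),
      (∀ a : F, a ≠ 0 → v (c a) = ((0 : ℤ) : WithTop ℤ)) ∧
      (∀ f : E, ((0 : ℤ) : WithTop ℤ) ≤ v f → ∃ a : F, ((1 : ℤ) : WithTop ℤ) ≤ v (f - c a)) ∧
      (∀ i ≤ k, v (ξ i) = ((-(l : ℤ) ^ (k - i) : ℤ) : WithTop ℤ)) ∧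
      ∀ i < k, (ξ (i + 1) ^ l + ξ (i + 1)) * ((ξ i)⁻¹ ^ l + (ξ i)⁻¹) = 1 := by
  have hnext : ∀ (j : ℕ) (w : LaurentSeries F), ∃ w' : LaurentSeries F,
      HahnSeries.addVal ℤ F w = (((l : ℤ) ^ j : ℤ) : WithTop ℤ) →
      (w⁻¹ ^ l + w⁻¹) * (w' ^ l + w') = 1 ∧
      HahnSeries.addVal ℤ F w' = (((l : ℤ) ^ (j + 1) : ℤ) : WithTop ℤ) := by
    intro j w
    by_cases hw : HahnSeries.addVal ℤ F w = (((l : ℤ) ^ j : ℤ) : WithTop ℤ)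
    · obtain ⟨w', h1, h2⟩ := LaurentSeries.exists_next hl (by positivity) hw
      exact ⟨w', fun _ => ⟨h1, by rw [h2, pow_succ']⟩⟩
    · exact ⟨0, fun h => absurd h hw⟩
  choose next hnext using hnext
  let w : ℕ → LaurentSeries F := fun n => Nat.rec (HahnSeries.single 1 1) next n
  have hw : ∀ j, HahnSeries.addVal ℤ F (w j) = (((l : ℤ) ^ j : ℤ) : WithTop ℤ) := by
    intro j
    induction j with
    | zero =>
      show HahnSeries.addVal ℤ F (HahnSeries.single 1 1) = _
      rw [HahnSeries.addVal_apply, HahnSeries.orderTop_single one_ne_zero, pow_zero]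
    | succ j ih => exact (hnext j (w j) ih).2
  refine ⟨LaurentSeries F, inferInstance, HahnSeries.C, HahnSeries.addVal ℤ F,
    fun i => (w (k - i))⁻¹, ?_, ?_, ?_, ?_⟩
  · intro a ha
    rw [HahnSeries.addVal_apply, HahnSeries.C_apply, HahnSeries.orderTop_single ha]
  · intro f hf
    obtain ⟨g, rfl⟩ := LaurentSeries.exists_ofPowerSeries 0 (f := f) (by exact_mod_cast hf)
    rw [pow_zero, one_mul]
    refine ⟨PowerSeries.constantCoeff g, ?_⟩
    rw [← HahnSeries.ofPowerSeries_C, ← map_sub]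
    obtain ⟨g', hg'⟩ := (PowerSeries.X_dvd_iff
      (φ := g - PowerSeries.C (PowerSeries.constantCoeff g))).2
      (by simp)
    rw [hg', ← pow_one (PowerSeries.X : PowerSeries F)]
    exact LaurentSeries.le_addVal_ofPowerSeries 1 g'
  · intro i _
    exact AddValuation.int_inv_eq (hw _)
  · intro i hi
    obtain ⟨j, hj⟩ : ∃ j, k - i = j + 1 := ⟨k - i - 1, by omega⟩
    have hj' : k - (i + 1) = j := by omega
    show ((w (k - (i + 1)))⁻¹ ^ l + (w (k - (i + 1)))⁻¹) *
      ((w (k - i))⁻¹⁻¹ ^ l + (w (k - i))⁻¹⁻¹) = 1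
    rw [hj, hj', inv_inv]
    exact (hnext j (w j) (hw j)).1

theorem AddValuation.map_poly {F E : Type*} [Field F] [Field E] {c : F →+* E}
    {v : AddValuation E (WithTop ℤ)} (hc : ∀ a : F, a ≠ 0 → v (c a) = ((0 : ℤ) : WithTop ℤ))
    {x : E} {a : ℤ} (ha : 0 < a) (hx : v x = ((-a : ℤ) : WithTop ℤ)) {p : F[X]} (hp : p ≠ 0) :
    v (p.eval₂ c x) = ((-a * p.natDegree : ℤ) : WithTop ℤ) := by
  have hc' : ∀ a : F, ((0 : ℤ) : WithTop ℤ) ≤ v (c a) := by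
    intro a
    by_cases h0 : a = 0
    · simp [h0]
    · exact (hc a h0).ge
  rw [eval₂_eq_sum_range, Finset.sum_range_succ]
  have h1 : v (c (p.coeff p.natDegree) * x ^ p.natDegree) =
      ((-a * p.natDegree : ℤ) : WithTop ℤ) := by
    rw [AddValuation.int_mul_eq (hc _ (by simpa using hp)) (AddValuation.int_pow_eq hx _)]
    congr 1
    ring
  rw [v.map_add_eq_of_lt_right, h1]
  rw [h1]
  refine v.map_lt_sum (WithTop.coe_ne_top) fun i hi => ?_
  have hi : i < p.natDegree := Finset.mem_range.1 hi
  refine lt_of_lt_of_le ?_ (AddValuation.int_le_mul (c := -a * i) (hc' _)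
    (AddValuation.int_pow_eq hx i).ge (by linarith))
  have : (i : ℤ) < p.natDegree := by exact_mod_cast hi
  have : -a * p.natDegree < -a * i := by nlinarith
  exact_mod_cast this

theorem exists_isTower (F : Type u) [Field F] {l : ℕ} (hl : 2 ≤ l) (k : ℕ) :
    ∃ (E : Type u) (_ : Field E) (_ : Algebra F E) (_ : Algebra F[X] E) (_ : Algebra (RatFunc F) E)
      (_ : IsScalarTower F[X] (RatFunc F) E) (_ : IsScalarTower F (RatFunc F) E)
      (_ : IsScalarTower F F[X] E) (v : AddValuation E (WithTop ℤ)) (ξ : ℕ → E),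
      IsTower (F := F) v l k ξ := by
  obtain ⟨E, _, c, v, ξ, h1, h2, h3, h4⟩ := exists_laurent_tower F hl k
  have hinj : Function.Injective (eval₂RingHom c (ξ 0)) := by
    rw [injective_iff_map_eq_zero]
    intro p hp
    by_contra hp0
    have := AddValuation.map_poly h1 (by positivity) (h3 0 (Nat.zero_le _)) hp0
    exact AddValuation.ne_zero_of_int_eq this hp
  let φ : RatFunc F →+* E := IsLocalization.lift (M := nonZeroDivisors F[X]) (S := RatFunc F)
    (g := eval₂RingHom c (ξ 0)) (fun y => by
      rw [isUnit_iff_ne_zero]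
      intro h0
      exact nonZeroDivisors.ne_zero y.2 (hinj (h0.trans (map_zero _).symm)))
  have hφ : ∀ p : F[X], φ (algebraMap F[X] (RatFunc F) p) = p.eval₂ c (ξ 0) := fun p =>
    IsLocalization.lift_eq _ _
  let _ : Algebra (RatFunc F) E := φ.toAlgebra
  let _ : Algebra F[X] E := (φ.comp (algebraMap F[X] (RatFunc F))).toAlgebra
  let _ : Algebra F E := (φ.comp (algebraMap F (RatFunc F))).toAlgebra
  have i1 : IsScalarTower F[X] (RatFunc F) E := IsScalarTower.of_algebraMap_eq fun _ => rfl
  have i2 : IsScalarTower F (RatFunc F) E := IsScalarTower.of_algebraMap_eq fun _ => rfl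
  have i3 : IsScalarTower F F[X] E := IsScalarTower.of_algebraMap_eq fun a => by
    show φ (algebraMap F (RatFunc F) a) = φ (algebraMap F[X] (RatFunc F) (algebraMap F F[X] a))
    rw [← IsScalarTower.algebraMap_apply]
  have hc : ∀ a : F, algebraMap F E a = c a := by
    intro a
    rw [IsScalarTower.algebraMap_apply F F[X] E]
    exact (hφ _).trans (by simp)
  refine ⟨E, inferInstance, inferInstance, inferInstance, inferInstance, i1, i2, i3, v, ξ,
    ⟨by simpa only [hc] using h1, by simpa only [hc] using h2, h3, h4, ?_⟩⟩
  rw [← RatFunc.algebraMap_X]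
  exact (hφ X).trans (by simp)

/-- Terms with distinct valuations cannot cancel. -/
theorem AddValuation.map_sum_le {R ι : Type*} [Ring R] (v : AddValuation R (WithTop ℤ))
    (s : Finset ι) (f : ι → R) (hf : ∀ i ∈ s, ∀ j ∈ s, i ≠ j → v (f i) ≠ ⊤ → v (f i) ≠ v (f j))
    {i : ι} (hi : i ∈ s) : v (∑ j ∈ s, f j) ≤ v (f i) := by
  classical
  obtain ⟨i₀, hi₀, hmin⟩ := s.exists_min_image (fun j => v (f j)) ⟨i, hi⟩
  refine le_trans ?_ (hmin i hi)
  by_cases ht : v (f i₀) = ⊤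
  · rw [ht]; exact le_top
  rw [← Finset.add_sum_erase s f hi₀, v.map_add_eq_of_lt_left]
  refine v.map_lt_sum ht fun j hj => ?_
  rw [Finset.mem_erase] at hj
  exact lt_of_le_of_ne (hmin j hj.2) (hf i₀ hi₀ j hj.2 hj.1.symm ht)

section PowerBasis

variable {L L' : Type*} [Field L] [Field L'] [Algebra L L'] {y : L'}

theorem exists_powerBasis_gen_eq (hy : IsIntegral L y) (htop : Algebra.adjoin L {y} = ⊤) :
    ∃ pb : PowerBasis L L', pb.gen = y ∧ pb.dim = (minpoly L y).natDegree :=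
  ⟨PowerBasis.ofAdjoinEqTop' hy htop, by simp, by simp⟩

theorem exists_eq_sum_pow (hy : IsIntegral L y) (htop : Algebra.adjoin L {y} = ⊤) (f : L') :
    ∃ c : ℕ → L, f = ∑ j ∈ Finset.range (minpoly L y).natDegree, algebraMap L L' (c j) * y ^ j := by
  obtain ⟨pb, rfl, hd⟩ := exists_powerBasis_gen_eq hy htop
  refine ⟨fun j => if h : j < pb.dim then pb.basis.repr f ⟨j, h⟩ else 0, ?_⟩
  conv_lhs => rw [← pb.basis.sum_repr f]
  rw [← hd, Finset.sum_range]
  refine Finset.sum_congr rfl fun i _ => ?_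
  simp [pb.basis_eq_pow, Algebra.smul_def]

/-- Euler's formula for the dual basis of a power basis. -/
theorem sum_trace_mul_coeff_minpolyDiv [Algebra.IsSeparable L L'] [FiniteDimensional L L']
    (htop : Algebra.adjoin L {y} = ⊤) (f : L') :
    aeval y (derivative (minpoly L y)) * f = ∑ j ∈ Finset.range (minpoly L y).natDegree,
      algebraMap L L' (Algebra.trace L L' (f * y ^ j)) * (minpolyDiv L y).coeff j := by
  obtain ⟨pb, rfl, hd⟩ := exists_powerBasis_gen_eq (Algebra.IsIntegral.isIntegral (R := L) y) htop
  have h1 : aeval pb.gen (derivative (minpoly L pb.gen)) ≠ 0 :=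
    (Algebra.IsSeparable.isSeparable L pb.gen).aeval_derivative_ne_zero (minpoly.aeval _ _)
  conv_lhs => rw [← pb.basis.traceDual.sum_repr f]
  rw [← hd, Finset.sum_range, Finset.mul_sum]
  refine Finset.sum_congr rfl fun i _ => ?_
  rw [Module.Basis.traceDual_repr_apply, Module.Basis.traceDual_powerBasis_eq, pb.basis_eq_pow,
    Algebra.smul_def, Algebra.traceForm_apply]
  field_simp

theorem sum_trace_mul_pow [Algebra.IsSeparable L L'] [FiniteDimensional L L']
    (htop : Algebra.adjoin L {y} = ⊤) (f : L') :
    aeval y (derivative (minpoly L y)) * f = ∑ j ∈ Finset.range (minpoly L y).natDegree,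
      algebraMap L L' (Algebra.trace L L' (f * (minpolyDiv L y).coeff j /
        aeval y (derivative (minpoly L y)))) * (aeval y (derivative (minpoly L y)) * y ^ j) := by
  obtain ⟨pb, rfl, hd⟩ := exists_powerBasis_gen_eq (Algebra.IsIntegral.isIntegral (R := L) y) htop
  conv_lhs => rw [← pb.basis.sum_repr f]
  rw [← hd, Finset.sum_range, Finset.mul_sum]
  refine Finset.sum_congr rfl fun i _ => ?_
  have h2 := Module.Basis.traceDual_repr_apply (b := pb.basis.traceDual) f i
  rw [Module.Basis.traceDual_traceDual] at h2
  rw [h2, Module.Basis.traceDual_powerBasis_eq, pb.basis_eq_pow,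
    Algebra.smul_def, Algebra.traceForm_apply, mul_div_assoc]
  ring

end PowerBasis

/-- The extension `L'` of `L` is generated by a root `y` of the irreducible polynomial
`Y ^ l + Y - z`. -/
structure IsStep {L L' : Type*} [Field L] [Field L'] [Algebra L L'] (l : ℕ) (z : L) (y : L') :
    Prop where
  two_le : 2 ≤ l
  cast_eq_zero : (l : L) = 0
  adjoin_eq_top : Algebra.adjoin L {y} = ⊤
  eq : y ^ l + y = algebraMap L L' z
  minpoly_eq : minpoly L y = X ^ l + X - C z

namespace IsStep

variable {K L L' : Type*} [Field K] [Field L] [Field L'] [Algebra K L] [Algebra K L']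
  [Algebra L L'] [IsScalarTower K L L'] {l : ℕ} {z : L} {y : L'}

theorem poly_eq (l : ℕ) (z : L) : (X ^ l + X - C z : L[X]) = X ^ l + (X - C z) := by ring

theorem poly_monic (hl : 2 ≤ l) (z : L) : (X ^ l + X - C z : L[X]).Monic := by
  rw [poly_eq]
  refine monic_X_pow_add ((degree_X_sub_C_le _).trans_lt ?_)
  exact_mod_cast hl

theorem poly_natDegree (hl : 2 ≤ l) (z : L) : (X ^ l + X - C z : L[X]).natDegree = l := by
  rw [poly_eq]
  refine (natDegree_add_eq_left_of_natDegree_lt ?_).trans (natDegree_X_pow l)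
  rw [natDegree_X_sub_C, natDegree_X_pow]
  omega

/-- Total ramification at infinity forces the defining polynomial to be irreducible. -/
theorem of_addValuation (hl : 2 ≤ l) (hl0 : (l : L) = 0) (htop : Algebra.adjoin L {y} = ⊤)
    (hy : y ^ l + y = algebraMap L L' z) {v : AddValuation L' (WithTop ℤ)} {q : ℤ} (hq : 0 < q)
    (hvy : v y = ((-q : ℤ) : WithTop ℤ))
    (hv : ∀ f : L, f ≠ 0 → ∃ n : ℤ, v (algebraMap L L' f) = ((l * q * n : ℤ) : WithTop ℤ)) :
    IsStep l z y ∧ ∀ (c : ℕ → L), ∀ j < l,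
      v (∑ j ∈ Finset.range l, algebraMap L L' (c j) * y ^ j) ≤
        v (algebraMap L L' (c j) * y ^ j) := by
  have key : ∀ (c : ℕ → L), ∀ j < l,
      v (∑ j ∈ Finset.range l, algebraMap L L' (c j) * y ^ j) ≤
        v (algebraMap L L' (c j) * y ^ j) := by
    intro c j hj
    refine v.map_sum_le _ (fun j => algebraMap L L' (c j) * y ^ j) ?_ (Finset.mem_range.2 hj)
    intro i hi j hj hij hi0 heq
    rw [Finset.mem_range] at hi hj
    have hval : ∀ i, v (algebraMap L L' (c i) * y ^ i) ≠ ⊤ → ∃ n : ℤ,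
        v (algebraMap L L' (c i) * y ^ i) = ((l * q * n - i * q : ℤ) : WithTop ℤ) := by
      intro i hi
      have hci : c i ≠ 0 := by
        intro h0
        apply hi
        rw [h0, map_zero, zero_mul, v.map_zero]
      obtain ⟨n, hn⟩ := hv _ hci
      refine ⟨n, ?_⟩
      rw [AddValuation.int_mul_eq hn (AddValuation.int_pow_eq hvy i)]
      congr 1
      ring
    obtain ⟨n, hn⟩ := hval i hi0
    obtain ⟨n', hn'⟩ := hval j (heq ▸ hi0)
    rw [hn, hn'] at heq
    have heq : (l * q * n - i * q : ℤ) = l * q * n' - j * q := by exact_mod_cast heq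
    have h1 : ((i : ℤ) - j) = l * (n - n') := by
      have : q * ((i : ℤ) - j) = q * (l * (n - n')) := by linear_combination -heq
      exact mul_left_cancel₀ hq.ne' this
    have h2 : (l : ℤ) ∣ (i : ℤ) - j := ⟨_, h1⟩
    have h3 := Int.eq_zero_of_abs_lt_dvd h2 (by rw [abs_lt]; omega)
    omega
  refine ⟨⟨hl, hl0, htop, hy, ?_⟩, key⟩
  have hmon := poly_monic hl z
  have hroot : aeval y (X ^ l + X - C z : L[X]) = 0 := by simp [hy]
  have h_int : IsIntegral L y := ⟨_, hmon, hroot⟩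
  refine (eq_of_monic_of_dvd_of_natDegree_le (minpoly.monic h_int) hmon
    (minpoly.dvd _ _ hroot) ?_).symm
  rw [poly_natDegree hl]
  by_contra hlt
  rw [not_le] at hlt
  have h1 := key (minpoly L y).coeff _ hlt
  have h2 : ∑ j ∈ Finset.range l, algebraMap L L' ((minpoly L y).coeff j) * y ^ j = 0 := by
    rw [← minpoly.aeval L y, aeval_eq_sum_range' hlt]
    exact Finset.sum_congr rfl fun _ _ => (Algebra.smul_def _ _).symm
  rw [h2, v.map_zero, coeff_natDegree, minpoly.monic h_int, map_one, one_mul,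
    AddValuation.int_pow_eq hvy] at h1
  exact WithTop.coe_ne_top (top_le_iff.1 h1)

variable (H : IsStep l z y)
include H

theorem isIntegral : IsIntegral L y :=
  ⟨_, poly_monic H.two_le z, by simp [H.eq]⟩

theorem natDegree_minpoly : (minpoly L y).natDegree = l := by
  rw [H.minpoly_eq, poly_natDegree H.two_le]

theorem derivative_minpoly : derivative (minpoly L y) = 1 := by
  rw [H.minpoly_eq]
  simp [derivative_X_pow, H.cast_eq_zero]

theorem finiteDimensional : FiniteDimensional L L' := by
  obtain ⟨pb, _⟩ := exists_powerBasis_gen_eq H.isIntegral H.adjoin_eq_top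
  exact pb.finite

theorem isSeparable : Algebra.IsSeparable L L' := by
  have h1 : IsSeparable L y := by
    rw [IsSeparable, Polynomial.Separable, H.derivative_minpoly]
    exact isCoprime_one_right
  have h2 : IntermediateField.adjoin L {y} = ⊤ := by
    rw [← IntermediateField.toSubalgebra_inj,
      IntermediateField.adjoin_simple_toSubalgebra_of_isAlgebraic H.isIntegral.isAlgebraic,
      H.adjoin_eq_top, IntermediateField.top_toSubalgebra]
  have h3 := (IntermediateField.isSeparable_adjoin_simple_iff_isSeparable L L').2 h1
  rw [h2] at h3
  exact Algebra.IsSeparable.of_algHom L (⊤ : IntermediateField L L')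
    IntermediateField.topEquiv.symm.toAlgHom

theorem minpolyDiv_eq : minpolyDiv L y =
    ∑ i ∈ Finset.range l, X ^ i * C (y ^ (l - 1 - i)) + 1 := by
  have h1 := minpolyDiv_spec L y
  refine mul_right_cancel₀ (X_sub_C_ne_zero y) (h1.trans ?_)
  have h2 : (∑ i ∈ Finset.range l, X ^ i * C y ^ (l - 1 - i)) * (X - C y) = X ^ l - C y ^ l :=
    (Commute.all _ _).geom_sum₂_mul l
  simp_rw [C_pow]
  rw [add_mul, h2, H.minpoly_eq]
  simp only [Polynomial.map_sub, Polynomial.map_add, Polynomial.map_pow, map_X, map_C, ← H.eq,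
    map_add, map_pow]
  ring

theorem coeff_minpolyDiv_eq {j : ℕ} (hj : j < l) :
    (minpolyDiv L y).coeff j = y ^ (l - 1 - j) + if j = 0 then 1 else 0 := by
  rw [H.minpolyDiv_eq, coeff_add, finsetSum_coeff, coeff_one]
  congr 1
  · simp_rw [coeff_mul_C, coeff_X_pow]
    simp [hj]

/-- The coordinates of `f` in the power basis. -/
theorem eq_sum_trace (f : L') : f = ∑ j ∈ Finset.range l,
    algebraMap L L' (Algebra.trace L L' (f * (minpolyDiv L y).coeff j)) * y ^ j := by
  have := H.finiteDimensional
  have := H.isSeparable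
  have h1 := sum_trace_mul_pow H.adjoin_eq_top f
  simpa [H.derivative_minpoly, H.natDegree_minpoly] using h1

theorem trace_pow {j : ℕ} (hj : j < l) :
    Algebra.trace L L' (y ^ j) = if j = l - 1 then 1 else 0 := by
  have := H.finiteDimensional
  have := H.isSeparable
  have hl := H.two_le
  obtain ⟨pb, hpb, hd⟩ := exists_powerBasis_gen_eq H.isIntegral H.adjoin_eq_top
  rw [H.natDegree_minpoly] at hd
  have h1 := pb.basis.trace_mul_traceDual (⟨j, by omega⟩ : Fin pb.dim) ⟨l - 1, by omega⟩
  rw [Module.Basis.traceDual_powerBasis_eq, pb.basis_eq_pow, hpb, H.derivative_minpoly,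
    H.coeff_minpolyDiv_eq (by simp; omega)] at h1
  simpa [Fin.ext_iff, show l - 1 ≠ 0 by omega, eq_comm] using h1

theorem trace_sum (c : ℕ → L) :
    Algebra.trace L L' (∑ j ∈ Finset.range l, algebraMap L L' (c j) * y ^ j) = c (l - 1) := by
  have hl := H.two_le
  rw [map_sum, Finset.sum_eq_single (l - 1)]
  · rw [← Algebra.smul_def, map_smul, H.trace_pow (by omega), if_pos rfl, smul_eq_mul, mul_one]
  · intro j hj hne
    rw [← Algebra.smul_def, map_smul, H.trace_pow (Finset.mem_range.1 hj), if_neg hne, smul_zero]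
  · intro h
    exact absurd (Finset.mem_range.2 (by omega)) h

end IsStep

/-- The properties at infinity of a stage of a totally ramified tower over `F(X)`; the index `q` of
the value group is the ramification index of the rest of the tower. -/
structure IsInfStage (F : Type u) {L : Type u} [Field F] [Field L] [Algebra (RatFunc F) L]
    (v : AddValuation L (WithTop ℤ)) (q : ℕ) : Prop where
  finite : FiniteDimensional (RatFunc F) L
  separable : Algebra.IsSeparable (RatFunc F) L
  dvd : ∀ f : L, f ≠ 0 → ∃ n : ℤ, v f = ((q * n : ℤ) : WithTop ℤ)
  le_trace : ∀ f : L, v f ≤ v (algebraMap (RatFunc F) L (Algebra.trace (RatFunc F) L f))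
  dual : ∀ (m : ℤ) (f : L), (∀ g : L, ((-m * q : ℤ) : WithTop ℤ) ≤ v g →
    Algebra.trace (RatFunc F) L (f * g) ∈ RatFunc.degLE F (-2)) →
    (((m + 2) * q : ℤ) : WithTop ℤ) ≤ v f

theorem isInfStage_base {F E : Type u} [Field F] [Field E] [Algebra (RatFunc F) E]
    {v : AddValuation E (WithTop ℤ)} {q : ℕ} (hq : 0 < q)
    (hv : ∀ φ : RatFunc F, φ ≠ 0 →
      v (algebraMap (RatFunc F) E φ) = ((-(q : ℤ) * φ.intDegree : ℤ) : WithTop ℤ)) :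
    IsInfStage F (v.comap (algebraMap (RatFunc F) E)) q where
  finite := inferInstance
  separable := inferInstance
  dvd f hf := ⟨-f.intDegree, (hv f hf).trans (by congr 1; ring)⟩
  le_trace f := by rw [Algebra.trace_self_apply]; rfl
  dual m f hf := by
    by_cases hf0 : f = 0
    · rw [hf0, AddValuation.map_zero]; exact le_top
    have hX : (RatFunc.X : RatFunc F) ^ m ≠ 0 := zpow_ne_zero _ RatFunc.X_ne_zero
    have h1 := hf (RatFunc.X ^ m) (by
      refine ((hv _ hX).trans ?_).ge
      rw [RatFunc.intDegree_X_zpow]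
      congr 1
      ring)
    rw [Algebra.trace_self_apply] at h1
    have h2 := h1.resolve_left (mul_ne_zero hf0 hX)
    rw [RatFunc.intDegree_mul hf0 hX, RatFunc.intDegree_X_zpow] at h2
    refine le_trans ?_ (hv f hf0).ge
    have hq' : (0 : ℤ) < q := by exact_mod_cast hq
    have : (m + 2) * q ≤ -(q : ℤ) * f.intDegree := by nlinarith
    exact_mod_cast this

theorem IsInfStage.step {F L L' : Type u} [Field F] [Field L] [Field L'] [Algebra (RatFunc F) L]
    [Algebra (RatFunc F) L'] [Algebra L L'] [IsScalarTower (RatFunc F) L L']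
    {v : AddValuation L (WithTop ℤ)} {v' : AddValuation L' (WithTop ℤ)} {l q : ℕ}
    (H : IsInfStage F v (l * q)) (hv : ∀ f, v' (algebraMap L L' f) = v f) {z : L} {y : L'}
    (hl : 2 ≤ l) (hl0 : (l : L) = 0) (htop : Algebra.adjoin L {y} = ⊤)
    (hy : y ^ l + y = algebraMap L L' z) (hq : 0 < q)
    (hvy : v' y = ((-q : ℤ) : WithTop ℤ)) : IsStep l z y ∧ IsInfStage F v' q := by
  have hq' : (0 : ℤ) < q := by exact_mod_cast hq
  obtain ⟨hS, hmin⟩ := IsStep.of_addValuation hl hl0 htop hy hq' hvy (fun f hf => by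
    obtain ⟨n, hn⟩ := H.dvd f hf
    exact ⟨n, by rw [hv, hn]; push_cast; rfl⟩)
  have := H.finite
  have := H.separable
  have := hS.finiteDimensional
  have := hS.isSeparable
  refine ⟨hS, ⟨FiniteDimensional.trans (RatFunc F) L L', Algebra.IsSeparable.trans (RatFunc F) L L',
    ?_, ?_, ?_⟩⟩
  · intro f hf
    obtain ⟨c, hc⟩ := exists_eq_sum_pow hS.isIntegral htop f
    rw [hS.natDegree_minpoly] at hc
    obtain ⟨w, hw⟩ := v'.exists_int_of_ne_zero hf
    -- the valuation of the sum is attained by a term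
    by_contra hcon
    have hlt : v' f < v' f := by
      conv_rhs => rw [hc]
      refine v'.map_lt_sum (by rw [hw]; exact WithTop.coe_ne_top) fun j hj => ?_
      refine lt_of_le_of_ne ?_ ?_
      · conv_lhs => rw [hc]
        exact hmin c j (Finset.mem_range.1 hj)
      · intro heq
        apply hcon
        have hcj : c j ≠ 0 := by
          intro h0
          rw [h0, map_zero, zero_mul, v'.map_zero, hw] at heq
          exact WithTop.coe_ne_top heq
        obtain ⟨n, hn⟩ := H.dvd _ hcj
        rw [← hv] at hn
        refine ⟨l * n - j, ?_⟩
        rw [heq, AddValuation.int_mul_eq hn (AddValuation.int_pow_eq hvy j)]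
        congr 1
        push_cast
        ring
    exact lt_irrefl _ hlt
  · intro f
    obtain ⟨c, hc⟩ := exists_eq_sum_pow hS.isIntegral htop f
    rw [hS.natDegree_minpoly] at hc
    have h1 := hmin c (l - 1) (by omega)
    rw [← hc] at h1
    have h2 : Algebra.trace L L' f = c (l - 1) := by
      conv_lhs => rw [hc]
      exact hS.trace_sum c
    rw [← Algebra.trace_trace (S := L), h2, IsScalarTower.algebraMap_apply (RatFunc F) L L', hv]
    refine le_trans (h1.trans ?_) (H.le_trace _)
    by_cases h0 : c (l - 1) = 0
    · rw [h0, AddValuation.map_zero]; exact le_top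
    obtain ⟨n, hn⟩ := v.exists_int_of_ne_zero h0
    rw [hn, AddValuation.int_mul_eq ((hv _).trans hn) (AddValuation.int_pow_eq hvy _)]
    have : n + ((l - 1 : ℕ) : ℤ) * -q ≤ n := by
      have : (0 : ℤ) ≤ ((l - 1 : ℕ) : ℤ) * q := by positivity
      linarith
    exact_mod_cast this
  · intro m f hf
    rw [hS.eq_sum_trace f]
    refine v'.map_le_sum fun j hj => ?_
    have hj : j < l := Finset.mem_range.1 hj
    set s : ℤ := (m - l + 1 + j) / l with hs
    have hl' : (0 : ℤ) < l := by exact_mod_cast (by omega : 0 < l)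
    have hs1 : s * l ≤ m - l + 1 + j := Int.ediv_mul_le _ hl'.ne'
    have hs2 : m - l + 1 + j < (s + 1) * l := Int.lt_ediv_add_one_mul_self _ hl'
    have hb : ((-(l - 1 - j) * q : ℤ) : WithTop ℤ) ≤ v' ((minpolyDiv L y).coeff j) := by
      rw [hS.coeff_minpolyDiv_eq hj]
      refine v'.map_le_add ?_ ?_
      · rw [AddValuation.int_pow_eq hvy]
        have : -(l - 1 - j : ℤ) * q ≤ ((l - 1 - j : ℕ) : ℤ) * -q := by
          rw [Nat.cast_sub (by omega), Nat.cast_sub (by omega)]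
          push_cast
          linarith
        exact_mod_cast this
      · split_ifs
        · rw [v'.map_one]
          have : -(l - 1 - j : ℤ) * q ≤ 0 := by
            have h1 : (0 : ℤ) ≤ l - 1 - j := by omega
            have := mul_nonneg h1 hq'.le
            linarith
          exact_mod_cast this
        · rw [v'.map_zero]; exact le_top
    have h1 := H.dual s (Algebra.trace L L' (f * (minpolyDiv L y).coeff j)) (by
      intro g hg
      rw [← hv] at hg
      have h2 := hf (algebraMap L L' g * (minpolyDiv L y).coeff j)
        (AddValuation.int_le_mul hg hb (by
          push_cast
          have h3 : (-m : ℤ) ≤ -s * l + -(l - 1 - j) := by linarith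
          have h4 := mul_le_mul_of_nonneg_right h3 hq'.le
          linarith))
      have h3 : f * (algebraMap L L' g * (minpolyDiv L y).coeff j) =
        g • (f * (minpolyDiv L y).coeff j) := by
        rw [Algebra.smul_def]; ring
      rw [h3, ← Algebra.trace_trace (S := L), map_smul, smul_eq_mul, mul_comm] at h2
      exact h2)
    rw [← hv] at h1
    refine AddValuation.int_le_mul h1 (AddValuation.int_pow_eq hvy j).ge ?_
    push_cast
    have h3 : (m + 2 : ℤ) ≤ (s + 2) * l - j := by linarith
    have h4 := mul_le_mul_of_nonneg_right h3 hq'.le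
    linarith

/-- The ring of integers of a valuation is integrally closed. -/
theorem Valuation.le_one_of_eval₂_eq_zero {R L Γ₀ : Type*} [CommRing R] [Field L]
    [LinearOrderedCommGroupWithZero Γ₀] (v : Valuation L Γ₀) {f : R →+* L} {p : R[X]}
    (hp : p.Monic) (hf : ∀ i, v (f (p.coeff i)) ≤ 1) {x : L} (hx : p.eval₂ f x = 0) : v x ≤ 1 := by
  by_contra! hlt
  have h0 : v x ≠ 0 := (zero_lt_one.trans hlt).ne'
  rw [eval₂_eq_sum_range, Finset.sum_range_succ, hp.coeff_natDegree, map_one, one_mul] at hx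
  have h1 : v (∑ i ∈ Finset.range p.natDegree, f (p.coeff i) * x ^ i) < v (x ^ p.natDegree) := by
    refine v.map_sum_lt (by simpa using pow_ne_zero _ h0) fun i hi => ?_
    rw [map_mul, map_pow, map_pow]
    refine (mul_le_of_le_one_left' (hf i)).trans_lt ?_
    exact pow_lt_pow_right₀ hlt (Finset.mem_range.1 hi)
  have h2 := v.map_add_eq_of_lt_right h1
  rw [hx, map_zero] at h2
  rw [← h2] at h1
  exact not_lt_zero h1

theorem Valuation.le_one_of_isIntegral {R L Γ₀ : Type*} [CommRing R] [Field L] [Algebra R L]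
    [LinearOrderedCommGroupWithZero Γ₀] {v : Valuation L Γ₀}
    (hv : ∀ a : R, v (algebraMap R L a) ≤ 1) {x : L} (hx : IsIntegral R x) : v x ≤ 1 := by
  obtain ⟨p, hp, h⟩ := hx
  exact v.le_one_of_eval₂_eq_zero hp (fun i => hv _) h

/-- In a Dedekind domain, the ideal generated by two elements is invertible. -/
theorem IsDedekindDomain.exists_add_mul_eq_one (O : Type*) {L : Type*} [CommRing O]
    [IsDedekindDomain O] [Field L] [Algebra O L] [IsFractionRing O L] (c : L) :
    ∃ s t : L, s + c * t = 1 ∧ (∃ a, algebraMap O L a = s) ∧ (∃ a, algebraMap O L a = s * c) ∧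
      (∃ a, algebraMap O L a = t) ∧ ∃ a, algebraMap O L a = t * c := by
  let J : FractionalIdeal (nonZeroDivisors O) L :=
    FractionalIdeal.spanSingleton _ 1 + FractionalIdeal.spanSingleton _ c
  have h1 : (1 : L) ∈ J := (FractionalIdeal.mem_add _ _ _).2
    ⟨1, FractionalIdeal.mem_spanSingleton_self _ _, 0, FractionalIdeal.zero_mem _, add_zero _⟩
  have h2 : c ∈ J := (FractionalIdeal.mem_add _ _ _).2
    ⟨0, FractionalIdeal.zero_mem _, c, FractionalIdeal.mem_spanSingleton_self _ _, zero_add _⟩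
  have hJ : J ≠ 0 := by
    intro h
    rw [h] at h1
    exact one_ne_zero ((FractionalIdeal.mem_zero_iff _).1 h1)
  have h_int : ∀ s ∈ J⁻¹, (∃ a, algebraMap O L a = s) ∧ ∃ a, algebraMap O L a = s * c := by
    intro s hs
    rw [FractionalIdeal.mem_inv_iff hJ] at hs
    obtain ⟨a, ha⟩ := (FractionalIdeal.mem_one_iff _).1 (hs 1 h1)
    exact ⟨⟨a, ha.trans (mul_one _)⟩, (FractionalIdeal.mem_one_iff _).1 (hs c h2)⟩
  have h3 : (1 : L) ∈ J * J⁻¹ := by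
    rw [mul_inv_cancel₀ hJ]
    exact (FractionalIdeal.mem_one_iff _).2 ⟨1, map_one _⟩
  rw [add_mul] at h3
  obtain ⟨s, hs, t, ht, hst⟩ := (FractionalIdeal.mem_add _ _ _).1 h3
  obtain ⟨s, hs', rfl⟩ := FractionalIdeal.mem_singleton_mul.1 hs
  obtain ⟨t, ht', rfl⟩ := FractionalIdeal.mem_singleton_mul.1 ht
  rw [one_mul] at hst
  exact ⟨s, t, hst, (h_int s hs').1, (h_int s hs').2, (h_int t ht').1, (h_int t ht').2⟩

section

variable {A K L L' Γ₀ : Type*} [CommRing A] [Field K] [Algebra A K]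
  [Field L] [Algebra A L] [Algebra K L] [IsScalarTower A K L]
  [Field L'] [Algebra A L'] [Algebra K L'] [IsScalarTower A K L'] [Algebra L L']
  [IsScalarTower A L L'] [IsScalarTower K L L'] [LinearOrderedCommGroupWithZero Γ₀]

/-- Every element of `L` which is integral at a valuation becomes integral over `A` after
multiplication with an integral element which is a unit at the valuation. -/
theorem exists_isIntegral_mul [IsDedekindDomain A] [IsFractionRing A K]
    [FiniteDimensional K L] [Algebra.IsSeparable K L] {v : Valuation L Γ₀}
    (hv : ∀ a : A, v (algebraMap A L a) ≤ 1) {c : L} (hc : v c ≤ 1) :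
    ∃ e : L, IsIntegral A e ∧ v e = 1 ∧ IsIntegral A (e * c) := by
  have : IsDedekindDomain (integralClosure A L) := integralClosure.isDedekindDomain A K L
  have : IsFractionRing (integralClosure A L) L :=
    integralClosure.isFractionRing_of_finite_extension K L
  obtain ⟨s, t, hst, ⟨s₁, hs₁⟩, ⟨s₂, hs₂⟩, ⟨t₁, ht₁⟩, ⟨t₂, ht₂⟩⟩ :=
    IsDedekindDomain.exists_add_mul_eq_one (integralClosure A L) c
  replace hs₁ : IsIntegral A s := hs₁ ▸ s₁.2
  replace hs₂ : IsIntegral A (s * c) := hs₂ ▸ s₂.2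
  replace ht₁ : IsIntegral A t := ht₁ ▸ t₁.2
  replace ht₂ : IsIntegral A (t * c) := ht₂ ▸ t₂.2
  by_cases hvs : v s = 1
  · exact ⟨s, hs₁, hvs, hs₂⟩
  have hvs : v s < 1 := lt_of_le_of_ne (Valuation.le_one_of_isIntegral hv hs₁) hvs
  have hvt := Valuation.le_one_of_isIntegral hv ht₁
  refine ⟨t, ht₁, le_antisymm hvt ?_, ht₂⟩
  by_contra! hlt
  have : v (s + c * t) < 1 := by
    refine v.map_add_lt hvs ?_
    rw [map_mul]
    exact (mul_le_of_le_one_left' hc).trans_lt hlt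
  rw [hst, map_one] at this
  exact lt_irrefl _ this

variable (A K) in
/-- `c` clears the denominators of the trace dual at the valuation `v`. -/
def IsDualBound (v : Valuation L Γ₀) (c : L) : Prop :=
  ∀ f : L, IsDual A K f → v (c * f) ≤ 1

theorem IsDualBound.of_le {v : Valuation L Γ₀} {c c' : L} (h : IsDualBound A K v c)
    (hc : v c' ≤ v c) : IsDualBound A K v c' := fun f hf => by
  refine le_trans ?_ (h f hf)
  rw [map_mul, map_mul]
  gcongr

theorem IsDual.trace_mul [FiniteDimensional K L] [FiniteDimensional L L'] {f : L'}
    (hf : IsDual A K f) {e : L'} (he : IsIntegral A e) :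
    IsDual A K (Algebra.trace L L' (f * e)) := by
  intro g hg
  obtain ⟨a, ha⟩ := hf (e * algebraMap L L' g) (he.mul hg.algebraMap)
  refine ⟨a, ha.trans ?_⟩
  rw [← Algebra.trace_trace (S := L), ← mul_assoc, mul_comm _ (algebraMap L L' g),
    ← Algebra.smul_def, map_smul, smul_eq_mul, mul_comm]

theorem IsDualBound.mul_aeval_derivative [FiniteDimensional K L] [FiniteDimensional L L']
    [Algebra.IsSeparable L L'] {v : Valuation L' Γ₀} {c : L}
    (hc : IsDualBound A K (v.comap (algebraMap L L')) c) {x : L'}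
    (htop : Algebra.adjoin L {x} = ⊤) (hx : ∀ i, v (algebraMap L L' ((minpoly L x).coeff i)) ≤ 1)
    {e : L} (he : v (algebraMap L L' e) = 1)
    (hex : IsIntegral A (algebraMap L L' e * x)) :
    IsDualBound A K v (algebraMap L L' c * aeval x (derivative (minpoly L x))) := by
  have hxi : IsIntegral L x := Algebra.IsIntegral.isIntegral x
  have hvx : v x ≤ 1 := v.le_one_of_eval₂_eq_zero (minpoly.monic hxi) hx (minpoly.aeval L x)
  have hcoeff : ∀ n i, (minpoly L x).natDegree < i + n → v ((minpolyDiv L x).coeff i) ≤ 1 := by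
    intro n
    induction n with
    | zero =>
      intro i hi
      rw [coeff_eq_zero_of_natDegree_lt, map_zero]
      · exact zero_le_one
      · exact (natDegree_minpolyDiv_lt hxi).trans (by omega)
    | succ n ih =>
      intro i hi
      rw [coeff_minpolyDiv]
      refine v.map_add_le (hx _) ?_
      rw [map_mul]
      exact mul_le_one' (ih _ (by omega)) hvx
  intro f hf
  set N := (minpoly L x).natDegree
  have key : v (algebraMap L L' e ^ N * (algebraMap L L' c *
      aeval x (derivative (minpoly L x)) * f)) ≤ 1 := by
    rw [mul_assoc (algebraMap L L' c), sum_trace_mul_coeff_minpolyDiv htop f, Finset.mul_sum,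
      Finset.mul_sum]
    refine v.map_sum_le fun j hj => ?_
    rw [Finset.mem_range] at hj
    have h1 : algebraMap L L' e ^ N * (algebraMap L L' c * (algebraMap L L'
        (Algebra.trace L L' (f * x ^ j)) * (minpolyDiv L x).coeff j)) =
        algebraMap L L' (c * Algebra.trace L L' (f * (algebraMap L L' e * x) ^ j)) *
          (algebraMap L L' e ^ (N - j) * (minpolyDiv L x).coeff j) := by
      have h2 : f * (algebraMap L L' e * x) ^ j = e ^ j • (f * x ^ j) := by
        rw [Algebra.smul_def, map_pow]; ring
      rw [h2, map_smul, smul_eq_mul, map_mul (algebraMap L L'), map_mul (algebraMap L L'),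
        map_pow (algebraMap L L')]
      have h3 : algebraMap L L' e ^ N = algebraMap L L' e ^ j * algebraMap L L' e ^ (N - j) := by
        rw [← pow_add]; congr 1; omega
      rw [h3]; ring
    rw [h1, map_mul v, map_mul v, map_pow v, he, one_pow, one_mul]
    exact mul_le_one' (hc _ (hf.trace_mul (hex.pow j))) (hcoeff (N + 1) j (by omega))
  rwa [map_mul, map_pow, he, one_pow, one_mul] at key

end

theorem isIntegral_of_monic_of_isIntegral_coeff {A L L' : Type*} [CommRing A] [Field L] [Field L']
    [Algebra A L] [Algebra A L'] [Algebra L L'] [IsScalarTower A L L'] {p : L[X]} (hp : p.Monic)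
    (hc : ∀ i, IsIntegral A (p.coeff i)) {x : L'} (hx : aeval x p = 0) : IsIntegral A x := by
  have hs : (p.coeffs : Set L) ⊆ (integralClosure A L).toSubring := by
    intro c hc'
    rw [Finset.mem_coe, mem_coeffs_iff] at hc'
    obtain ⟨i, _, rfl⟩ := hc'
    exact hc i
  have h1 : IsIntegral (integralClosure A L) x := by
    refine ⟨p.toSubring (integralClosure A L).toSubring hs, (monic_toSubring _ _ _).2 hp, ?_⟩
    rw [← hx, aeval_def, ← eval_map, ← eval_map]
    congr 1
    ext i
    rw [coeff_map, coeff_map, IsScalarTower.algebraMap_apply (integralClosure A L) L L']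
    congr 1
    exact coeff_toSubring _ _ _
  exact isIntegral_trans (R := A) x h1

section

variable {A K L L' Γ₀ : Type*} [CommRing A] [IsDedekindDomain A] [Field K] [Algebra A K]
  [IsFractionRing A K]
  [Field L] [Algebra A L] [Algebra K L] [IsScalarTower A K L]
  [Field L'] [Algebra A L'] [Algebra K L'] [IsScalarTower A K L'] [Algebra L L']
  [IsScalarTower A L L'] [IsScalarTower K L L'] [LinearOrderedCommGroupWithZero Γ₀]
  [FiniteDimensional K L] [Algebra.IsSeparable K L]
  {l : ℕ} {z : L} {y : L'}

/-- An unramified Artin-Schreier step. -/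
theorem IsStep.isDualBound (H : IsStep l z y) {v : Valuation L' Γ₀}
    (hv : ∀ a : A, v (algebraMap A L' a) ≤ 1) (hz : v (algebraMap L L' z) ≤ 1) {c : L}
    (hc : IsDualBound A K (v.comap (algebraMap L L')) c) :
    IsDualBound A K v (algebraMap L L' c) := by
  have := H.finiteDimensional
  have := H.isSeparable
  have hl := H.two_le
  obtain ⟨e, heA, he, hez⟩ := exists_isIntegral_mul (A := A) (K := K)
    (v := v.comap (algebraMap L L')) (c := z)
    (fun a => by simpa [← IsScalarTower.algebraMap_apply] using hv a) hz
  have h1 := hc.mul_aeval_derivative H.adjoin_eq_top (e := e) ?_ he ?_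
  · simpa [H.derivative_minpoly] using h1
  · intro i
    rw [H.minpoly_eq, coeff_sub, coeff_add, coeff_X_pow, coeff_X, coeff_C]
    rw [map_sub, map_add]
    refine v.map_sub_le (v.map_add_le ?_ ?_) ?_ <;> split_ifs <;> simp [hz]
  · have hp : (X ^ l + (C (e ^ (l - 1)) * X - C (e ^ (l - 1) * (e * z))) : L[X]).Monic := by
      refine monic_X_pow_add ((degree_sub_le _ _).trans_lt (max_lt ?_ ?_))
      · exact (degree_C_mul_X_le _).trans_lt (by exact_mod_cast hl)
      · exact degree_C_le.trans_lt (by exact_mod_cast (by omega : 0 < l))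
    refine isIntegral_of_monic_of_isIntegral_coeff (A := A) hp (fun i => ?_) ?_
    · rw [coeff_add, coeff_sub, coeff_X_pow, coeff_C_mul, coeff_X, coeff_C]
      refine IsIntegral.add ?_ (IsIntegral.sub ((heA.pow _).mul ?_) ?_) <;> split_ifs
      exacts [isIntegral_one, isIntegral_zero, isIntegral_one, isIntegral_zero,
        (heA.pow _).mul hez, isIntegral_zero]
    · have h2 : e ^ l = e ^ (l - 1) * e := by rw [← pow_succ]; congr 1; omega
      have h3 := H.eq
      simp only [map_add, map_sub, map_mul, map_pow, aeval_X, aeval_C, mul_pow]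
      rw [← h3, ← map_pow, h2, map_mul, map_pow]
      ring

theorem IsStep.shift {m : ℕ} [CharP L 2] (H : IsStep (2 ^ m) z y) (w : L) :
    IsStep (2 ^ m) (z - (w ^ 2 ^ m + w)) (y - algebraMap L L' w) where
  two_le := H.two_le
  cast_eq_zero := H.cast_eq_zero
  adjoin_eq_top := by
    rw [eq_top_iff, ← H.adjoin_eq_top, Algebra.adjoin_le_iff, Set.singleton_subset_iff]
    simpa using add_mem (Algebra.self_mem_adjoin_singleton L (y - algebraMap L L' w))
      (algebraMap_mem (Algebra.adjoin L {y - algebraMap L L' w}) w)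
  eq := by
    have : CharP L' 2 := charP_of_injective_algebraMap (algebraMap L L').injective 2
    rw [sub_pow_char_pow, map_sub, ← H.eq, map_add, map_pow]
    ring
  minpoly_eq := by
    rw [minpoly.sub_algebraMap, H.minpoly_eq]
    simp only [sub_comp, add_comp, pow_comp, X_comp, C_comp, C_sub, C_add, C_pow]
    rw [add_pow_char_pow]
    ring

/-- A totally ramified Artin-Schreier step. -/
theorem IsStep.isDualBound_of_one_lt [CharP L 2] (H : IsStep l z y) {v : Valuation L' Γ₀}
    (hv : ∀ a : A, v (algebraMap A L' a) ≤ 1) (hz : 1 < v (algebraMap L L' z)) {c : L}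
    (hc : IsDualBound A K (v.comap (algebraMap L L')) c) :
    IsDualBound A K v (algebraMap L L' (c * z⁻¹) * y⁻¹ ^ (l - 2)) := by
  have := H.finiteDimensional
  have := H.isSeparable
  have hl := H.two_le
  have hz0 : z ≠ 0 := by
    rintro rfl
    simp at hz
  have hzb : v (algebraMap L L' z⁻¹) < 1 := by
    rw [map_inv₀]
    exact (v.one_lt_val_iff (by simpa)).1 hz
  have hy0 : y ≠ 0 := by
    intro h0
    have := H.eq
    rw [h0, zero_pow (by omega), add_zero, eq_comm, map_eq_zero] at this
    exact hz0 this
  obtain ⟨n, rfl⟩ : ∃ n, l = n + 2 := ⟨l - 2, by omega⟩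
  have hzL : algebraMap L L' z ≠ 0 := by simpa
  have hroot : y⁻¹ ^ (n + 2) + algebraMap L L' z⁻¹ * y⁻¹ ^ (n + 1) + algebraMap L L' z⁻¹ = 0 := by
    have : CharP L' 2 := charP_of_injective_algebraMap (algebraMap L L').injective 2
    have h1 := H.eq
    rw [map_inv₀, inv_pow, inv_pow]
    field_simp
    rw [← h1]
    linear_combination (CharTwo.add_self_eq_zero (y ^ (n + 2) + y)) * y ^ (n + 1)
  have htop : Algebra.adjoin L {y⁻¹} = ⊤ := by
    rw [eq_top_iff, ← H.adjoin_eq_top, Algebra.adjoin_le_iff, Set.singleton_subset_iff,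
      SetLike.mem_coe]
    have h1 : y = -(algebraMap L L' z * (y⁻¹ ^ (n + 1)) + y⁻¹ ^ n) := by
      have : y * (y⁻¹ ^ (n + 2) + algebraMap L L' z⁻¹ * y⁻¹ ^ (n + 1) +
          algebraMap L L' z⁻¹) = 0 := by
        rw [hroot, mul_zero]
      rw [map_inv₀, pow_succ _ (n + 1), pow_succ _ n] at this
      rw [pow_succ]
      field_simp at this ⊢
      linear_combination this
    have h2 := Algebra.self_mem_adjoin_singleton L y⁻¹
    rw [h1]
    exact neg_mem (add_mem (mul_mem (algebraMap_mem _ _) (pow_mem (by rwa [← h1]) _))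
      (pow_mem (by rwa [← h1]) _))
  have hmon : (X ^ (n + 2) + (C z⁻¹ * X ^ (n + 1) + C z⁻¹) : L[X]).Monic := by
    refine monic_X_pow_add ((degree_add_le _ _).trans_lt (max_lt ?_ ?_))
    · exact (degree_C_mul_X_pow_le _ _).trans_lt (by exact_mod_cast Nat.lt_succ_self _)
    · exact degree_C_le.trans_lt (by exact_mod_cast (Nat.succ_pos (n + 1)))
  have hmin : minpoly L y⁻¹ = X ^ (n + 2) + (C z⁻¹ * X ^ (n + 1) + C z⁻¹) := by
    have h_int : IsIntegral L y⁻¹ := Algebra.IsIntegral.isIntegral _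
    refine (eq_of_monic_of_dvd_of_natDegree_le (minpoly.monic h_int) hmon
      (minpoly.dvd _ _ ?_) ?_).symm
    · rw [← hroot]
      simp [add_assoc]
    · obtain ⟨pb, _, hd⟩ := exists_powerBasis_gen_eq h_int htop
      obtain ⟨pb', _, hd'⟩ := exists_powerBasis_gen_eq H.isIntegral H.adjoin_eq_top
      rw [← hd, ← pb.finrank, pb'.finrank, hd', H.natDegree_minpoly]
      refine (natDegree_add_le _ _).trans (max_le (natDegree_X_pow_le _) ?_)
      refine (natDegree_add_le _ _).trans (max_le ?_ ?_)
      · exact (natDegree_C_mul_X_pow_le _ _).trans (Nat.le_succ _)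
      · rw [natDegree_C]; omega
  obtain ⟨e, heA, he, hez⟩ := exists_isIntegral_mul (A := A) (K := K)
    (v := v.comap (algebraMap L L')) (c := z⁻¹)
    (fun a => by simpa [← IsScalarTower.algebraMap_apply] using hv a) hzb.le
  have h1 := hc.mul_aeval_derivative htop (e := e) ?_ he ?_
  · convert h1 using 1
    have : CharP L' 2 := charP_of_injective_algebraMap (algebraMap L L').injective 2
    have hn2 : ((n : L') + 2) = 0 := by
      have h0 : ((n + 2 : ℕ) : L') = 0 := by
        rw [← map_natCast (algebraMap L L'), H.cast_eq_zero, map_zero]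
      exact_mod_cast h0
    have hn : ((n : L') + 1) = 1 := by
      linear_combination hn2 - CharTwo.two_eq_zero (R := L')
    rw [hmin]
    simp [map_mul, hn, mul_assoc, one_add_one_eq_two, CharTwo.two_eq_zero (R := L')]
  · intro i
    rw [hmin, coeff_add, coeff_add, coeff_X_pow, coeff_C_mul_X_pow, coeff_C,
      map_add (algebraMap L L'), map_add (algebraMap L L')]
    refine v.map_add_le ?_ (v.map_add_le ?_ ?_) <;> split_ifs <;> first | exact hzb.le | simp
  · have hp : (X ^ (n + 2) + (C (e * z⁻¹) * X ^ (n + 1) + C (e ^ (n + 1) * (e * z⁻¹))) :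
        L[X]).Monic := by
      refine monic_X_pow_add ((degree_add_le _ _).trans_lt (max_lt ?_ ?_))
      · exact (degree_C_mul_X_pow_le _ _).trans_lt (by exact_mod_cast Nat.lt_succ_self _)
      · exact degree_C_le.trans_lt (by exact_mod_cast (Nat.succ_pos (n + 1)))
    refine isIntegral_of_monic_of_isIntegral_coeff (A := A) hp (fun i => ?_) ?_
    · rw [coeff_add, coeff_add, coeff_X_pow, coeff_C_mul_X_pow, coeff_C]
      refine IsIntegral.add ?_ (IsIntegral.add ?_ ?_) <;> split_ifs
      exacts [isIntegral_one, isIntegral_zero, hez, isIntegral_zero,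
        (heA.pow _).mul hez, isIntegral_zero]
    · simp only [map_add, map_mul, map_pow, aeval_X, aeval_C, mul_pow]
      linear_combination algebraMap L L' e ^ (n + 2) * hroot

end

namespace Valuation

variable {L Γ₀ : Type*} [Field L] [LinearOrderedCommGroupWithZero Γ₀] (v : Valuation L Γ₀)

theorem map_pow_add_self_le {l : ℕ} {x : L} (hx : v x ≤ 1) : v (x ^ l + x) ≤ 1 :=
  v.map_add_le (by rw [map_pow]; exact pow_le_one' hx l) hx

theorem map_pow_add_self_lt {l : ℕ} (hl : 2 ≤ l) {x : L} (hx : v x < 1) : v (x ^ l + x) < 1 :=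
  v.map_add_lt (by rw [map_pow]; exact pow_lt_one₀ zero_le hx (by omega)) hx

theorem map_pow_add_self_of_one_lt {l : ℕ} (hl : 2 ≤ l) {x : L} (hx : 1 < v x) :
    v (x ^ l + x) = v x ^ l := by
  rw [v.map_add_eq_of_lt_left, map_pow]
  rw [map_pow]
  conv_lhs => rw [← pow_one (v x)]
  exact pow_lt_pow_right₀ hx (by omega)

theorem le_one_of_map_pow_add_self {l : ℕ} (hl : 2 ≤ l) {x : L} (hx : v (x ^ l + x) ≤ 1) :
    v x ≤ 1 := by
  by_contra! h
  rw [v.map_pow_add_self_of_one_lt hl h] at hx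
  exact absurd hx (not_le.2 (one_lt_pow₀ h (by omega)))

theorem one_lt_of_map_pow_add_self {l : ℕ} {x : L} (hx : 1 < v (x ^ l + x)) : 1 < v x := by
  by_contra! h
  exact absurd hx (not_lt.2 (v.map_pow_add_self_le h))

theorem eq_one_of_map_pow_add_self {l : ℕ} (hl : 2 ≤ l) {x : L} (hx : v (x ^ l + x) = 1) :
    v x = 1 := by
  refine le_antisymm (v.le_one_of_map_pow_add_self hl hx.le) ?_
  by_contra! h
  exact absurd hx (v.map_pow_add_self_lt hl h).ne

theorem map_div_of_one_lt {l : ℕ} (hl : 2 ≤ l) {x : L} (hx : 1 < v x) :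
    v (x ^ (l + 1) / (x ^ l + x)) = v x := by
  rw [map_div₀, v.map_pow_add_self_of_one_lt hl hx, map_pow, pow_succ,
    mul_div_cancel_left₀ _ (pow_ne_zero _ (zero_lt_one.trans hx).ne')]

/-- The reduction of an Artin-Schreier root is a root in the constant field. -/
theorem exists_map_sub_lt_one {F : Type*} [Field F] [Algebra F L] {l : ℕ} (hl : 2 ≤ l)
    (hF : (X ^ l + X : F[X]).Splits) {x : L} (hx : v (x ^ l + x) < 1) :
    ∃ α : F, α ^ l + α = 0 ∧ v (x - algebraMap F L α) < 1 := by
  by_contra! hne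
  have hmon : (X ^ l + X : F[X]).Monic := by
    refine monic_X_pow_add (degree_X_le.trans_lt ?_)
    exact_mod_cast hl
  have h1 : aeval x (X ^ l + X : F[X]) = x ^ l + x := by simp
  have h2 : ∀ s : Multiset F, (∀ a ∈ s, a ∈ (X ^ l + X : F[X]).roots) →
      1 ≤ v (aeval x (s.map (fun a => X - C a)).prod) := by
    intro s
    induction s using Multiset.induction_on with
    | empty => simp
    | cons a s ih =>
      intro hs
      rw [Multiset.map_cons, Multiset.prod_cons, map_mul, map_mul]
      refine one_le_mul_of_one_le_of_one_le ?_ (ih fun b hb => hs b (Multiset.mem_cons_of_mem hb))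
      have h3 := hs a (Multiset.mem_cons_self a s)
      rw [mem_roots hmon.ne_zero] at h3
      simpa using hne a (by simpa using h3)
  have h4 := h2 _ fun a ha => ha
  rw [← hF.eq_prod_roots_of_monic hmon, h1] at h4
  exact absurd hx (not_lt.2 h4)

theorem map_algebraMap_eq_one {F : Type*} [Field F] [Algebra F L]
    (hv : ∀ a : F, v (algebraMap F L a) ≤ 1) {a : F} (ha : a ≠ 0) : v (algebraMap F L a) = 1 := by
  refine le_antisymm (hv a) ?_
  have h1 : v (algebraMap F L a) * v (algebraMap F L a⁻¹) = 1 := by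
    rw [← map_mul, ← map_mul, mul_inv_cancel₀ ha, map_one, map_one]
  rw [← h1]
  exact mul_le_of_le_one_right' (hv _)

theorem div_pow_add_div {l : ℕ} {c t α : L} (ht : t ≠ 0)
    (hc : c ^ l + c = t ^ (l + 1) / (t ^ l + t)) (hα : α ^ l = α) :
    (α ^ 2 / t) ^ l + α ^ 2 / t = α ^ 2 / (c ^ l + c) := by
  have h1 : (α ^ 2 / t) ^ l = α ^ 2 / t ^ l := by
    rw [div_pow, ← pow_mul, mul_comm, pow_mul, hα]
  have : t ^ l ≠ 0 := pow_ne_zero _ ht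
  rw [hc, h1]
  field_simp
  ring

theorem map_sub_le_one_of_unit {m : ℕ} [CharP L 2] (hl : 2 ≤ 2 ^ m) {x t α : L} (ht : t ≠ 0)
    (hx : x ^ 2 ^ m + x = t ^ (2 ^ m + 1) / (t ^ 2 ^ m + t)) (hx0 : x ^ 2 ^ m + x ≠ 0)
    (hα : α ^ 2 ^ m = α) (hvα : v α ≤ 1) (hvx : v (x - α) < 1) :
    v (x ^ (2 ^ m + 1) / (x ^ 2 ^ m + x) - ((α ^ 2 / t) ^ 2 ^ m + α ^ 2 / t)) ≤ 1 := by
  rw [div_pow_add_div ht hx hα]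
  obtain ⟨s, rfl⟩ : ∃ s, x = s + α := ⟨x - α, by ring⟩
  rw [add_sub_cancel_right] at hvx
  have h1 : (s + α) ^ 2 ^ m = s ^ 2 ^ m + α := by rw [add_pow_char_pow, hα]
  have h2 : (s + α) ^ 2 ^ m + (s + α) = s ^ 2 ^ m + s := by
    rw [h1]
    linear_combination CharTwo.add_self_eq_zero α
  rw [h2] at hx0
  rw [pow_succ, h2, h1]
  obtain ⟨n, hn⟩ : ∃ n, 2 ^ m = n + 2 := ⟨2 ^ m - 2, by omega⟩
  rw [hn] at hx0 ⊢
  have hs : s ≠ 0 := by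
    rintro rfl
    simp at hx0
  have h3 : (1 + s ^ (n + 1)) ≠ 0 := by
    intro h
    exact hx0 (by linear_combination s * h)
  have h4 : (s ^ (n + 2) + α) * (s + α) / (s ^ (n + 2) + s) - α ^ 2 / (s ^ (n + 2) + s) =
      α + s ^ (n + 2) / (1 + s ^ (n + 1)) := by
    rw [show s ^ (n + 2) + s = s * (1 + s ^ (n + 1)) by ring]
    field_simp
    ring
  rw [h4]
  refine v.map_add_le hvα ?_
  rw [map_div₀, map_one_add_of_lt, div_one, map_pow]
  · exact pow_le_one' hvx.le _
  · rw [map_pow]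
    exact pow_lt_one₀ zero_le hvx (by omega)

theorem one_lt_of_map_sub_le {x c α : L} (hc : v c < 1) (hc0 : c ≠ 0) (hvα : v α = 1)
    (hx : v (x - α ^ 2 / c) ≤ 1) : v x = (v c)⁻¹ ∧ 1 < v x := by
  have h1 : v (α ^ 2 / c) = (v c)⁻¹ := by rw [map_div₀, map_pow, hvα, one_pow, one_div]
  have h2 : 1 < v (α ^ 2 / c) := by
    rw [h1, one_lt_inv₀ (v.pos_iff.2 hc0)]
    exact hc
  have h3 : v x = v (α ^ 2 / c) := by
    have := v.map_add_eq_of_lt_right (hx.trans_lt h2)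
    rwa [sub_add_cancel] at this
  exact ⟨h3.trans h1, h3 ▸ h2⟩

theorem map_sub_le_one_of_pole {l : ℕ} (hl : 2 ≤ l) {x c t α : L} (ht : t ≠ 0)
    (hc : c ^ l + c = t ^ (l + 1) / (t ^ l + t)) (hc0 : c ≠ 0)
    (hα : α ^ l = α) (hvα : v α = 1) (hvc : v c < 1) (hvx : v (x - α ^ 2 / c) ≤ 1) :
    v (x ^ (l + 1) / (x ^ l + x) - ((α ^ 2 / t) ^ l + α ^ 2 / t)) ≤ 1 := by
  rw [div_pow_add_div ht hc hα]
  have hx1 := (v.one_lt_of_map_sub_le hvc hc0 hvα hvx).2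
  have hx0 : x ≠ 0 := by
    rintro rfl
    simp at hx1
  obtain ⟨n, rfl⟩ : ∃ n, l = n + 2 := ⟨l - 2, by omega⟩
  have hvc' : v (c ^ (n + 1)) < 1 := by
    rw [map_pow]
    exact pow_lt_one₀ zero_le hvc (by omega)
  have hvx' : 1 < v (x ^ (n + 1)) := by
    rw [map_pow]
    exact one_lt_pow₀ hx1 (by omega)
  have hvx'' : v (1 + x ^ (n + 1)) = v (x ^ (n + 1)) :=
    v.map_add_eq_of_lt_right (by rwa [map_one])
  have h3 : (1 + c ^ (n + 1)) ≠ 0 := by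
    intro h
    have := v.map_one_add_of_lt hvc'
    simp [h] at this
  have h4 : (1 + x ^ (n + 1)) ≠ 0 := by
    intro h
    rw [h, map_zero] at hvx''
    rw [← hvx''] at hvx'
    exact not_lt_zero hvx'
  have h5 : x ^ (n + 2 + 1) / (x ^ (n + 2) + x) - α ^ 2 / (c ^ (n + 2) + c) =
      (x - α ^ 2 / c) - x / (1 + x ^ (n + 1)) + α ^ 2 * c ^ n / (1 + c ^ (n + 1)) := by
    rw [show x ^ (n + 2) + x = x * (1 + x ^ (n + 1)) by ring,
      show c ^ (n + 2) + c = c * (1 + c ^ (n + 1)) by ring]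
    field_simp
    ring
  rw [h5]
  refine v.map_add_le (v.map_sub_le hvx ?_) ?_
  · rw [map_div₀, hvx'', map_pow, pow_succ, div_le_one₀ (mul_pos (pow_pos (zero_lt_one.trans hx1) _)
      (zero_lt_one.trans hx1))]
    exact le_mul_of_one_le_left' (one_le_pow₀ hx1.le)
  · rw [map_div₀, v.map_one_add_of_lt hvc', div_one, map_mul, map_pow, hvα, one_pow, one_mul,
      map_pow]
    exact pow_le_one' hvc.le _

end Valuation

/-- The possible behaviours, at a finite place `v`, of the `i`-th stage of the tower. -/
def IsFinState (F : Type*) {L Γ₀ : Type*} [Field F] [Field L] [Algebra F L] [Algebra F[X] L]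
    [Algebra (RatFunc F) L] [LinearOrderedCommGroupWithZero Γ₀] (l : ℕ) (v : Valuation L Γ₀)
    (x : ℕ → L) (i : ℕ) : Prop :=
  (IsDualBound F[X] (RatFunc F) v (1 : L) ∧
    ((v (x i ^ l + x i) = 1) ∨ (∀ j ≤ i, v (x j) < 1) ∨
      ((∀ j < i, v (x j) < 1) ∧ ∃ α : F, α ≠ 0 ∧ α ^ l + α = 0 ∧
        v (x i - algebraMap F L α) < 1) ∨
      ∃ j ≤ i, (∀ k ≤ j, v (x k) < 1) ∧ ∃ α : F, α ≠ 0 ∧ α ^ l + α = 0 ∧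
        v (x i - algebraMap F L α ^ 2 / x j) ≤ 1)) ∨
  (1 < v (x i) ∧ IsDualBound F[X] (RatFunc F) v ((x 0 ^ l + x 0) ^ 2 * x i ^ 2))

/-- The relations between consecutive generators of the tower. -/
structure IsTowerSeq {L : Type*} [Field L] (l : ℕ) (x : ℕ → L) (i : ℕ) : Prop where
  ne_zero : ∀ j ≤ i, x j ≠ 0
  add_ne_zero : ∀ j ≤ i, x j ^ l + x j ≠ 0
  eq : ∀ j < i, x (j + 1) ^ l + x (j + 1) = x j ^ (l + 1) / (x j ^ l + x j)

section

variable {F L L' Γ₀ : Type*} [Field F] [Field L] [Field L'] [Algebra F L] [Algebra F L']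
  [Algebra F[X] L] [Algebra F[X] L'] [Algebra (RatFunc F) L] [Algebra (RatFunc F) L']
  [IsScalarTower F[X] (RatFunc F) L] [IsScalarTower F[X] (RatFunc F) L']
  [Algebra L L'] [IsScalarTower F L L'] [IsScalarTower F[X] L L'] [IsScalarTower (RatFunc F) L L']
  [LinearOrderedCommGroupWithZero Γ₀]

theorem IsFinState.isDualBound {l : ℕ} {v : Valuation L Γ₀} {x : ℕ → L} {i : ℕ}
    (h : IsFinState F l v x i) (hx : v (x 0) ≤ 1) :
    IsDualBound F[X] (RatFunc F) v ((x 0 ^ l + x 0) ^ 2) := by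
  rcases h with ⟨h, -⟩ | ⟨h1, h2⟩
  · refine h.of_le ?_
    rw [map_one, map_pow]
    exact pow_le_one' (v.map_pow_add_self_le hx) 2
  · refine h2.of_le ?_
    rw [map_mul, map_pow v (x i)]
    exact le_mul_of_one_le_right' (one_le_pow₀ h1.le)

theorem IsFinState.base {l : ℕ} (hl : 2 ≤ l) (hF : (X ^ l + X : F[X]).Splits)
    {v : Valuation (RatFunc F) Γ₀} (hv : ∀ a : F[X], v (algebraMap F[X] (RatFunc F) a) ≤ 1)
    {x : ℕ → RatFunc F} (hx : x 0 = RatFunc.X) : IsFinState F l v x 0 := by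
  refine Or.inl ⟨fun f hf => ?_, ?_⟩
  · obtain ⟨a, ha⟩ := hf 1 isIntegral_one
    rw [mul_one, Algebra.trace_self_apply] at ha
    rw [one_mul, ← ha]
    exact hv a
  have hx1 : v (x 0) ≤ 1 := by
    rw [hx, ← RatFunc.algebraMap_X]
    exact hv X
  rcases (v.map_pow_add_self_le (l := l) hx1).eq_or_lt with h | h
  · exact Or.inl h
  obtain ⟨α, hα, hα'⟩ := v.exists_map_sub_lt_one hl hF h
  by_cases h0 : α = 0
  · refine Or.inr (Or.inl fun j hj => ?_)
    rw [Nat.le_zero.1 hj]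
    simpa [h0] using hα'
  · exact Or.inr (Or.inr (Or.inl ⟨fun j hj => absurd hj (Nat.not_lt_zero j), α, h0, hα, hα'⟩))

variable [FiniteDimensional (RatFunc F) L] [Algebra.IsSeparable (RatFunc F) L]

theorem IsStep.isDualBound_sq [CharP L 2] {l : ℕ} {z : L} {y : L'} (H : IsStep l z y)
    {v : Valuation L' Γ₀} (hv : ∀ a : F[X], v (algebraMap F[X] L' a) ≤ 1)
    (hz : 1 < v (algebraMap L L' z)) {c h : L}
    (hc : IsDualBound F[X] (RatFunc F) (v.comap (algebraMap L L')) c)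
    (hh : v (algebraMap L L' (h * z)) ^ 2 ≤ v (algebraMap L L' c)) :
    1 < v y ∧ IsDualBound F[X] (RatFunc F) v (algebraMap L L' h ^ 2 * y ^ 2) := by
  have hl := H.two_le
  have hzy : v (y ^ l + y) = v (algebraMap L L' z) := by rw [H.eq]
  have hy : 1 < v y := v.one_lt_of_map_pow_add_self (by rwa [hzy])
  refine ⟨hy, (H.isDualBound_of_one_lt hv hz hc).of_le ?_⟩
  rw [v.map_pow_add_self_of_one_lt hl hy] at hzy
  have hy0 : v y ≠ 0 := (zero_lt_one.trans hy).ne'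
  have hz0 : v (algebraMap L L' z) ≠ 0 := (zero_lt_one.trans hz).ne'
  obtain ⟨n, rfl⟩ : ∃ n, l = n + 2 := ⟨l - 2, by omega⟩
  have e1 : v (algebraMap L L' h ^ 2 * y ^ 2) =
      v (algebraMap L L' (h * z)) ^ 2 * (v y ^ 2 / v (algebraMap L L' z) ^ 2) := by
    simp only [map_mul, map_pow]
    field_simp
  have e2 : v (algebraMap L L' (c * z⁻¹) * y⁻¹ ^ (n + 2 - 2)) =
      v (algebraMap L L' c) * (v y ^ 2 / v (algebraMap L L' z) ^ 2) := by
    simp only [map_mul, map_pow, map_inv₀, Nat.add_sub_cancel]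
    rw [← hzy, inv_pow]
    field_simp
    rw [mul_assoc, ← pow_add]
  rw [e1, e2]
  exact mul_le_mul_left hh _

theorem IsFinState.step {m : ℕ} [CharP L 2] (hF : (X ^ 2 ^ m + X : F[X]).Splits)
    {v : Valuation L' Γ₀} (hv : ∀ a : F[X], v (algebraMap F[X] L' a) ≤ 1)
    (hvF : ∀ a : F, v (algebraMap F L' a) ≤ 1) {x : ℕ → L} {i : ℕ}
    (hx : IsTowerSeq (2 ^ m) x i) {x' : ℕ → L'} (hx' : ∀ j ≤ i, x' j = algebraMap L L' (x j))
    (H : IsStep (2 ^ m) (x i ^ (2 ^ m + 1) / (x i ^ 2 ^ m + x i)) (x' (i + 1)))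
    (h : IsFinState F (2 ^ m) (v.comap (algebraMap L L')) x i) :
    IsFinState F (2 ^ m) v x' (i + 1) := by
  have hl := H.two_le
  have : CharP L' 2 := charP_of_injective_algebraMap (algebraMap L L').injective 2
  set w := v.comap (algebraMap L L') with hw
  have hw' : ∀ a, v (algebraMap L L' a) = w a := fun _ => rfl
  have hwF : ∀ a : F, w (algebraMap F L a) ≤ 1 := fun a => by
    rw [← hw', ← IsScalarTower.algebraMap_apply]
    exact hvF a
  have hFα : ∀ α : F, α ^ 2 ^ m + α = 0 → algebraMap F L α ^ 2 ^ m = algebraMap F L α := by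
    intro α hα
    rw [← map_pow, eq_neg_of_add_eq_zero_left hα, map_neg, CharTwo.neg_eq]
  have hlt : ∀ j ≤ i, w (x j) < 1 → v (x' j) < 1 := fun j hj h => by rwa [hx' j hj]
  have hpole : ∀ j ≤ i, (∀ k ≤ j, w (x k) < 1) → ∀ α : F, α ≠ 0 → α ^ 2 ^ m + α = 0 →
      IsDualBound F[X] (RatFunc F) w (1 : L) →
      w (x i ^ (2 ^ m + 1) / (x i ^ 2 ^ m + x i) - ((algebraMap F L α ^ 2 / x j) ^ 2 ^ m +
        algebraMap F L α ^ 2 / x j)) ≤ 1 → IsFinState F (2 ^ m) v x' (i + 1) := by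
    intro j hj hjlt α hα0 hα hd hz
    have H' := H.shift (algebraMap F L α ^ 2 / x j)
    refine Or.inl ⟨by simpa using H'.isDualBound hv hz hd, Or.inr (Or.inr (Or.inr ⟨j, by omega,
      fun k hk => hlt k (by omega) (hjlt k hk), α, hα0, hα, ?_⟩))⟩
    have h1 : v (x' (i + 1) - algebraMap L L' (algebraMap F L α ^ 2 / x j)) ≤ 1 := by
      refine v.le_one_of_map_pow_add_self hl ?_
      rw [H'.eq]
      exact hz
    rw [map_div₀, map_pow, ← IsScalarTower.algebraMap_apply] at h1
    rwa [hx' j hj]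
  have hram : ∀ c : L, 1 < w (x i ^ (2 ^ m + 1) / (x i ^ 2 ^ m + x i)) →
      IsDualBound F[X] (RatFunc F) w c →
      w ((x 0 ^ 2 ^ m + x 0) * (x i ^ (2 ^ m + 1) / (x i ^ 2 ^ m + x i))) ^ 2 ≤ w c →
      IsFinState F (2 ^ m) v x' (i + 1) := by
    intro c hz hd hh
    have h1 := H.isDualBound_sq hv hz hd hh
    refine Or.inr ⟨h1.1, ?_⟩
    rw [hx' 0 (Nat.zero_le _)]
    simpa using h1.2
  rcases h with ⟨hd, h | h | ⟨hlt', α, hα0, hα, hxα⟩ | ⟨j, hj, hjlt, α, hα0, hα, hxα⟩⟩ | ⟨hxi, hd⟩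
  · have hxi := w.eq_one_of_map_pow_add_self hl h
    have hz : w (x i ^ (2 ^ m + 1) / (x i ^ 2 ^ m + x i)) = 1 := by
      rw [map_div₀, map_pow, hxi, h, one_pow, div_one]
    refine Or.inl ⟨by simpa using H.isDualBound hv hz.le hd, Or.inl ?_⟩
    rw [H.eq]
    exact hz
  · have hxi := h i le_rfl
    have hxi0 := hx.ne_zero i le_rfl
    have hz : w (x i ^ (2 ^ m + 1) / (x i ^ 2 ^ m + x i)) < 1 := by
      obtain ⟨n, hn⟩ : ∃ n, 2 ^ m = n + 2 := ⟨2 ^ m - 2, by omega⟩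
      rw [hn]
      have h1 : x i ^ (n + 2 + 1) / (x i ^ (n + 2) + x i) =
          x i ^ (n + 2) / (1 + x i ^ (n + 1)) := by
        rw [show x i ^ (n + 2) + x i = x i * (1 + x i ^ (n + 1)) by ring]
        rw [pow_succ, mul_comm, mul_div_mul_left _ _ hxi0]
      rw [h1, map_div₀, w.map_one_add_of_lt, div_one, map_pow]
      · exact pow_lt_one₀ zero_le hxi (by omega)
      · rw [map_pow]
        exact pow_lt_one₀ zero_le hxi (by omega)
    have hy : v (x' (i + 1) ^ 2 ^ m + x' (i + 1)) < 1 := by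
      rw [H.eq]
      exact hz
    refine Or.inl ⟨by simpa using H.isDualBound hv hz.le hd, Or.inr ?_⟩
    obtain ⟨α, hα, hα'⟩ := v.exists_map_sub_lt_one hl hF hy
    by_cases h0 : α = 0
    · refine Or.inl fun j hj => ?_
      rcases Nat.le_succ_iff.1 hj with hj | rfl
      · exact hlt j hj (h j hj)
      · simpa [h0] using hα'
    · exact Or.inr (Or.inl ⟨fun j hj => hlt j (by omega) (h j (by omega)), α, h0, hα, hα'⟩)
  · rcases i with _ | i
    · have h1 := w.map_algebraMap_eq_one hwF hα0
      have h2 : w (x 0) = 1 := by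
        have := w.map_add_eq_of_lt_right (x := x 0 - algebraMap F L α) (y := algebraMap F L α)
          (by rwa [h1])
        rwa [sub_add_cancel, h1] at this
      have h3 : w (x 0 ^ 2 ^ m + x 0) < 1 := by
        have h4 := w.map_pow_add_self_lt hl hxα
        rw [sub_pow_char_pow, hFα α hα] at h4
        convert h4 using 2
        linear_combination CharTwo.add_self_eq_zero (algebraMap F L α)
      refine hram 1 ?_ hd ?_
      · rw [map_div₀, map_pow, h2, one_pow, one_div, one_lt_inv₀]
        · exact h3
        · exact w.pos_iff.2 (hx.add_ne_zero 0 le_rfl)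
      · rw [mul_div_cancel₀ _ (hx.add_ne_zero 0 le_rfl), map_pow, h2]
        simp
    · exact hpole i (Nat.le_succ i) (fun k hk => hlt' k (by omega)) α hα0 hα hd
        (w.map_sub_le_one_of_unit hl (hx.ne_zero i (Nat.le_succ i)) (hx.eq i (Nat.lt_succ_self i))
          (hx.add_ne_zero _ le_rfl) (hFα α hα) (hwF α) hxα)
  · have h1 := w.map_algebraMap_eq_one hwF hα0
    rcases j with _ | j
    · have h2 := w.one_lt_of_map_sub_le (hjlt 0 le_rfl) (hx.ne_zero 0 (Nat.zero_le _)) h1 hxα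
      refine hram 1 ?_ hd ?_
      · rw [w.map_div_of_one_lt hl h2.2]
        exact h2.2
      · rw [map_mul, w.map_div_of_one_lt hl h2.2, h2.1, map_one]
        refine pow_le_one' ?_ 2
        have h3 : w (x 0 ^ 2 ^ m + x 0) ≤ w (x 0) := by
          refine w.map_add_le ?_ le_rfl
          rw [map_pow]
          exact pow_le_of_le_one zero_le (hjlt 0 le_rfl).le (by omega)
        refine (mul_le_mul_left h3 _).trans ?_
        rw [mul_inv_cancel₀ (w.ne_zero_iff.2 (hx.ne_zero 0 (Nat.zero_le _)))]
    · exact hpole j (by omega) (fun k hk => hjlt k (by omega)) α hα0 hα hd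
        (w.map_sub_le_one_of_pole hl (hx.ne_zero j (by omega)) (hx.eq j (by omega))
          (hx.ne_zero _ hj) (hFα α hα) h1 (hjlt _ le_rfl) hxα)
  · refine hram _ ?_ hd ?_
    · rwa [w.map_div_of_one_lt hl hxi]
    · rw [map_mul, w.map_div_of_one_lt hl hxi, map_mul, map_pow, map_pow, mul_pow]

end

section

variable {F : Type*} [Field F] [Fintype F]

open Classical in
theorem eq_nodal_of_dvd_X_pow_card_sub_X {f : F[X]} (hm : f.Monic)
    (hf : f ∣ X ^ Fintype.card F - X) :
    Lagrange.nodal {a | f.eval a = 0} id = f ∧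
      Finset.card {a | f.eval a = 0} = f.natDegree := by
  have h0 := FiniteField.X_pow_card_sub_X_ne_zero F (Fintype.one_lt_card (α := F))
  have hs : (X ^ Fintype.card F - X : F[X]).Splits := by
    rw [splits_iff_card_roots, FiniteField.roots_X_pow_card_sub_X,
      FiniteField.X_pow_card_sub_X_natDegree_eq F Fintype.one_lt_card]
    rfl
  have hsf := hs.of_dvd h0 hf
  have hr : f.roots = Finset.val {a | f.eval a = 0} := by
    refine (Multiset.Nodup.ext ?_ (Finset.nodup _)).2 fun a => ?_
    · refine Multiset.nodup_of_le (roots.le_of_dvd h0 hf) ?_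
      rw [FiniteField.roots_X_pow_card_sub_X]
      exact Finset.nodup _
    · simp [mem_roots hm.ne_zero]
  constructor
  · conv_rhs => rw [hsf.eq_prod_roots_of_monic hm, hr]
    rfl
  · rw [hsf.natDegree_eq_card_roots, hr]
    rfl

open Classical in
theorem sum_pow_eq_of_pow_add_self {l : ℕ} (hl : 2 ≤ l) (hl0 : (l : F) = 0) {s : F}
    (hs : (X ^ l + X - C s : F[X]) ∣ X ^ Fintype.card F - X) :
    Finset.card {c : F | c ^ l + c = s} = l ∧ ∀ j < l,
      ∑ c : F with c ^ l + c = s, c ^ j = if j = l - 1 then 1 else 0 := by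
  obtain ⟨h1, h2⟩ := eq_nodal_of_dvd_X_pow_card_sub_X (IsStep.poly_monic hl s) hs
  rw [IsStep.poly_natDegree hl] at h2
  simp only [eval_sub, eval_add, eval_pow, eval_X, eval_C, sub_eq_zero] at h1 h2
  refine ⟨h2, fun j hj => ?_⟩
  have h3 := Lagrange.coeff_eq_sum (s := ({c : F | c ^ l + c = s} : Finset F)) (v := id)
    Function.injective_id.injOn (P := X ^ j) (by rw [degree_X_pow, h2]; exact_mod_cast hj)
  rw [h2, coeff_X_pow] at h3
  simp only [@eq_comm _ j] at h3 ⊢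
  rw [h3]
  refine Finset.sum_congr rfl fun c hc => ?_
  have h4 := Lagrange.nodalWeight_eq_eval_derivative_nodal (v := id) hc
  rw [h1, Lagrange.nodalWeight] at h4
  simp only [derivative_sub, derivative_add, derivative_X_pow, hl0, derivative_C, derivative_X,
    map_zero, zero_mul, zero_add, sub_zero, eval_one, inv_one, Finset.prod_inv_distrib,
    inv_eq_one] at h4
  rw [h4, div_one, eval_pow, eval_X, id]

section

variable {m : ℕ} [CharP F 2]

theorem X_pow_add_X_mul_eq (hcard : Fintype.card F = (2 ^ m) ^ 2) :
    (X ^ 2 ^ m + X : F[X]) * ((X ^ 2 ^ m + X) ^ (2 ^ m - 1) + 1) = X ^ Fintype.card F - X := by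
  rw [mul_add, mul_one, ← pow_succ', Nat.sub_add_cancel Nat.one_le_two_pow, add_pow_char_pow,
    ← pow_mul, ← sq, ← hcard, CharTwo.sub_eq_add, add_assoc, CharTwo.add_cancel_left]

theorem X_pow_add_X_sub_C_dvd (hcard : Fintype.card F = (2 ^ m) ^ 2) {s : F}
    (hs : s ^ 2 ^ m = s) :
    (X ^ 2 ^ m + X - C s : F[X]) ∣ X ^ Fintype.card F - X := by
  have h1 : (X ^ Fintype.card F - X : F[X]) =
      (X ^ 2 ^ m + X - C s) ^ 2 ^ m - (X ^ 2 ^ m + X - C s) := by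
    rw [sub_pow_char_pow, add_pow_char_pow, ← C_pow, hs, ← pow_mul, ← sq, ← hcard]
    ring
  rw [h1]
  exact dvd_sub (dvd_pow_self _ (by positivity)) dvd_rfl

theorem splits_X_pow_add_X (hcard : Fintype.card F = (2 ^ m) ^ 2) :
    (X ^ 2 ^ m + X : F[X]).Splits := by
  have h0 := FiniteField.X_pow_card_sub_X_ne_zero F (Fintype.one_lt_card (α := F))
  have hs : (X ^ Fintype.card F - X : F[X]).Splits := by
    rw [splits_iff_card_roots, FiniteField.roots_X_pow_card_sub_X,
      FiniteField.X_pow_card_sub_X_natDegree_eq F Fintype.one_lt_card]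
    rfl
  have h1 := X_pow_add_X_sub_C_dvd hcard (s := 0) (by simp)
  rw [map_zero, sub_zero] at h1
  exact hs.of_dvd h0 h1

end

end

/-- The residue at infinity of a simple pole. -/
theorem residue_inv_X_sub_C {F : Type u} [Field F] {ρ : RatFunc F →ₗ[F] F}
    (hρ : RatFunc.IsResidue ρ) (a : F) :
    ρ (algebraMap F[X] (RatFunc F) (X - C a))⁻¹ = 1 := by
  have h0 : algebraMap F[X] (RatFunc F) (X - C a) ≠ 0 := by
    rw [Ne, FaithfulSMul.algebraMap_eq_zero_iff]
    exact X_sub_C_ne_zero a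
  have hX : (RatFunc.X : RatFunc F) ≠ 0 := RatFunc.X_ne_zero
  have h1 : (algebraMap F[X] (RatFunc F) (X - C a))⁻¹ = RatFunc.X⁻¹ +
      a • (RatFunc.X⁻¹ * (algebraMap F[X] (RatFunc F) (X - C a))⁻¹) := by
    rw [RatFunc.smul_eq_C_mul]
    field_simp
    rw [map_sub, RatFunc.algebraMap_X, RatFunc.algebraMap_C]
    ring
  rw [h1, map_add, map_smul, hρ.inv_X, hρ.deg, smul_zero, add_zero]
  refine Or.inr ?_
  rw [RatFunc.intDegree_mul (inv_ne_zero hX) (inv_ne_zero h0), RatFunc.intDegree_inv,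
    RatFunc.intDegree_inv, RatFunc.intDegree_X, RatFunc.intDegree_polynomial, natDegree_X_sub_C]
  norm_num

open Classical in
/-- The residue theorem for a function with simple poles on the projective line. -/
theorem sum_nodalWeight_mul_eval_eq_residue {F : Type u} [Field F] {ρ : RatFunc F →ₗ[F] F}
    (hρ : RatFunc.IsResidue ρ) (s : Finset F) (q : F[X]) :
    ∑ a ∈ s, Lagrange.nodalWeight s id a * q.eval a =
      ρ (algebraMap F[X] (RatFunc F) q *
        (algebraMap F[X] (RatFunc F) (Lagrange.nodal s id))⁻¹) := by
  have hmon : (Lagrange.nodal s (id : F → F)).Monic := Lagrange.nodal_monic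
  set n := Lagrange.nodal s (id : F → F) with hn
  have hn0 : algebraMap F[X] (RatFunc F) n ≠ 0 := by simpa using hmon.ne_zero
  have h1 : (q %ₘ n) = ∑ a ∈ s,
      C (q.eval a * Lagrange.nodalWeight s id a) * (n / (X - C a)) := by
    rw [Lagrange.eq_interpolate (s := s) (v := id) (f := q %ₘ n) Function.injective_id.injOn
      ((degree_modByMonic_lt _ hmon).trans_eq Lagrange.degree_nodal),
      Lagrange.interpolate_eq_nodalWeight_mul_nodal_div_X_sub_C]
    refine Finset.sum_congr rfl fun a ha => ?_
    have h2 : (q %ₘ n).eval (id a) = q.eval a := by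
      nth_rw 2 [← modByMonic_add_div q n]
      rw [eval_add, eval_mul, hn]
      rw [show eval a (Lagrange.nodal s id) = 0 from Lagrange.eval_nodal_at_node (v := id) ha,
        zero_mul, add_zero, id]
    rw [h2, C_mul, id]
    ring
  have h2 : algebraMap F[X] (RatFunc F) q * (algebraMap F[X] (RatFunc F) n)⁻¹ =
      algebraMap F[X] (RatFunc F) (q /ₘ n) + ∑ a ∈ s, (Lagrange.nodalWeight s id a * q.eval a) •
        (algebraMap F[X] (RatFunc F) (X - C a))⁻¹ := by
    nth_rw 1 [← modByMonic_add_div q n]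
    rw [mul_inv_eq_iff_eq_mul₀ hn0, map_add, map_mul, add_mul, add_comm, mul_comm]
    congr 1
    rw [h1, map_sum, Finset.sum_mul]
    refine Finset.sum_congr rfl fun a ha => ?_
    have h3 : algebraMap F[X] (RatFunc F) (X - C a) ≠ 0 := by
      rw [Ne, FaithfulSMul.algebraMap_eq_zero_iff]
      exact X_sub_C_ne_zero a
    have h4 : n = (X - C a) * (n / (X - C a)) := by
      have h5 := Lagrange.nodal_erase_eq_nodal_div (v := id) ha
      rw [id] at h5
      rw [hn, ← h5]
      exact Lagrange.nodal_eq_mul_nodal_erase ha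
    rw [RatFunc.smul_eq_C_mul, ← RatFunc.algebraMap_C]
    conv_rhs => rw [h4, map_mul (algebraMap F[X] (RatFunc F)) (X - C a)]
    rw [map_mul, mul_assoc, inv_mul_cancel_left₀ h3, mul_comm (q.eval a)]
  rw [h2, map_add, hρ.poly, zero_add, map_sum]
  refine Finset.sum_congr rfl fun a _ => ?_
  rw [map_smul, residue_inv_X_sub_C hρ, smul_eq_mul, mul_one]

/-- The elements of `L` that become integral over `F[X]` after multiplication by a power of `h`. -/
def integralAway (F L : Type*) [Field F] [Field L] [Algebra F L] [Algebra F[X] L]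
    [IsScalarTower F F[X] L] (h : F[X]) : Subalgebra F L where
  carrier := {f | ∃ n : ℕ, IsIntegral F[X] (algebraMap F[X] L h ^ n * f)}
  mul_mem' := by
    rintro a b ⟨n, hn⟩ ⟨k, hk⟩
    refine ⟨n + k, ?_⟩
    rw [pow_add, mul_mul_mul_comm]
    exact hn.mul hk
  add_mem' := by
    rintro a b ⟨n, hn⟩ ⟨k, hk⟩
    refine ⟨n + k, ?_⟩
    have h1 : IsIntegral F[X] (algebraMap F[X] L h) := isIntegral_algebraMap
    have h2 : algebraMap F[X] L h ^ (n + k) * (a + b) = algebraMap F[X] L h ^ k *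
        (algebraMap F[X] L h ^ n * a) +
          algebraMap F[X] L h ^ n * (algebraMap F[X] L h ^ k * b) := by
      ring
    rw [h2]
    exact ((h1.pow k).mul hn).add ((h1.pow n).mul hk)
  algebraMap_mem' c := by
    refine ⟨0, ?_⟩
    rw [pow_zero, one_mul, IsScalarTower.algebraMap_apply F F[X] L]
    exact isIntegral_algebraMap

section

variable {F L L' : Type*} [Field F] [Field L] [Field L'] [Algebra F L] [Algebra F L']
  [Algebra F[X] L] [Algebra F[X] L'] [IsScalarTower F F[X] L] [IsScalarTower F F[X] L']
  [Algebra L L'] [IsScalarTower F L L'] [IsScalarTower F[X] L L'] {h : F[X]}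

theorem IsIntegral.mem_integralAway {f : L} (hf : IsIntegral F[X] f) : f ∈ integralAway F L h :=
  ⟨0, by rwa [pow_zero, one_mul]⟩

theorem algebraMap_mem_integralAway (q : F[X]) : algebraMap F[X] L q ∈ integralAway F L h :=
  isIntegral_algebraMap.mem_integralAway

theorem algebraMap_inv_mem_integralAway : (algebraMap F[X] L h)⁻¹ ∈ integralAway F L h := by
  refine ⟨1, ?_⟩
  rw [pow_one]
  by_cases h0 : algebraMap F[X] L h = 0
  · rw [h0, zero_mul]
    exact isIntegral_zero
  · rw [mul_inv_cancel₀ h0]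
    exact isIntegral_one

theorem algebraMap_mem_integralAway_of_mem {f : L} (hf : f ∈ integralAway F L h) :
    algebraMap L L' f ∈ integralAway F L' h := by
  obtain ⟨n, hn⟩ := hf
  refine ⟨n, ?_⟩
  rw [IsScalarTower.algebraMap_apply F[X] L L', ← map_pow, ← map_mul]
  exact hn.algebraMap

theorem trace_mem_integralAway [FiniteDimensional L L'] {f : L'} (hf : f ∈ integralAway F L' h) :
    Algebra.trace L L' f ∈ integralAway F L h := by
  obtain ⟨n, hn⟩ := hf
  refine ⟨n, ?_⟩
  rw [IsScalarTower.algebraMap_apply F[X] L L', ← map_pow, ← Algebra.smul_def] at hn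
  rw [← smul_eq_mul, ← map_smul]
  exact Algebra.isIntegral_trace hn

theorem mem_integralAway_of_pow_add {l : ℕ} (hl : 2 ≤ l) {y : L}
    (hy : y ^ l + y ∈ integralAway F L h) : y ∈ integralAway F L h := by
  obtain ⟨n, hn⟩ := hy
  refine ⟨n, ?_⟩
  obtain ⟨k, rfl⟩ : ∃ k, l = k + 2 := ⟨l - 2, by omega⟩
  set η := algebraMap F[X] L h with hη
  have h1 : IsIntegral F[X] η := isIntegral_algebraMap
  have h2 : (X ^ (k + 2) + (C (η ^ (n * (k + 1))) * X -
      C (η ^ (n * (k + 1)) * (η ^ n * (y ^ (k + 2) + y)))) : L[X]).Monic := by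
    refine monic_X_pow_add ((degree_sub_le _ _).trans_lt (max_lt ?_ ?_))
    · exact (degree_C_mul_X_le _).trans_lt (by norm_cast)
    · exact degree_C_le.trans_lt (by norm_cast; omega)
  refine isIntegral_of_monic_of_isIntegral_coeff (A := F[X]) h2 (fun i => ?_) ?_
  · rw [coeff_add, coeff_sub, coeff_X_pow, coeff_C_mul, coeff_X, coeff_C]
    refine IsIntegral.add ?_ (IsIntegral.sub ((h1.pow _).mul ?_) ?_) <;> split_ifs
    exacts [isIntegral_one, isIntegral_zero, isIntegral_one, isIntegral_zero,
      (h1.pow _).mul hn, isIntegral_zero]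
  · simp only [map_add, map_sub, map_mul, aeval_X, aeval_C, map_pow, Algebra.algebraMap_self,
      RingHom.id_apply]
    ring

/-- An evaluation extends to a step of the tower, with every admissible value of the generator. -/
theorem IsStep.exists_extend {l : ℕ} {z : L} {y : L'} (H : IsStep l z y) {A : Subalgebra F L}
    {A' : Subalgebra F L'} (hA : ∀ a ∈ A, algebraMap L L' a ∈ A') (hy : y ∈ A') (hz : z ∈ A)
    (hsum : ∀ f ∈ A', ∃ c : ℕ → L, (∀ j, c j ∈ A) ∧
      f = ∑ j ∈ Finset.range l, algebraMap L L' (c j) * y ^ j)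
    (ev : A →ₐ[F] F) {b : F} (hb : b ^ l + b = ev ⟨z, hz⟩) :
    ∃ ev' : A' →ₐ[F] F, (∀ a (ha : a ∈ A), ev' ⟨algebraMap L L' a, hA a ha⟩ = ev ⟨a, ha⟩) ∧
      ev' ⟨y, hy⟩ = b := by
  let i : A →+* A' := ((algebraMap L L').comp A.val.toRingHom).codRestrict A' fun a => hA a a.2
  let φ : A[X] →+* A' := eval₂RingHom i ⟨y, hy⟩
  let ψ : A[X] →+* F := eval₂RingHom ev.toRingHom b
  have hφ : Function.Surjective φ := by
    rintro ⟨f, hf⟩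
    obtain ⟨c, hc, hfc⟩ := hsum f hf
    refine ⟨∑ j ∈ Finset.range l, C ⟨c j, hc j⟩ * X ^ j, ?_⟩
    apply Subtype.ext
    simp only [φ, map_sum, map_mul, map_pow, coe_eval₂RingHom, eval₂_C, eval₂_X]
    rw [hfc]
    simp [i]
  have hval : ∀ P : A[X], (φ P : L') = aeval y (P.map A.val.toRingHom) := by
    intro P
    rw [aeval_def, eval₂_map]
    exact hom_eval₂ P i A'.val.toRingHom ⟨y, hy⟩
  have hker : RingHom.ker φ ≤ RingHom.ker ψ := by
    intro P hP
    rw [RingHom.mem_ker] at hP ⊢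
    set Q : A[X] := X ^ l + X - C ⟨z, hz⟩ with hQ
    have hQm : Q.Monic := by
      have h1 : Q = X ^ l + (X - C ⟨z, hz⟩) := by rw [hQ]; ring
      rw [h1]
      refine monic_X_pow_add ((degree_X_sub_C_le _).trans_lt ?_)
      exact_mod_cast H.two_le
    have hQmap : Q.map A.val.toRingHom = minpoly L y := by
      rw [H.minpoly_eq]
      simp [hQ]
    have hφQ : φ Q = 0 := by
      apply Subtype.ext
      rw [hval, hQmap, minpoly.aeval]
      rfl
    have hψQ : ψ Q = 0 := by
      simp [hQ, ψ, ← hb]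
    have hmod : P %ₘ Q = 0 := by
      have h1 : φ (P %ₘ Q) = 0 := by
        rw [← modByMonic_add_div P Q, map_add, map_mul, hφQ, zero_mul, add_zero] at hP
        exact hP
      have h2 := hval (P %ₘ Q)
      rw [h1] at h2
      have h3 : (P %ₘ Q).map A.val.toRingHom = 0 := by
        by_contra h3
        have h4 := minpoly.degree_le_of_ne_zero L y h3 h2.symm
        rw [← hQmap, hQm.degree_map] at h4
        exact absurd (degree_map_le.trans_lt (degree_modByMonic_lt P hQm)) (not_lt.2 h4)
      exact (Polynomial.map_eq_zero_iff Subtype.val_injective).1 h3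
    rw [← modByMonic_add_div P Q, hmod, map_add, map_zero, map_mul, hψQ, zero_mul, zero_add]
  have hlift : ∀ P, φ.liftOfSurjective hφ ⟨ψ, hker⟩ (φ P) = ψ P :=
    fun P => φ.liftOfRightInverse_comp_apply _ _ ⟨ψ, hker⟩ P
  have hφC : ∀ a (ha : a ∈ A), φ (C ⟨a, ha⟩) = ⟨algebraMap L L' a, hA a ha⟩ := by
    intro a ha
    simp only [φ, coe_eval₂RingHom, eval₂_C]
    rfl
  have hevC : ∀ a (ha : a ∈ A),
      φ.liftOfSurjective hφ ⟨ψ, hker⟩ ⟨algebraMap L L' a, hA a ha⟩ = ev ⟨a, ha⟩ := by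
    intro a ha
    rw [← hφC a ha, hlift]
    simp [ψ]
  refine ⟨{ φ.liftOfSurjective hφ ⟨ψ, hker⟩ with commutes' := fun c => ?_ }, hevC, ?_⟩
  · have h1 := hevC (algebraMap F L c) (A.algebraMap_mem c)
    refine Eq.trans ?_ (h1.trans (ev.commutes c))
    change φ.liftOfSurjective hφ ⟨ψ, hker⟩ _ = _
    congr 1
    exact Subtype.ext (IsScalarTower.algebraMap_apply F L L' c)
  · have h1 : φ X = ⟨y, hy⟩ := by simp [φ]
    change φ.liftOfSurjective hφ ⟨ψ, hker⟩ ⟨y, hy⟩ = b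
    rw [← h1, hlift]
    simp [ψ]

end

/-- A family of distinct rational points of the affine curve with function field `L`, along which
`x` and `x ^ l + x` do not vanish, satisfying a residue formula. -/
structure IsPointSystem {F L ι : Type u} [Field F] [Field L] [Fintype ι] [Algebra F L]
    [Algebra F[X] L] [Algebra (RatFunc F) L] [IsScalarTower F F[X] L] (ρ : RatFunc F →ₗ[F] F)
    (l n : ℕ) (h p : F[X]) (x : L) (ev : ι → integralAway F L h →ₐ[F] F) : Prop where
  injective : Function.Injective ev
  card_eq : Fintype.card ι = n * p.natDegree
  mem : x ∈ integralAway F L h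
  inv_mem : (x ^ l + x)⁻¹ ∈ integralAway F L h
  ne_zero : x ^ l + x ≠ 0
  p_eq_zero : ∀ P hp, ev P ⟨algebraMap F[X] L p, hp⟩ = 0
  sum_eq : ∀ f hf hh, IsIntegral F[X] f → ∑ P, ev P ⟨algebraMap F[X] L h, hh⟩ * ev P ⟨f, hf⟩ =
    ρ (Algebra.trace (RatFunc F) L (f * (algebraMap F[X] L p)⁻¹))

namespace IsPointSystem

section

variable {F L ι : Type u} [Field F] [Field L] [Fintype ι] [Algebra F L]
    [Algebra F[X] L] [Algebra (RatFunc F) L] [IsScalarTower F F[X] L]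
    [IsScalarTower F[X] (RatFunc F) L] {ρ : RatFunc F →ₗ[F] F}
    {l n : ℕ} {h p : F[X]} {x : L} {ev : ι → integralAway F L h →ₐ[F] F}

theorem isEvalSystem (H : IsPointSystem ρ l n h p x ev) (hh : h ≠ 0) (hp : p ≠ 0) :
    IsEvalSystem ρ n h p fun P => (ev P).comp
      (Subalgebra.inclusion (S := (integralClosure F[X] L).restrictScalars F)
        (T := integralAway F L h) fun _ hf => IsIntegral.mem_integralAway hf) := by
  have hh0 : algebraMap F[X] L h ≠ 0 := by
    rw [IsScalarTower.algebraMap_apply F[X] (RatFunc F) L]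
    simpa using hh
  have hev : ∀ P, ev P ⟨algebraMap F[X] L h, algebraMap_mem_integralAway h⟩ ≠ 0 := by
    intro P h0
    have h1 : (⟨algebraMap F[X] L h, algebraMap_mem_integralAway h⟩ : integralAway F L h) *
        ⟨_, algebraMap_inv_mem_integralAway⟩ = 1 := Subtype.ext (mul_inv_cancel₀ hh0)
    have h2 := congrArg (ev P) h1
    rw [map_mul, h0, zero_mul, map_one] at h2
    exact zero_ne_one h2
  refine ⟨fun P Q hPQ => H.injective ?_, hev, fun P => H.p_eq_zero P _, hp, H.card_eq,
    fun f => H.sum_eq f _ _ f.2⟩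
  have h_int : ∀ f (hf : IsIntegral F[X] f),
      ev P ⟨f, hf.mem_integralAway⟩ = ev Q ⟨f, hf.mem_integralAway⟩ := fun f hf =>
    DFunLike.congr_fun hPQ (⟨f, hf⟩ : integralClosure F[X] L)
  ext ⟨f, hf⟩
  obtain ⟨k, hk⟩ := hf
  have h1 := h_int _ hk
  have h2 : (⟨_, hk.mem_integralAway⟩ : integralAway F L h) =
      ⟨algebraMap F[X] L h, algebraMap_mem_integralAway h⟩ ^ k * ⟨f, ⟨k, hk⟩⟩ := rfl
  rw [h2, map_mul, map_mul, map_pow, map_pow, h_int _ isIntegral_algebraMap] at h1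
  exact mul_left_cancel₀ (pow_ne_zero _ (hev Q)) h1

end

section

variable {F L L' : Type u} [Field F] [Fintype F] [Field L] [Field L'] [Algebra F L] [Algebra F L']
  [Algebra F[X] L] [Algebra F[X] L'] [Algebra (RatFunc F) L] [Algebra (RatFunc F) L']
  [IsScalarTower F F[X] L] [IsScalarTower F F[X] L']
  [IsScalarTower F[X] (RatFunc F) L] [IsScalarTower F[X] (RatFunc F) L']
  [Algebra L L'] [IsScalarTower F L L'] [IsScalarTower F[X] L L'] [IsScalarTower (RatFunc F) L L']

/-- The residue formula and the count of points pass to the next stage of the tower. -/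
theorem step {m n : ℕ} [CharP F 2] (hcard : Fintype.card F = (2 ^ m) ^ 2) {ρ : RatFunc F →ₗ[F] F}
    {h p : F[X]} {x : L} {y : L'}
    (Hs : IsStep (2 ^ m) (x ^ (2 ^ m + 1) / (x ^ 2 ^ m + x)) y)
    [FiniteDimensional (RatFunc F) L] {ι : Type u} [Fintype ι]
    {ev : ι → integralAway F L h →ₐ[F] F} (H : IsPointSystem ρ (2 ^ m) n h p x ev) :
    ∃ (ι' : Type u) (_ : Fintype ι') (ev' : ι' → integralAway F L' h →ₐ[F] F),
      IsPointSystem ρ (2 ^ m) (2 ^ m * n) h p y ev' := by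
  classical
  have hl := Hs.two_le
  have := Hs.finiteDimensional
  set z := x ^ (2 ^ m + 1) / (x ^ 2 ^ m + x) with hzdef
  have hx0 : x ≠ 0 := by
    rintro rfl
    exact H.ne_zero (by simp)
  have hz : z ∈ integralAway F L h := by
    rw [hzdef, div_eq_mul_inv]
    exact mul_mem (pow_mem H.mem _) H.inv_mem
  have hz' : z⁻¹ ∈ integralAway F L h := by
    have hx' : x⁻¹ ∈ integralAway F L h := by
      have h1 : x⁻¹ = (x ^ (2 ^ m - 1) + 1) * (x ^ 2 ^ m + x)⁻¹ := by
        rw [eq_mul_inv_iff_mul_eq₀ H.ne_zero, inv_mul_eq_iff_eq_mul₀ hx0, mul_add,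
          ← pow_succ', Nat.sub_add_cancel (by omega), mul_one]
      rw [h1]
      exact mul_mem (add_mem (pow_mem H.mem _) (one_mem _)) H.inv_mem
    rw [hzdef, inv_div, div_eq_mul_inv, ← inv_pow]
    exact mul_mem (add_mem (pow_mem H.mem _) H.mem) (pow_mem hx' _)
  have hz0 : z ≠ 0 := div_ne_zero (pow_ne_zero _ hx0) H.ne_zero
  have hA : ∀ a ∈ integralAway F L h, algebraMap L L' a ∈ integralAway F L' h :=
    fun a ha => algebraMap_mem_integralAway_of_mem ha
  have hy : y ∈ integralAway F L' h := by
    refine mem_integralAway_of_pow_add hl ?_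
    rw [Hs.eq]
    exact hA _ hz
  have hsum : ∀ f ∈ integralAway F L' h, ∃ c : ℕ → L, (∀ j, c j ∈ integralAway F L h) ∧
      f = ∑ j ∈ Finset.range (2 ^ m), algebraMap L L' (c j) * y ^ j := by
    intro f hf
    refine ⟨_, fun j => ?_, Hs.eq_sum_trace f⟩
    refine trace_mem_integralAway (mul_mem hf ?_)
    rw [Hs.minpolyDiv_eq, coeff_add, finsetSum_coeff, coeff_one]
    refine add_mem (sum_mem fun i _ => ?_) ?_
    · rw [coeff_mul_C, coeff_X_pow]
      exact mul_mem (by split_ifs; exacts [one_mem _, zero_mem _]) (pow_mem hy _)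
    · split_ifs
      exacts [one_mem _, zero_mem _]
  have hs : ∀ P, ev P ⟨z, hz⟩ ^ 2 ^ m = ev P ⟨z, hz⟩ := by
    intro P
    set a := ev P ⟨x, H.mem⟩ with ha
    have h1 : (a ^ 2 ^ m + a) * ev P ⟨z, hz⟩ = a ^ (2 ^ m + 1) := by
      rw [ha, ← map_pow, ← map_pow, ← map_add, ← map_mul]
      congr 1
      exact Subtype.ext (mul_div_cancel₀ _ H.ne_zero)
    have h2 : (a ^ 2 ^ m + a) ≠ 0 := by
      intro h0
      have h3 : (⟨x, H.mem⟩ ^ 2 ^ m + ⟨x, H.mem⟩ : integralAway F L h) * ⟨_, H.inv_mem⟩ = 1 :=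
        Subtype.ext (mul_inv_cancel₀ H.ne_zero)
      have h4 := congrArg (ev P) h3
      rw [map_mul, map_add, map_pow, ← ha, h0, zero_mul, map_one] at h4
      exact zero_ne_one h4
    have h3 : (a ^ 2 ^ m) ^ 2 ^ m = a := by
      rw [← pow_mul, ← sq, ← hcard, FiniteField.pow_card]
    refine mul_left_cancel₀ h2 ?_
    rw [h1]
    have h4 := congrArg (· ^ 2 ^ m) h1
    simp only [mul_pow, add_pow_char_pow, h3, pow_succ] at h4
    rw [add_comm, h4, pow_succ, mul_comm]
  have hroots := fun P => sum_pow_eq_of_pow_add_self hl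
    (by rw [Nat.cast_pow, Nat.cast_ofNat, CharTwo.two_eq_zero, zero_pow]; rintro rfl; omega)
    (X_pow_add_X_sub_C_dvd hcard (hs P))
  let S : ι → Finset F := fun P => {b : F | b ^ 2 ^ m + b = ev P ⟨z, hz⟩}
  have hS : ∀ P b, b ∈ S P → b ^ 2 ^ m + b = ev P ⟨z, hz⟩ := fun P b hb => by
    simpa [S] using hb
  choose E hE1 hE2 using fun P (b : S P) => Hs.exists_extend hA hy hz hsum (ev P) (hS P b b.2)
  refine ⟨Σ P : ι, S P, inferInstance, fun Q => E Q.1 Q.2, ?_, ?_, hy, ?_, ?_, ?_, ?_⟩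
  · rintro ⟨P, b⟩ ⟨P', b'⟩ heq
    have heq : E P b = E P' b' := heq
    obtain rfl : P = P' := by
      refine H.injective (AlgHom.ext fun a => ?_)
      rw [← hE1 P b a a.2, heq, hE1 P' b' a a.2]
    obtain rfl : b = b' := by
      apply Subtype.ext
      rw [← hE2 P b, heq, hE2 P b']
    rfl
  · rw [Fintype.card_sigma]
    simp_rw [Fintype.card_coe, S, (hroots _).1]
    rw [Finset.sum_const, Finset.card_univ, H.card_eq, smul_eq_mul]
    ring
  · rw [Hs.eq, ← map_inv₀]
    exact hA _ hz'
  · rw [Hs.eq]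
    simpa using hz0
  · rintro ⟨P, b⟩ hp
    rw [← H.p_eq_zero P (algebraMap_mem_integralAway p), ← hE1 P b]
    exact congrArg (E P b) (Subtype.ext (IsScalarTower.algebraMap_apply F[X] L L' p))
  · intro f hf hh h_int
    obtain ⟨c, hc, hfc⟩ := hsum f hf
    have htr : Algebra.trace L L' f = c (2 ^ m - 1) := by rw [hfc, Hs.trace_sum]
    have hval : ∀ P (b : S P), E P b ⟨f, hf⟩ =
        ∑ j ∈ Finset.range (2 ^ m), ev P ⟨c j, hc j⟩ * (b : F) ^ j := by
      intro P b
      have h1 : (⟨f, hf⟩ : integralAway F L' h) =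
          ∑ j ∈ Finset.range (2 ^ m), ⟨algebraMap L L' (c j), hA _ (hc j)⟩ * ⟨y, hy⟩ ^ j := by
        apply Subtype.ext
        refine hfc.trans ?_
        simp
      rw [h1, map_sum]
      refine Finset.sum_congr rfl fun j _ => ?_
      rw [map_mul, map_pow, hE1 P b, hE2 P b]
    have hinner : ∀ P, ∑ b : S P, E P b ⟨f, hf⟩ = ev P ⟨c (2 ^ m - 1), hc _⟩ := by
      intro P
      rw [Finset.sum_congr rfl fun b _ => hval P b,
        Finset.sum_coe_sort (S P) fun b => ∑ j ∈ Finset.range (2 ^ m), ev P ⟨c j, hc j⟩ * b ^ j,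
        Finset.sum_comm]
      simp_rw [← Finset.mul_sum]
      rw [Finset.sum_eq_single (2 ^ m - 1)]
      · rw [(hroots P).2 _ (by omega), if_pos rfl, mul_one]
      · intro j hj hne
        rw [(hroots P).2 _ (Finset.mem_range.1 hj), if_neg hne, mul_zero]
      · intro hn
        exact absurd (Finset.mem_range.2 (by omega)) hn
    have hh' : ∀ P (b : S P), E P b ⟨algebraMap F[X] L' h, hh⟩ =
        ev P ⟨algebraMap F[X] L h, algebraMap_mem_integralAway h⟩ := by
      intro P b
      rw [← hE1 P b]
      exact congrArg (E P b) (Subtype.ext (IsScalarTower.algebraMap_apply F[X] L L' h))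
    have h_int' : IsIntegral F[X] (c (2 ^ m - 1)) := by
      rw [← htr]
      exact Algebra.isIntegral_trace h_int
    have h1 := H.sum_eq _ (hc (2 ^ m - 1)) (algebraMap_mem_integralAway h) h_int'
    rw [← Algebra.trace_trace (S := L), IsScalarTower.algebraMap_apply F[X] L L' p, ← map_inv₀,
      mul_comm, ← Algebra.smul_def, map_smul, htr, smul_eq_mul, mul_comm, ← h1, Fintype.sum_sigma]
    refine Finset.sum_congr rfl fun P _ => ?_
    rw [← hinner P, Finset.mul_sum]
    refine Finset.sum_congr rfl fun b _ => ?_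
    rw [hh' P b]

end

end IsPointSystem

/-- Evaluation at a point of the affine line at which `h` does not vanish. -/
noncomputable def evalAway {F : Type*} [Field F] (h : F[X]) (a : F) (ha : h.eval a ≠ 0) :
    integralAway F (RatFunc F) h →ₐ[F] F :=
  have key : ∀ φ : integralAway F (RatFunc F) h, eval₂ (RingHom.id F) a φ.1.denom ≠ 0 := by
    rintro ⟨φ, n, hn⟩ h0
    obtain ⟨q, hq⟩ := IsIntegrallyClosed.isIntegral_iff.1 hn
    have h1 : φ = algebraMap F[X] (RatFunc F) q / algebraMap F[X] (RatFunc F) (h ^ n) := by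
      rw [hq, map_pow, mul_div_cancel_left₀]
      refine pow_ne_zero _ ?_
      rw [Ne, FaithfulSMul.algebraMap_eq_zero_iff]
      rintro rfl
      simp at ha
    have h2 : φ.denom ∣ h ^ n := by
      rw [h1]
      exact RatFunc.denom_div_dvd _ _
    obtain ⟨r, hr⟩ := h2
    have h3 := congrArg (eval a) hr
    rw [eval_mul, eval_pow, show eval a φ.denom = 0 from h0, zero_mul] at h3
    exact pow_ne_zero _ ha h3
  { toFun := fun φ => RatFunc.eval (RingHom.id F) a φ
    map_one' := RatFunc.eval_one _ _
    map_zero' := RatFunc.eval_zero _ _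
    map_mul' := fun φ ψ => RatFunc.eval_mul _ _ (key φ) (key ψ)
    map_add' := fun φ ψ => RatFunc.eval_add _ _ (key φ) (key ψ)
    commutes' := fun c => RatFunc.eval_C _ _ }

theorem evalAway_algebraMap {F : Type*} [Field F] {h : F[X]} {a : F} (ha : h.eval a ≠ 0) (q : F[X])
    (hq) : evalAway h a ha ⟨algebraMap F[X] (RatFunc F) q, hq⟩ = q.eval a :=
  RatFunc.eval_algebraMap _ _ q

theorem X_pow_add_X_pow_sub_one_add_one_monic {F : Type*} [Field F] {l : ℕ} (hl : 2 ≤ l) :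
    ((X ^ l + X : F[X]) ^ (l - 1) + 1).Monic ∧
      ((X ^ l + X : F[X]) ^ (l - 1) + 1).natDegree = l ^ 2 - l := by
  have hmon := IsStep.poly_monic hl (0 : F)
  have hdeg := IsStep.poly_natDegree hl (0 : F)
  rw [map_zero, sub_zero] at hmon hdeg
  have h1 : ((X ^ l + X : F[X]) ^ (l - 1)).natDegree = l ^ 2 - l := by
    rw [hmon.natDegree_pow, hdeg, Nat.sub_mul, sq, one_mul]
  have h2 : (1 : F[X]).degree < ((X ^ l + X : F[X]) ^ (l - 1)).degree := by
    rw [degree_one, degree_eq_natDegree (hmon.pow _).ne_zero, hmon.natDegree_pow, hdeg]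
    exact_mod_cast Nat.mul_pos (by omega) (by omega)
  exact ⟨(hmon.pow _).add_of_left h2, by rw [natDegree_add_eq_left_of_degree_lt h2, h1]⟩

/-- The rational points of the affine line away from the zeros of `X ^ l + X`. -/
theorem exists_isPointSystem_base {F : Type u} [Field F] [Fintype F] {m : ℕ} [CharP F 2]
    (hm : m ≠ 0) (hcard : Fintype.card F = (2 ^ m) ^ 2) {ρ : RatFunc F →ₗ[F] F}
    (hρ : RatFunc.IsResidue ρ) :
    ∃ (ι : Type u) (_ : Fintype ι)
      (ev : ι → integralAway F (RatFunc F) (X ^ 2 ^ m + X : F[X]) →ₐ[F] F),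
      IsPointSystem ρ (2 ^ m) 1 (X ^ 2 ^ m + X) ((X ^ 2 ^ m + X) ^ (2 ^ m - 1) + 1)
        RatFunc.X ev := by
  classical
  have hl : 2 ≤ 2 ^ m := Nat.le_self_pow hm 2
  have hmul := X_pow_add_X_mul_eq hcard
  set h : F[X] := X ^ 2 ^ m + X with hh
  set p : F[X] := h ^ (2 ^ m - 1) + 1 with hp
  have hmon : h.Monic := by
    have := IsStep.poly_monic hl (0 : F)
    rwa [map_zero, sub_zero] at this
  have hpmon : p.Monic := (X_pow_add_X_pow_sub_one_add_one_monic hl).1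
  obtain ⟨hn, hc⟩ := eq_nodal_of_dvd_X_pow_card_sub_X hpmon ⟨h, by rw [← hmul, mul_comm]⟩
  have hiff : ∀ a, p.eval a = 0 ↔ h.eval a ≠ 0 := by
    intro a
    have h1 := congrArg (eval a) hmul
    rw [eval_mul, eval_sub, eval_pow, eval_X, FiniteField.pow_card, sub_self, mul_eq_zero] at h1
    refine ⟨fun h2 h3 => ?_, fun h2 => h1.resolve_left h2⟩
    rw [hp, eval_add, eval_pow, h3, zero_pow (by omega), eval_one, zero_add] at h2
    exact one_ne_zero h2
  have hweight : ∀ a : F, p.eval a = 0 →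
      Lagrange.nodalWeight ({a | p.eval a = 0} : Finset F) id a = h.eval a := by
    intro a ha
    rw [Lagrange.nodalWeight_eq_eval_derivative_nodal (by simpa using ha), hn]
    have h1 := congrArg (fun q => eval a (derivative q)) hmul
    simp only [derivative_mul, eval_add, eval_mul, ha, mul_zero, zero_add, derivative_sub,
      derivative_X, derivative_X_pow, FiniteField.cast_card_eq_zero, map_zero, zero_mul,
      eval_one, zero_sub, CharTwo.neg_eq] at h1
    exact inv_eq_of_mul_eq_one_left h1
  refine ⟨{a : F // h.eval a ≠ 0}, inferInstance, fun a => evalAway h a a.2, ?_, ?_, ?_, ?_, ?_,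
    ?_, ?_⟩
  · rintro ⟨a, ha⟩ ⟨b, hb⟩ hab
    have h1 := DFunLike.congr_fun hab ⟨_, algebraMap_mem_integralAway X⟩
    simp only [evalAway_algebraMap, eval_X] at h1
    exact Subtype.ext h1
  · rw [one_mul, ← hc, Fintype.card_subtype]
    simp_rw [hiff]
  · rw [← RatFunc.algebraMap_X]
    exact algebraMap_mem_integralAway X
  · have h1 : (RatFunc.X ^ 2 ^ m + RatFunc.X : RatFunc F) = algebraMap F[X] (RatFunc F) h := by
      simp [hh]
    rw [h1]
    exact algebraMap_inv_mem_integralAway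
  · have h1 : (RatFunc.X ^ 2 ^ m + RatFunc.X : RatFunc F) = algebraMap F[X] (RatFunc F) h := by
      simp [hh]
    rw [h1, Ne, FaithfulSMul.algebraMap_eq_zero_iff]
    exact hmon.ne_zero
  · intro P hP
    rw [evalAway_algebraMap]
    exact (hiff _).2 P.2
  · intro f hf hh' h_int
    obtain ⟨q, rfl⟩ := IsIntegrallyClosed.isIntegral_iff.1 h_int
    simp only [evalAway_algebraMap, Algebra.trace_self_apply]
    have h1 := sum_nodalWeight_mul_eval_eq_residue hρ {a | p.eval a = 0} q
    rw [hn] at h1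
    rw [← h1, Finset.sum_subtype (p := fun a => h.eval a ≠ 0) _ (by simp [hiff])]
    refine Finset.sum_congr rfl fun a _ => ?_
    rw [hweight _ ((hiff _).2 a.2)]

theorem IsTower.isTowerSeq {F E : Type u} [Field F] [Field E] [Algebra F E] [Algebra (RatFunc F) E]
    {v : AddValuation E (WithTop ℤ)} {l k : ℕ} {ξ : ℕ → E} (hl : 2 ≤ l)
    (H : IsTower (F := F) v l k ξ) : IsTowerSeq l ξ k := by
  have h0 : ∀ j ≤ k, ξ j ≠ 0 := fun j hj => AddValuation.ne_zero_of_int_eq (H.v_ξ j hj)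
  have h1 : ∀ j ≤ k, ξ j ^ l + ξ j ≠ 0 := by
    intro j hj heq
    have h2 : ξ j ^ l = -ξ j := eq_neg_of_add_eq_zero_left heq
    have h3 := AddValuation.int_pow_eq (H.v_ξ j hj) l
    rw [h2, AddValuation.map_neg, H.v_ξ j hj, WithTop.coe_eq_coe] at h3
    have h4 : (0 : ℤ) < (l : ℤ) ^ (k - j) := by positivity
    have h5 : (2 : ℤ) ≤ l := by exact_mod_cast hl
    nlinarith
  refine ⟨h0, h1, fun j hj => ?_⟩
  have h2 := H.rel j hj
  have h3 := h0 j hj.le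
  rw [eq_div_iff (h1 j hj.le)]
  have h4 : (ξ j)⁻¹ ^ l + (ξ j)⁻¹ = (ξ j ^ l + ξ j) / ξ j ^ (l + 1) := by
    rw [inv_pow, pow_succ]
    field_simp
    ring
  rwa [h4, mul_div_assoc', div_eq_one_iff_eq (pow_ne_zero _ h3)] at h2

theorem IsTower.v_base {F E : Type u} [Field F] [Field E] [Algebra F E] [Algebra F[X] E]
    [Algebra (RatFunc F) E] [IsScalarTower F[X] (RatFunc F) E] [IsScalarTower F (RatFunc F) E]
    [IsScalarTower F F[X] E]
    {v : AddValuation E (WithTop ℤ)} {l k : ℕ} {ξ : ℕ → E} (hl : 0 < l)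
    (H : IsTower (F := F) v l k ξ) {φ : RatFunc F} (hφ : φ ≠ 0) :
    v (algebraMap (RatFunc F) E φ) = ((-((l ^ k : ℕ) : ℤ) * φ.intDegree : ℤ) : WithTop ℤ) := by
  have hX : algebraMap F[X] E X = ξ 0 := by
    rw [← H.algebraMap_X, ← RatFunc.algebraMap_X, ← IsScalarTower.algebraMap_apply]
  have h1 : ∀ p : F[X], p ≠ 0 → v (algebraMap F[X] E p) =
      ((-((l ^ k : ℕ) : ℤ) * p.natDegree : ℤ) : WithTop ℤ) := by
    intro p hp
    have h2 : algebraMap F[X] E p = p.eval₂ (algebraMap F E) (ξ 0) := by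
      rw [← hX, ← aeval_def, aeval_algebraMap_apply, aeval_X_left_apply]
    rw [h2]
    have h3 := H.v_ξ 0 (Nat.zero_le _)
    rw [Nat.sub_zero] at h3
    rw [AddValuation.map_poly H.v_const (by positivity) h3 hp]
    push_cast
    rfl
  have h2 := h1 _ (RatFunc.num_ne_zero hφ)
  have h3 := AddValuation.int_inv_eq (h1 _ (RatFunc.denom_ne_zero φ))
  have h4 : algebraMap (RatFunc F) E φ =
      algebraMap F[X] E φ.num * (algebraMap F[X] E φ.denom)⁻¹ := by
    conv_lhs => rw [← RatFunc.num_div_denom φ]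
    rw [map_div₀, ← IsScalarTower.algebraMap_apply, ← IsScalarTower.algebraMap_apply,
      div_eq_mul_inv]
  rw [h4, AddValuation.int_mul_eq h2 h3, RatFunc.intDegree]
  congr 1
  ring

/-- The data propagated along the tower. -/
structure IsTowerStage {F E L : Type u} [Field F] [Field E] [Field L] [Algebra F L]
    [Algebra F[X] L] [Algebra (RatFunc F) L] [IsScalarTower F F[X] L]
    [Algebra L E] (ρ : RatFunc F →ₗ[F] F) (v : AddValuation E (WithTop ℤ)) (l k i : ℕ) (ξ : ℕ → E)
    (x : ℕ → L) : Prop where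
  algebraMap_eq : ∀ j ≤ i, algebraMap L E (x j) = ξ j
  inf : IsInfStage F (v.comap (algebraMap L E)) (l ^ (k - i))
  fin : ∀ (Γ₀ : Type u) [LinearOrderedCommGroupWithZero Γ₀] (w : Valuation L Γ₀),
    (∀ a, w (algebraMap F[X] L a) ≤ 1) → IsFinState F l w x i
  points : ∃ (ι : Type u) (_ : Fintype ι)
    (ev : ι → integralAway F L (X ^ l + X : F[X]) →ₐ[F] F),
    IsPointSystem ρ l (l ^ i) (X ^ l + X) ((X ^ l + X) ^ (l - 1) + 1) (x i) ev

namespace IsTowerStage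

theorem base {F E : Type u} [Field F] [Fintype F] [Field E] [Algebra F E] [Algebra F[X] E]
    [Algebra (RatFunc F) E] [IsScalarTower F[X] (RatFunc F) E] [IsScalarTower F (RatFunc F) E]
    [IsScalarTower F F[X] E] [CharP F 2] {m : ℕ} (hm : m ≠ 0)
    (hcard : Fintype.card F = (2 ^ m) ^ 2) {ρ : RatFunc F →ₗ[F] F} (hρ : RatFunc.IsResidue ρ)
    {v : AddValuation E (WithTop ℤ)} {k : ℕ} {ξ : ℕ → E}
    (H : IsTower (F := F) v (2 ^ m) k ξ) :
    IsTowerStage ρ v (2 ^ m) k 0 ξ fun _ => (RatFunc.X : RatFunc F) := by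
  refine ⟨fun j hj => ?_, ?_, fun Γ₀ _ w hw => ?_, ?_⟩
  · rw [Nat.le_zero.1 hj, H.algebraMap_X]
  · exact isInfStage_base (by positivity) fun φ hφ => H.v_base (by positivity) hφ
  · exact IsFinState.base (Nat.le_self_pow hm 2) (splits_X_pow_add_X hcard) hw rfl
  · rw [pow_zero]
    exact exists_isPointSystem_base hm hcard hρ

theorem isTowerSeq {F E L : Type u} [Field F] [Field E] [Field L] [Algebra F L]
    [Algebra F[X] L] [Algebra (RatFunc F) L] [IsScalarTower F F[X] L]
    [Algebra L E] {ρ : RatFunc F →ₗ[F] F} {v : AddValuation E (WithTop ℤ)} {l k i : ℕ} {ξ : ℕ → E}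
    {x : ℕ → L} (Hs : IsTowerStage ρ v l k i ξ x) (H : IsTowerSeq l ξ k) (hi : i ≤ k) :
    IsTowerSeq l x i := by
  refine ⟨fun j hj h0 => H.ne_zero j (hj.trans hi) ?_,
    fun j hj h0 => H.add_ne_zero j (hj.trans hi) ?_,
    fun j hj => (algebraMap L E).injective ?_⟩
  · rw [← Hs.algebraMap_eq j hj, h0, map_zero]
  · rw [← Hs.algebraMap_eq j hj, ← map_pow, ← map_add, h0, map_zero]
  · simp only [map_add, map_pow, map_div₀, Hs.algebraMap_eq j hj.le, Hs.algebraMap_eq (j + 1) hj]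
    exact H.eq j (hj.trans_le hi)

theorem step {F E L L' : Type u} [Field F] [Fintype F] [Field E] [Field L] [Field L'] [Algebra F E]
    [Algebra (RatFunc F) E] [Algebra F L]
    [Algebra F[X] L] [Algebra (RatFunc F) L] [IsScalarTower F F[X] L]
    [IsScalarTower F[X] (RatFunc F) L] [Algebra F L']
    [Algebra F[X] L'] [Algebra (RatFunc F) L'] [IsScalarTower F F[X] L']
    [IsScalarTower F[X] (RatFunc F) L'] [Algebra L L'] [Algebra L E] [Algebra L' E]
    [IsScalarTower L L' E] [IsScalarTower F L L'] [IsScalarTower F[X] L L']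
    [IsScalarTower (RatFunc F) L L'] [CharP F 2] {m : ℕ} (hm : m ≠ 0)
    (hcard : Fintype.card F = (2 ^ m) ^ 2) {ρ : RatFunc F →ₗ[F] F}
    {v : AddValuation E (WithTop ℤ)} {k i : ℕ} {ξ : ℕ → E} (H : IsTower (F := F) v (2 ^ m) k ξ)
    (hi : i < k) {x : ℕ → L} (Hs : IsTowerStage ρ v (2 ^ m) k i ξ x) {y : L'}
    (htop : Algebra.adjoin L {y} = ⊤) (hy : algebraMap L' E y = ξ (i + 1)) :
    IsTowerStage ρ v (2 ^ m) k (i + 1) ξ fun j => if j ≤ i then algebraMap L L' (x j) else y := by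
  have hl : 2 ≤ 2 ^ m := Nat.le_self_pow hm 2
  have : CharP L 2 := charP_of_injective_algebraMap (algebraMap F L).injective 2
  have hseq := Hs.isTowerSeq (H.isTowerSeq hl) hi.le
  have hfin := Hs.inf.finite
  have hsep := Hs.inf.separable
  have hrel : y ^ 2 ^ m + y =
      algebraMap L L' (x i ^ (2 ^ m + 1) / (x i ^ 2 ^ m + x i)) := by
    apply (algebraMap L' E).injective
    rw [← IsScalarTower.algebraMap_apply]
    simp only [map_add, map_pow, map_div₀, Hs.algebraMap_eq i le_rfl, hy]
    exact (H.isTowerSeq hl).eq i hi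
  have hq : 2 ^ m * (2 ^ m) ^ (k - (i + 1)) = (2 ^ m) ^ (k - i) := by
    rw [← pow_succ']
    congr 1
    omega
  have hinf := Hs.inf
  rw [← hq] at hinf
  have hval : ∀ f, v.comap (algebraMap L' E) (algebraMap L L' f) = v.comap (algebraMap L E) f := by
    intro f
    change v (algebraMap L' E (algebraMap L L' f)) = v (algebraMap L E f)
    rw [← IsScalarTower.algebraMap_apply]
  obtain ⟨hS, hI⟩ := hinf.step hval hl
    (by rw [Nat.cast_pow, Nat.cast_ofNat, CharTwo.two_eq_zero, zero_pow hm]) htop hrel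
    (by positivity)
    (by
      change v (algebraMap L' E y) = _
      rw [hy, H.v_ξ _ hi]
      push_cast
      rfl)
  have hlast : (if i + 1 ≤ i then algebraMap L L' (x (i + 1)) else y) = y := if_neg (by omega)
  refine ⟨fun j hj => ?_, hI, fun Γ₀ _ w hw => ?_, ?_⟩
  · split_ifs with h
    · rw [← IsScalarTower.algebraMap_apply, Hs.algebraMap_eq j h]
    · rw [hy, show j = i + 1 by omega]
  · refine IsFinState.step (splits_X_pow_add_X hcard) hw (fun a => ?_) hseq
      (fun j hj => if_pos hj) (by rw [hlast]; exact hS) (Hs.fin Γ₀ _ fun a => ?_)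
    · rw [IsScalarTower.algebraMap_apply F F[X] L']
      exact hw _
    · rw [Valuation.comap_apply, ← IsScalarTower.algebraMap_apply]
      exact hw a
  · rw [hlast, pow_succ']
    obtain ⟨ι, _, ev, hev⟩ := Hs.points
    exact hev.step hcard hS

end IsTowerStage

theorem isIntegral_of_forall_valuationSubring {A L : Type*} [CommRing A] [Field L] [Algebra A L]
    {f : L} (h : ∀ V : ValuationSubring L, (∀ a, algebraMap A L a ∈ V) → f ∈ V) :
    IsIntegral A f := by
  have h1 : f ∈ (integralClosure (Subring.closure (Set.range (algebraMap A L))) L).toSubring := by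
    rw [← iInf_valuationSubring_superset, Subring.mem_iInf]
    exact fun V => h V.1 fun a => V.2 ⟨a, rfl⟩
  have h2 : Subring.closure (Set.range (algebraMap A L)) = (algebraMap A L).range :=
    Subring.closure_eq (algebraMap A L).range
  rw [h2] at h1
  obtain ⟨p, hp, hpf⟩ := h1
  obtain ⟨q, hq, -, hqm⟩ := lifts_and_degree_eq_and_monic (f := (algebraMap A L).rangeRestrict)
    ((mem_lifts _).2 (map_surjective _ (algebraMap A L).rangeRestrict_surjective p)) hp
  refine ⟨q, hqm, ?_⟩
  rw [← hq, eval₂_map] at hpf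
  exact hpf

namespace IsTowerStage

theorem exists_stage {F E : Type u} [Field F] [Fintype F] [Field E] [Algebra F E] [Algebra F[X] E]
    [Algebra (RatFunc F) E] [IsScalarTower F[X] (RatFunc F) E] [IsScalarTower F (RatFunc F) E]
    [IsScalarTower F F[X] E] [CharP F 2] {m : ℕ} (hm : m ≠ 0)
    (hcard : Fintype.card F = (2 ^ m) ^ 2) {ρ : RatFunc F →ₗ[F] F} (hρ : RatFunc.IsResidue ρ)
    {v : AddValuation E (WithTop ℤ)} {k : ℕ} {ξ : ℕ → E}
    (H : IsTower (F := F) v (2 ^ m) k ξ) {i : ℕ} (hi : i ≤ k) :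
    ∃ (L : Type u) (_ : Field L) (_ : Algebra F L) (_ : Algebra F[X] L) (_ : Algebra (RatFunc F) L)
      (_ : Algebra L E) (_ : IsScalarTower F F[X] L) (_ : IsScalarTower F[X] (RatFunc F) L)
      (_ : IsScalarTower F (RatFunc F) L) (_ : IsScalarTower F L E) (_ : IsScalarTower F[X] L E)
      (_ : IsScalarTower (RatFunc F) L E) (x : ℕ → L), IsTowerStage ρ v (2 ^ m) k i ξ x := by
  induction i with
  | zero =>
    exact ⟨RatFunc F, inferInstance, inferInstance, inferInstance, inferInstance, inferInstance,
      inferInstance, inferInstance, inferInstance, inferInstance, inferInstance, inferInstance, _,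
      base hm hcard hρ H⟩
  | succ i ih =>
    obtain ⟨L, _, _, _, _, _, _, _, _, _, _, _, x, Hs⟩ := ih (by omega)
    have hl : 2 ≤ 2 ^ m := Nat.le_self_pow hm 2
    have h_int : IsIntegral L (ξ (i + 1)) := by
      refine ⟨X ^ 2 ^ m + X - C (x i ^ (2 ^ m + 1) / (x i ^ 2 ^ m + x i)),
        IsStep.poly_monic hl _, ?_⟩
      simp only [eval₂_sub, eval₂_add, eval₂_pow, eval₂_X, eval₂_C, map_add, map_pow, map_div₀,
        Hs.algebraMap_eq i le_rfl, (H.isTowerSeq hl).eq i hi, sub_self]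
    let L' := IntermediateField.adjoin L {ξ (i + 1)}
    have t1 : IsScalarTower F F[X] L' := .of_algebraMap_eq fun a =>
      (algebraMap L' E).injective (IsScalarTower.algebraMap_apply F F[X] E a)
    have t2 : IsScalarTower F[X] (RatFunc F) L' := .of_algebraMap_eq fun a =>
      (algebraMap L' E).injective (IsScalarTower.algebraMap_apply F[X] (RatFunc F) E a)
    have t3 : IsScalarTower F (RatFunc F) L' := .of_algebraMap_eq fun a =>
      (algebraMap L' E).injective (IsScalarTower.algebraMap_apply F (RatFunc F) E a)
    refine ⟨L', inferInstance, inferInstance, inferInstance, inferInstance, inferInstance,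
      t1, t2, t3,
      .of_algebraMap_eq fun _ => rfl, .of_algebraMap_eq fun _ => rfl,
      .of_algebraMap_eq fun _ => rfl, _,
      Hs.step hm hcard H hi (y := IntermediateField.AdjoinSimple.gen L (ξ (i + 1))) ?_
        (IntermediateField.AdjoinSimple.algebraMap_gen L (ξ (i + 1)))⟩
    exact (IntermediateField.adjoin.powerBasis h_int).adjoin_gen_eq_top

theorem isOnePoint {F E L : Type u} [Field F] [Field E] [Algebra F E] [Algebra F[X] E]
    [Algebra (RatFunc F) E] [IsScalarTower F[X] (RatFunc F) E] [IsScalarTower F (RatFunc F) E]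
    [IsScalarTower F F[X] E] [Field L] [Algebra F L] [Algebra F[X] L] [Algebra (RatFunc F) L]
    [Algebra L E] [IsScalarTower F F[X] L] [IsScalarTower F[X] (RatFunc F) L]
    [IsScalarTower F (RatFunc F) L] [IsScalarTower F L E] [IsScalarTower F[X] L E]
    [IsScalarTower (RatFunc F) L E] {ρ : RatFunc F →ₗ[F] F} {v : AddValuation E (WithTop ℤ)}
    {l k : ℕ} (hl : 2 ≤ l) {ξ : ℕ → E} {x : ℕ → L} (H : IsTower (F := F) v l k ξ)
    (Hs : IsTowerStage ρ v l k k ξ x) :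
    IsOnePoint (F := F) (v.comap (algebraMap L E)) (l ^ k) (X ^ l + X) := by
  have hinf := Hs.inf
  rw [Nat.sub_self, pow_zero] at hinf
  have hx0 : x 0 = algebraMap F[X] L X := by
    apply (algebraMap L E).injective
    rw [Hs.algebraMap_eq 0 (Nat.zero_le _), ← H.algebraMap_X, ← RatFunc.algebraMap_X,
      ← IsScalarTower.algebraMap_apply, ← IsScalarTower.algebraMap_apply]
  refine ⟨hinf.finite, hinf.separable, by positivity, fun φ hφ => ?_, fun f hf => ?_,
    ⟨x k, ?_⟩, hinf.le_trace, fun m f hf => ?_, ?_, fun f hf => ?_⟩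
  · rw [← H.v_base (by omega) hφ, IsScalarTower.algebraMap_apply (RatFunc F) L E]
    rfl
  · obtain ⟨c, hc⟩ := H.residue (algebraMap L E f) hf
    refine ⟨c, ?_⟩
    rw [IsScalarTower.algebraMap_apply F L E, ← map_sub] at hc
    exact hc
  · change v (algebraMap L E (x k)) = _
    rw [Hs.algebraMap_eq k le_rfl, H.v_ξ k le_rfl, Nat.sub_self, pow_zero]
  · have h1 := hinf.dual m f
    simp only [Nat.cast_one, mul_one] at h1
    exact h1 hf
  · have := (IsStep.poly_monic hl (0 : F)).ne_zero
    rwa [map_zero, sub_zero] at this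
  · refine isIntegral_of_forall_valuationSubring fun V hV => ?_
    rw [← V.valuation_le_one_iff]
    have h1 := (Hs.fin _ V.valuation fun a => (V.valuation_le_one_iff _).2 (hV a)).isDualBound
      (by rw [hx0]; exact (V.valuation_le_one_iff _).2 (hV X)) f hf
    rw [hx0] at h1
    simpa using h1

end IsTowerStage

theorem hasCurve_of_card_eq {F : Type u} [Field F] [Fintype F] [CharP F 2] {m : ℕ} (hm : m ≠ 0)
    (hcard : Fintype.card F = (2 ^ m) ^ 2) (k : ℕ) : HasCurve F (2 ^ m) k := by
  have hl : 2 ≤ 2 ^ m := Nat.le_self_pow hm 2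
  obtain ⟨ρ, hρ⟩ := RatFunc.exists_isResidue F
  obtain ⟨E, _, _, _, _, _, _, _, v, ξ, H⟩ := exists_isTower F hl k
  obtain ⟨L, _, _, _, _, _, _, _, _, _, _, _, x, Hs⟩ :=
    IsTowerStage.exists_stage hm hcard hρ H le_rfl
  obtain ⟨ι, _, ev, hev⟩ := Hs.points
  have hp := X_pow_add_X_pow_sub_one_add_one_monic (F := F) hl
  have h1 := Hs.isOnePoint hl H
  have hdeg := IsStep.poly_natDegree hl (0 : F)
  rw [map_zero, sub_zero] at hdeg
  exact ⟨L, ι, _, _, _, _, _, inferInstance, inferInstance, inferInstance, _, _, _, ρ, _, hρ, h1,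
    hev.isEvalSystem h1.h_ne_zero hp.1.ne_zero, hdeg, hp.2⟩

end

/-- Corollary 2 of the paper: asymptotically good families of triples
`C' ⊇ C ⊇ C^⊥` of `2^(2m)`-ary algebraic geometry codes with parameters
`R' = 1 − α' + γ`, `δ' ≥ α' − 2γ`, `R = 1 − α + γ`, `δ ≥ α − 2γ`,
where `γ = 1/(2^m − 2)`. -/
theorem ag_code_triples
    (m : ℕ) (hm : 3 ≤ m)
    (K : Type*) [Field K] [Fintype K] (hcard : Fintype.card K = 2 ^ (2 * m))
    (γ : ℝ) (hγ : γ = 1 / (2 ^ m - 2))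
    (α' α : ℝ) (h1 : 2 * γ ≤ α') (h2 : α' ≤ α) (h3 : α ≤ 1 / 2 + γ) :
    ∀ ε : ℝ, 0 < ε → ∀ N : ℕ, ∃ n : ℕ, N ≤ n ∧
      ∃ C C' : Submodule K (Fin n → K), C ≤ C' ∧
        (∀ x : Fin n → K, (∀ y ∈ C, ∑ i, x i * y i = 0) → x ∈ C) ∧
        ((1 - α' + γ - ε) * n ≤ (Module.finrank K C' : ℝ) ∧
          ∀ x ∈ C', x ≠ (0 : Fin n → K) →
            (α' - 2 * γ - ε) * n ≤ ({i | x i ≠ 0}.ncard : ℝ)) ∧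
        ((1 - α + γ - ε) * n ≤ (Module.finrank K C : ℝ) ∧
          ∀ x ∈ C, x ≠ (0 : Fin n → K) →
            (α - 2 * γ - ε) * n ≤ ({i | x i ≠ 0}.ncard : ℝ)) := by
  have := charP_two_of_card_eq hcard
  exact ag_code_triples_of_hasCurve m hm K hcard
    (hasCurve_of_card_eq (by omega) (by rw [hcard, ← pow_mul, mul_comm])) γ hγ α' α h1 h2 h3
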